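/- Let a ≥ 3 be an integer and let Z be a general set of n(a) = (3/2)a(a−1) + 2a points on a smooth cubic surface X ⊂ ℙ³. Then the graded minimal free resolution of the saturated ideal I_Z over R is 0 → R(−a−3)^{2a−1} → R(−a−2)^{3a} → R(−a)^{a+1} ⊕ R(−3) → I_Z → 0. -/

import Mathlib

/-!
Common definitions for formalizing "The minimal resolution conjecture for points
on the cubic surface" (arXiv:math/0611137).

We work with `R = k[x₀,x₁,x₂,x₃]`, closed points of `ℙ³` modeled by
`Projectivization k (Fin 4 → k)`, saturated ideals of sets of points as vanishing
ideals, genericity expressed by a nonempty basic open subset of the configuration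
space, and graded minimal free resolutions expressed by explicit homogeneous
matrices whose entries have zero constant term (no nonzero scalar entries).
-/

open MvPolynomial

noncomputable section

/-- The polynomial ring `R = k[x₀,x₁,x₂,x₃]` in four variables over `k`. -/
abbrev R4 (k : Type) [Field k] : Type := MvPolynomial (Fin 4) k

/-- The (closed) points of the projective space `ℙ³` over `k`. -/
abbrev P3 (k : Type) [Field k] : Type := Projectivization k (Fin 4 → k)

variable (k : Type) [Field k]

/-- A polynomial vanishes at a projective point if it vanishes at every
representative vector of that point. -/
def VanishesAt (f : R4 k) (p : P3 k) : Prop :=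
  ∀ (v : Fin 4 → k) (hv : v ≠ 0), Projectivization.mk k v hv = p → eval v f = 0

/-- The saturated homogeneous ideal `I_Z ⊆ R` of a set `Z` of (reduced) points of
`ℙ³`: all polynomials vanishing at every point of `Z`. -/
def pointsIdeal (Zs : Set (P3 k)) : Ideal (R4 k) where
  carrier := {f | ∀ p ∈ Zs, VanishesAt k f p}
  zero_mem' := by
    intro p _ v hv _
    simp
  add_mem' := by
    intro a b ha hb p hp v hv hmk
    have h1 := ha p hp v hv hmk
    have h2 := hb p hp v hv hmk
    simp [h1, h2]
  smul_mem' := by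
    intro c a ha p hp v hv hmk
    have h1 := ha p hp v hv hmk
    simp [smul_eq_mul, h1]

/-- An ideal of `R` is homogeneous if it is generated by homogeneous elements. -/
def IsHomogIdeal (I : Ideal (R4 k)) : Prop :=
  ∃ G : Set (R4 k), (∀ g ∈ G, ∃ d : ℕ, g.IsHomogeneous d) ∧ I = Ideal.span G

/-- Saturation of an ideal with respect to the irrelevant maximal ideal
`(x₀,…,x₃)`. -/
def satIdeal (I : Ideal (R4 k)) : Ideal (R4 k) where
  carrier := {g | ∀ i : Fin 4, ∃ N : ℕ, (X i : R4 k) ^ N * g ∈ I}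
  zero_mem' := by
    intro i
    exact ⟨0, by simp⟩
  add_mem' := by
    intro a b ha hb i
    obtain ⟨N, hN⟩ := ha i
    obtain ⟨M, hM⟩ := hb i
    refine ⟨N + M, ?_⟩
    have h1 : (X i : R4 k) ^ (N + M) * (a + b)
        = X i ^ M * (X i ^ N * a) + X i ^ N * (X i ^ M * b) := by ring
    rw [h1]
    exact Ideal.add_mem _ (Ideal.mul_mem_left _ _ hN) (Ideal.mul_mem_left _ _ hM)
  smul_mem' := by
    intro c a ha i
    obtain ⟨N, hN⟩ := ha i
    refine ⟨N, ?_⟩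
    have h1 : (X i : R4 k) ^ N * (c • a) = c * (X i ^ N * a) := by
      rw [smul_eq_mul]; ring
    rw [h1]
    exact Ideal.mul_mem_left _ _ hN

/-- The colon ideal `(I : J) = {r | r·J ⊆ I}`. -/
def icolon (I J : Ideal (R4 k)) : Ideal (R4 k) where
  carrier := {r | ∀ x ∈ J, r * x ∈ I}
  zero_mem' := by
    intro x hx
    rw [zero_mul]; exact I.zero_mem
  add_mem' := by
    intro a b ha hb x hx
    rw [add_mul]
    exact Ideal.add_mem _ (ha x hx) (hb x hx)
  smul_mem' := by
    intro c a ha x hx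
    rw [smul_eq_mul, mul_assoc]
    exact Ideal.mul_mem_left _ _ (ha x hx)

/-- A smooth cubic surface `X ⊂ ℙ³`: an irreducible homogeneous cubic form with
no singular zero (Jacobian criterion). -/
structure SmoothCubicSurface (k : Type) [Field k] : Type where
  f : MvPolynomial (Fin 4) k
  homog : f.IsHomogeneous 3
  irred : Irreducible f
  smooth : ∀ v : Fin 4 → k, v ≠ 0 → eval v f = 0 →
    ∃ i : Fin 4, eval v (pderiv i f) ≠ 0

/-- A configuration of `t` distinct points lying on `X`. -/
def ConfigOn (S : SmoothCubicSurface k) {t : ℕ} (Z : Fin t → P3 k) : Prop :=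
  Function.Injective Z ∧ ∀ i, VanishesAt k S.f (Z i)

/-- A configuration avoids the (closed locus of the) polynomial `g` on the
product of the affine cones: some choice of representatives does not annihilate `g`. -/
def Avoids {t : ℕ} (g : MvPolynomial (Fin t × Fin 4) k) (Z : Fin t → P3 k) : Prop :=
  ∃ v : Fin t → Fin 4 → k,
    (∀ i, ∃ hv : v i ≠ 0, Projectivization.mk k (v i) hv = Z i) ∧
    eval (fun q : Fin t × Fin 4 => v q.1 q.2) g ≠ 0

/-- `P` holds for a *general* set of `t` points on `X`: it holds on a nonempty
(basic) Zariski-open subset of the family of all sets of `t` points of `X`. -/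
def GeneralPointsSatisfy (S : SmoothCubicSurface k) (t : ℕ)
    (P : (Fin t → P3 k) → Prop) : Prop :=
  ∃ g : MvPolynomial (Fin t × Fin 4) k,
    (∃ Z : Fin t → P3 k, ConfigOn k S Z ∧ Avoids k g Z) ∧
    (∀ Z : Fin t → P3 k, ConfigOn k S Z → Avoids k g Z → P Z)

/-- An admissible entry of a matrix in a graded **minimal** free resolution,
mapping a generator of degree `d` into a generator of degree `e`: the entry is
homogeneous of degree `d - e`, and it is not a nonzero scalar (zero constant
coefficient). -/
def EntryOk (d e : ℕ) (q : R4 k) : Prop :=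
  (q = 0 ∨ ∃ c : ℕ, d = e + c ∧ q.IsHomogeneous c) ∧ coeff 0 q = 0

/-- Integer-degree version of `EntryOk` (for modules with generators of
arbitrary integer degrees). -/
def EntryOkZ (d e : ℤ) (q : R4 k) : Prop :=
  (q = 0 ∨ ∃ c : ℕ, d = e + (c : ℤ) ∧ q.IsHomogeneous c) ∧ coeff 0 q = 0

/-- The body of a graded minimal free resolution of length 2 over `R` of the
`R`-module `I/J`:
`0 → ⊕ R(-d2 i) --M2--> ⊕ R(-d1 j) --g--> I/J → 0`.
The generators `g j ∈ I` are homogeneous of degree `d1 j` and generate `I` mod `J`;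
`M2` is a homogeneous matrix with no nonzero scalar entries whose rows generate the
kernel, and which is injective. -/
def Res2Body (J I : Ideal (R4 k)) {n1 n2 : ℕ}
    (d1 : Fin n1 → ℕ) (d2 : Fin n2 → ℕ)
    (g : Fin n1 → R4 k) (M2 : Fin n2 → Fin n1 → R4 k) : Prop :=
  (∀ j, g j ∈ I ∧ (g j).IsHomogeneous (d1 j)) ∧
  (∀ x ∈ I, ∃ w : Fin n1 → R4 k, x - ∑ j, w j * g j ∈ J) ∧
  (∀ i j, EntryOk k (d2 i) (d1 j) (M2 i j)) ∧
  (∀ w : Fin n1 → R4 k,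
    ((∑ j, w j * g j) ∈ J) ↔ ∃ u : Fin n2 → R4 k, ∀ j, w j = ∑ i, u i * M2 i j) ∧
  (∀ u : Fin n2 → R4 k, (∀ j, (∑ i, u i * M2 i j) = 0) → u = 0)

/-- `I/J` has a graded minimal free resolution
`0 → ⊕ R(-d2 i) → ⊕ R(-d1 j) → I/J → 0` over `R`. -/
def HasMinFreeRes2 (J I : Ideal (R4 k)) {n1 n2 : ℕ}
    (d1 : Fin n1 → ℕ) (d2 : Fin n2 → ℕ) : Prop :=
  ∃ (g : Fin n1 → R4 k) (M2 : Fin n2 → Fin n1 → R4 k), Res2Body k J I d1 d2 g M2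

/-- The body of a graded minimal free resolution of length 3 over `R` of the
`R`-module `I/J`:
`0 → ⊕ R(-d3 l) --M3--> ⊕ R(-d2 i) --M2--> ⊕ R(-d1 j) --g--> I/J → 0`. -/
def Res3Body (J I : Ideal (R4 k)) {n1 n2 n3 : ℕ}
    (d1 : Fin n1 → ℕ) (d2 : Fin n2 → ℕ) (d3 : Fin n3 → ℕ)
    (g : Fin n1 → R4 k) (M2 : Fin n2 → Fin n1 → R4 k)
    (M3 : Fin n3 → Fin n2 → R4 k) : Prop :=
  (∀ j, g j ∈ I ∧ (g j).IsHomogeneous (d1 j)) ∧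
  (∀ x ∈ I, ∃ w : Fin n1 → R4 k, x - ∑ j, w j * g j ∈ J) ∧
  (∀ i j, EntryOk k (d2 i) (d1 j) (M2 i j)) ∧
  (∀ i j, EntryOk k (d3 i) (d2 j) (M3 i j)) ∧
  (∀ w : Fin n1 → R4 k,
    ((∑ j, w j * g j) ∈ J) ↔ ∃ u : Fin n2 → R4 k, ∀ j, w j = ∑ i, u i * M2 i j) ∧
  (∀ u : Fin n2 → R4 k,
    (∀ j, (∑ i, u i * M2 i j) = 0) ↔ ∃ t : Fin n3 → R4 k, ∀ i, u i = ∑ l, t l * M3 l i) ∧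
  (∀ t : Fin n3 → R4 k, (∀ i, (∑ l, t l * M3 l i) = 0) → t = 0)

/-- `I/J` has a graded minimal free resolution
`0 → ⊕ R(-d3 l) → ⊕ R(-d2 i) → ⊕ R(-d1 j) → I/J → 0` over `R`.
Taking `J = ⊥` this is a resolution of the ideal `I ⊆ R`; taking `J = (f)` it is a
resolution of `I/(f) ⊆ R_X = R/(f)`; taking `J = I_C` a resolution of `I/I_C`. -/
def HasMinFreeRes3 (J I : Ideal (R4 k)) {n1 n2 n3 : ℕ}
    (d1 : Fin n1 → ℕ) (d2 : Fin n2 → ℕ) (d3 : Fin n3 → ℕ) : Prop :=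
  ∃ (g : Fin n1 → R4 k) (M2 : Fin n2 → Fin n1 → R4 k) (M3 : Fin n3 → Fin n2 → R4 k),
    Res3Body k J I d1 d2 d3 g M2 M3

/-- The Betti numbers read off from a minimal free resolution
`0 → F₃ → F₂ → F₁ → I_Z → 0` of the ideal of `Z` (so that
`F_i = ⊕_j R(-i-j)^{b_{i,j}}` in the resolution of `R/I_Z`, with `F₀ = R`). -/
def bettiCount {n1 n2 n3 : ℕ} (d1 : Fin n1 → ℕ) (d2 : Fin n2 → ℕ) (d3 : Fin n3 → ℕ)
    (i j : ℕ) : ℕ :=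
  if i = 0 then (if j = 0 then 1 else 0)
  else if i = 1 then (Finset.univ.filter fun l => d1 l = 1 + j).card
  else if i = 2 then (Finset.univ.filter fun l => d2 l = 2 + j).card
  else if i = 3 then (Finset.univ.filter fun l => d3 l = 3 + j).card
  else 0

/-- The Hilbert polynomial `P_X(t) = (3/2)t(t+1) + 1` of the cubic surface. -/
def PXcubic (t : ℕ) : ℕ := 3 * (t * (t + 1) / 2) + 1

/-- The saturated homogeneous ideal of an integral curve lying on `X`. -/
def IsCurveIdealOn (S : SmoothCubicSurface k) (I : Ideal (R4 k)) : Prop :=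
  IsHomogIdeal k I ∧ I.IsPrime ∧ S.f ∈ I ∧
    ringKrullDim (R4 k ⧸ I) = ((2 : ℕ∞) : WithBot ℕ∞)

/-- The Jacobian criterion at a point of the cone: some 2×2 minor of the Jacobian
matrix of elements of `I` is nonzero, i.e. the curve is smooth there. -/
def CurveSmoothAt (I : Ideal (R4 k)) (v : Fin 4 → k) : Prop :=
  ∃ g₁ ∈ I, ∃ g₂ ∈ I, ∃ i j : Fin 4,
    eval v (pderiv i g₁) * eval v (pderiv j g₂)
      - eval v (pderiv j g₁) * eval v (pderiv i g₂) ≠ 0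

/-- A smooth (integral) curve on `X`. -/
def IsSmoothCurveIdealOn (S : SmoothCubicSurface k) (I : Ideal (R4 k)) : Prop :=
  IsCurveIdealOn k S I ∧
  ∀ v : Fin 4 → k, v ≠ 0 → (∀ g ∈ I, eval v g = 0) → CurveSmoothAt k I v

/-- The coordinate ring `R/I` of a curve has depth 2 (a regular sequence of two
positive-degree homogeneous elements), i.e. the curve is arithmetically
Cohen–Macaulay. -/
def IsACMIdeal (I : Ideal (R4 k)) : Prop :=
  ∃ r₁ r₂ : R4 k,
    (∃ d₁ : ℕ, 0 < d₁ ∧ r₁.IsHomogeneous d₁) ∧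
    (∃ d₂ : ℕ, 0 < d₂ ∧ r₂.IsHomogeneous d₂) ∧
    (∀ x : R4 k, r₁ * x ∈ I → x ∈ I) ∧
    (∀ x : R4 k, r₂ * x ∈ I ⊔ Ideal.span {r₁} → x ∈ I ⊔ Ideal.span {r₁})

/-- The Hilbert function `t ↦ dim_k (R/I)_t`. -/
def hilbFn (I : Ideal (R4 k)) (t : ℕ) : ℕ :=
  Module.finrank k ↥(homogeneousSubmodule (Fin 4) k t) -
    Module.finrank k ↥(homogeneousSubmodule (Fin 4) k t ⊓
      Submodule.restrictScalars k I)

/-- The subscheme with saturated ideal `I` has degree `d` and (arithmetic) genus `g`,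
read off from the Hilbert polynomial `P(t) = d·t + 1 - g`. -/
def HasDegreeGenus (I : Ideal (R4 k)) (d : ℕ) (g : ℤ) : Prop :=
  ∃ N : ℕ, ∀ t : ℕ, N ≤ t → (hilbFn k I t : ℤ) = d * t + 1 - g

/-- Linear equivalence of divisors on `X`: the divisor with (divisorial) ideal `I`
is linearly equivalent to (divisor of `J`) + `a·H`, where `H` is the hyperplane
class.  Concretely, there are homogeneous forms `q, p` with `deg p = deg q + a`,
nonzero on `X`, with `q·I = p·J` in `R_X = R/(f)`.  (Taking `J = ⊤` expresses
that the divisor of `I` is linearly equivalent to `aH`.) -/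
def LinEquivOnX (S : SmoothCubicSurface k) (I J : Ideal (R4 k)) (a : ℤ) : Prop :=
  ∃ (mq mp : ℕ) (q p : R4 k), (mp : ℤ) = (mq : ℤ) + a ∧
    q.IsHomogeneous mq ∧ p.IsHomogeneous mp ∧
    q ∉ Ideal.span {S.f} ∧ p ∉ Ideal.span {S.f} ∧
    Ideal.span {q} * I ⊔ Ideal.span {S.f} = Ideal.span {p} * J ⊔ Ideal.span {S.f}

/-- Linear equivalence, on the curve `C` with ideal `IC`, of the divisor with
ideal `IG` to `r·H_C` (`H_C` the hyperplane section of `C`): there are homogeneous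
forms `q, p`, nonzero on `C`, with `deg p = deg q + r` and `q·I_{G,C} = (p)` in
`R/I_C`. -/
def DivOnCurveEquivH (IC IG : Ideal (R4 k)) (r : ℤ) : Prop :=
  ∃ (mq mp : ℕ) (q p : R4 k), (mp : ℤ) = (mq : ℤ) + r ∧
    q.IsHomogeneous mq ∧ p.IsHomogeneous mp ∧ q ∉ IC ∧ p ∉ IC ∧
    Ideal.span {q} * IG ⊔ IC = Ideal.span {p} ⊔ IC

/-- The saturated homogeneous ideal of a zero-dimensional subscheme of `ℙ³`. -/
def IsZeroDimIdeal (I : Ideal (R4 k)) : Prop :=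
  IsHomogIdeal k I ∧ satIdeal k I = I ∧
    ringKrullDim (R4 k ⧸ I) = ((1 : ℕ∞) : WithBot ℕ∞)

/-- An arithmetically Gorenstein zero-dimensional subscheme of `ℙ³`: its ideal has a
graded minimal free resolution of length 3 whose last free module has rank one. -/
def IsAGPointsIdeal (I : Ideal (R4 k)) : Prop :=
  IsZeroDimIdeal k I ∧
  ∃ (n1 n2 : ℕ) (d1 : Fin n1 → ℕ) (d2 : Fin n2 → ℕ) (s : ℕ),
    HasMinFreeRes3 k ⊥ I d1 d2 (fun _ : Fin 1 => s)

/-- `V₁` and `V₂` are directly Gorenstein linked by the arithmetically Gorenstein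
scheme with ideal `IG`: `I_G ⊆ I_{V₁} ∩ I_{V₂}`, `I_G : I_{V₁} = I_{V₂}` and
`I_G : I_{V₂} = I_{V₁}`. -/
def IsGLinked (IG I1 I2 : Ideal (R4 k)) : Prop :=
  IG ≤ I1 ⊓ I2 ∧ icolon k IG I1 = I2 ∧ icolon k IG I2 = I1

/-- The divisor `G` (with ideal `IG`) on the curve `C ⊂ X` (with ideal `IC`) is
linearly equivalent to `m·H_C - K_C`.  By adjunction on the cubic surface
(`K_X = -H`) this says `G + C|_C ∼ (m+1)·H_C` on `C`, where `C|_C` is realized as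
the scheme-theoretic intersection `C ∩ C'` with any curve `C' ∼ C`, `C' ≠ C`,
chosen disjoint from `G`. -/
def EquivHminusKC (S : SmoothCubicSurface k) (IC IG : Ideal (R4 k)) (m : ℤ) : Prop :=
  ∃ IC' : Ideal (R4 k), IsCurveIdealOn k S IC' ∧ IC' ≠ IC ∧
    LinEquivOnX k S IC' IC 0 ∧
    satIdeal k (satIdeal k (IC ⊔ IC') ⊔ IG) = ⊤ ∧
    DivOnCurveEquivH k IC (IG ⊓ satIdeal k (IC ⊔ IC')) (m + 1)

/-- A line on `X`: a smooth integral curve of degree 1, genus 0 on `X`. -/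
def IsLineOn (S : SmoothCubicSurface k) (I : Ideal (R4 k)) : Prop :=
  IsSmoothCurveIdealOn k S I ∧ HasDegreeGenus k I 1 0

/-- A smooth conic on `X`: a smooth integral curve of degree 2, genus 0 on `X`. -/
def IsConicOn (S : SmoothCubicSurface k) (I : Ideal (R4 k)) : Prop :=
  IsSmoothCurveIdealOn k S I ∧ HasDegreeGenus k I 2 0

/-- A twisted cubic on `X`: a smooth integral curve of degree 3, genus 0 on `X`. -/
def IsTwistedCubicOn (S : SmoothCubicSurface k) (I : Ideal (R4 k)) : Prop :=
  IsSmoothCurveIdealOn k S I ∧ HasDegreeGenus k I 3 0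

/-- The curve `C ⊂ X` moves in a linear system of (projective) dimension `dim`,
i.e. `h⁰(O_X(C)) = dim + 1`.  Global sections of `O_X(C)` are computed, for any
homogeneous `q ∈ I_C` of degree `s` not divisible by `f`, as the degree-`s` part of
the colon ideal `((q, f) : I_C)` modulo `(f)`. -/
def MovesInLinSysOfDim (S : SmoothCubicSurface k) (IC : Ideal (R4 k)) (dim : ℤ) : Prop :=
  ∀ (s : ℕ) (q : R4 k), q.IsHomogeneous s → q ∈ IC → q ∉ Ideal.span {S.f} →
    (Module.finrank k ↥(homogeneousSubmodule (Fin 4) k s ⊓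
        Submodule.restrictScalars k (icolon k (Ideal.span {q} ⊔ Ideal.span {S.f}) IC)) : ℤ)
      - (Module.finrank k ↥(homogeneousSubmodule (Fin 4) k s ⊓
        Submodule.restrictScalars k (icolon k (Ideal.span {q} ⊔ Ideal.span {S.f}) IC) ⊓
        Submodule.restrictScalars k (Ideal.span {S.f})) : ℤ) = dim + 1

/-- `I/(f₀)` is a maximal Cohen–Macaulay module over `R/(f₀)` (3-dimensional):
it admits a regular sequence of three positive-degree homogeneous elements. -/
def IsMCMQuotient (f0 : R4 k) (I : Ideal (R4 k)) : Prop :=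
  ∃ r₁ r₂ r₃ : R4 k,
    (∃ d : ℕ, 0 < d ∧ r₁.IsHomogeneous d) ∧
    (∃ d : ℕ, 0 < d ∧ r₂.IsHomogeneous d) ∧
    (∃ d : ℕ, 0 < d ∧ r₃.IsHomogeneous d) ∧
    (∀ x ∈ I, r₁ * x ∈ Ideal.span {f0} → x ∈ Ideal.span {f0}) ∧
    (∀ x ∈ I, r₂ * x ∈ Ideal.span {r₁} * I ⊔ Ideal.span {f0} →
      x ∈ Ideal.span {r₁} * I ⊔ Ideal.span {f0}) ∧
    (∀ x ∈ I, r₃ * x ∈ Ideal.span {r₁} * I ⊔ Ideal.span {r₂} * I ⊔ Ideal.span {f0} →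
      x ∈ Ideal.span {r₁} * I ⊔ Ideal.span {r₂} * I ⊔ Ideal.span {f0}) ∧
    (∃ x ∈ I, x ∉ Ideal.span {r₁} * I ⊔ Ideal.span {r₂} * I ⊔ Ideal.span {r₃} * I
      ⊔ Ideal.span {f0})

end

section Graded
variable {σ K : Type*} [Field K]

theorem homogeneousComponent_mul_left {p : MvPolynomial σ K} {m : ℕ} (hp : p.IsHomogeneous m)
    (q : MvPolynomial σ K) (n : ℕ) :
    homogeneousComponent (m + n) (p * q) = p * homogeneousComponent n q := by
  conv_lhs => rw [← sum_homogeneousComponent q, Finset.mul_sum, map_sum]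
  have h : ∀ i, homogeneousComponent (m + n) (p * homogeneousComponent i q) =
      if i = n then p * homogeneousComponent n q else 0 := by
    intro i
    rw [homogeneousComponent_of_mem (hp.mul (homogeneousComponent_isHomogeneous i q))]
    by_cases hi : i = n
    · subst hi; simp
    · rw [if_neg (by omega), if_neg hi]
  simp only [h, Finset.sum_ite_eq', Finset.mem_range]
  split_ifs with hn
  · rfl
  · rw [homogeneousComponent_eq_zero n q (by omega), mul_zero]

theorem homogeneousComponent_mul_left_of_lt {p : MvPolynomial σ K} {m : ℕ}
    (hp : p.IsHomogeneous m) (q : MvPolynomial σ K) {t : ℕ} (ht : t < m) :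
    homogeneousComponent t (p * q) = 0 := by
  conv_lhs => rw [← sum_homogeneousComponent q, Finset.mul_sum, map_sum]
  refine Finset.sum_eq_zero fun i _ => ?_
  rw [homogeneousComponent_of_mem (hp.mul (homogeneousComponent_isHomogeneous i q)),
    if_neg (by omega)]

theorem exists_homogeneous_of_dvd {p F : MvPolynomial σ K} {m n : ℕ} (hp : p.IsHomogeneous m)
    (hF : F.IsHomogeneous (m + n)) (h : p ∣ F) :
    ∃ G : MvPolynomial σ K, G.IsHomogeneous n ∧ F = p * G := by
  obtain ⟨G, rfl⟩ := h
  refine ⟨homogeneousComponent n G, homogeneousComponent_isHomogeneous n G, ?_⟩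
  rw [← homogeneousComponent_mul_left hp, homogeneousComponent_eq_self hF]

theorem eq_zero_of_dvd_of_degree_lt {p F : MvPolynomial σ K} {m n : ℕ} (hp : p.IsHomogeneous m)
    (hF : F.IsHomogeneous n) (h : p ∣ F) (hn : n < m) : F = 0 := by
  obtain ⟨G, rfl⟩ := h
  rw [← homogeneousComponent_eq_self hF, homogeneousComponent_mul_left_of_lt hp _ hn]

theorem exists_eq_C_of_isHomogeneous_zero {F : MvPolynomial σ K} (hF : F.IsHomogeneous 0) :
    ∃ c : K, F = C c :=
  ⟨coeff 0 F, by rw [← homogeneousComponent_zero, homogeneousComponent_eq_self hF]⟩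

instance homogeneousSubmodule_finite [Finite σ] (n : ℕ) :
    Module.Finite K (homogeneousSubmodule σ K n) :=
  Module.Finite.iff_fg.2 (homogeneousSubmodule_fg σ K n)

theorem finrank_homogeneousSubmodule (m n : ℕ) :
    Module.finrank K (homogeneousSubmodule (Fin (m + 1)) K n) = (n + m).choose m := by
  rw [homogeneousSubmodule_eq_finsupp_supported]
  rw [(AddMonoidAlgebra.supportedEquivFinsupp (R := K) (S := K)
    {d : Fin (m + 1) →₀ ℕ | d.degree = n}).finrank_eq]
  let e : Sym (Fin (m + 1)) n ≃ {d : Fin (m + 1) →₀ ℕ | d.degree = n} :=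
    (Sym.equivNatSum (Fin (m + 1)) n).trans (Equiv.subtypeEquivRight fun d => Iff.rfl)
  have : Fintype {d : Fin (m + 1) →₀ ℕ | d.degree = n} := Fintype.ofEquiv _ e
  rw [Module.finrank_finsupp_self, ← Fintype.card_congr e, Sym.card_sym_eq_choose]
  simp only [Fintype.card_fin]
  rw [show m + 1 + n - 1 = n + m by omega, Nat.choose_symm_add]

end Graded

section Generic
variable {K : Type*} [Field K] [Infinite K]

theorem exists_points_separating {τ ι : Type*} [Finite ι] (N : ℕ)
    (E : ι → Submodule K (MvPolynomial τ K)) (hfin : ∀ i, Module.Finite K (E i))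
    (hE : ∀ i, Module.finrank K (E i) ≤ N) {h : MvPolynomial τ K} (hh : h ≠ 0) :
    ∃ p : Fin N → τ → K, (∀ j, eval (p j) h ≠ 0) ∧
      ∀ i, ∀ e ∈ E i, (∀ j, eval (p j) e = 0) → e = 0 := by
  classical
  have := Fintype.ofFinite ι
  induction N generalizing E with
  | zero =>
    refine ⟨Fin.elim0, fun j => j.elim0, fun i e he _ => ?_⟩
    have := hfin i
    have h0 : E i = ⊥ := Submodule.finrank_eq_zero.1 (Nat.le_zero.1 (hE i))
    rw [h0] at he
    simpa using he
  | succ N ih =>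
    have hex : ∀ i, ∃ e : MvPolynomial τ K, e ≠ 0 ∧ (E i ≠ ⊥ → e ∈ E i) := by
      intro i
      by_cases hb : E i = ⊥
      · exact ⟨1, one_ne_zero, fun h => (h hb).elim⟩
      · obtain ⟨e, he, he0⟩ := Submodule.exists_mem_ne_zero_of_ne_bot hb
        exact ⟨e, he0, fun _ => he⟩
    choose e he0 he using hex
    have hprod : h * ∏ i, e i ≠ 0 :=
      mul_ne_zero hh (Finset.prod_ne_zero_iff.2 fun i _ => he0 i)
    obtain ⟨p, hp⟩ : ∃ p, eval p (h * ∏ i, e i) ≠ 0 := by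
      by_contra! hc
      exact hprod (MvPolynomial.funext fun x => by simpa using hc x)
    rw [map_mul, map_prod] at hp
    have hp1 := left_ne_zero_of_mul hp
    have hp2 := Finset.prod_ne_zero_iff.1 (right_ne_zero_of_mul hp)
    let ev : MvPolynomial τ K →ₗ[K] K := (aeval p).toLinearMap
    have hev : ∀ x, ev x = eval p x := fun x => by
      simp [ev, aeval_eq_eval]
    have hle : ∀ i, E i ⊓ LinearMap.ker ev ≤ E i := fun i => inf_le_left
    have hfin' : ∀ i, Module.Finite K (E i ⊓ LinearMap.ker ev : Submodule K _) := fun i => by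
      have := hfin i
      exact Submodule.finiteDimensional_of_le (hle i)
    obtain ⟨P, hP1, hP2⟩ := ih (fun i => E i ⊓ LinearMap.ker ev) hfin' (fun i => by
      have := hfin i
      by_cases hb : E i = ⊥
      · have : Module.finrank K (E i ⊓ LinearMap.ker ev : Submodule K _) ≤ Module.finrank K (E i) :=
          Submodule.finrank_mono (hle i)
        rw [hb, finrank_bot] at this
        rw [hb]; omega
      · have hlt : E i ⊓ LinearMap.ker ev < E i := by
          refine lt_of_le_of_ne (hle i) fun heq => hp2 i (Finset.mem_univ i) ?_
          have : e i ∈ E i ⊓ LinearMap.ker ev := by rw [heq]; exact he i hb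
          rw [← hev]; exact this.2
        have := Submodule.finrank_lt_finrank_of_lt hlt
        have := hE i
        omega)
    refine ⟨Fin.cons p P, fun j => ?_, fun i x hx hj => ?_⟩
    · refine Fin.cases ?_ (fun j => ?_) j
      · simpa using hp1
      · simpa using hP1 j
    · refine hP2 i x ⟨hx, ?_⟩ fun j => by simpa using hj j.succ
      change ev x = 0; rw [hev]
      simpa using hj 0

end Generic

section Restrict
variable {K : Type*} [Field K]

/-- Restriction of polynomials to the hyperplane where the last coordinate vanishes. -/
noncomputable def killLast (m : ℕ) : MvPolynomial (Fin (m + 1)) K →ₐ[K] MvPolynomial (Fin m) K :=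
  aeval (Fin.snoc (α := fun _ => MvPolynomial (Fin m) K) X 0)

theorem killLast_X_castSucc {m : ℕ} (i : Fin m) :
    killLast (K := K) m (X i.castSucc) = X i := by
  simp [killLast]

theorem killLast_X_last {m : ℕ} : killLast (K := K) m (X (Fin.last m)) = 0 := by
  simp [killLast]

theorem X_last_dvd_of_killLast_eq_zero {m : ℕ} {p : MvPolynomial (Fin (m + 1)) K}
    (h : killLast m p = 0) : X (Fin.last m) ∣ p := by
  have key : ∀ p : MvPolynomial (Fin (m + 1)) K,
      X (Fin.last m) ∣ p - rename Fin.castSucc (killLast m p) := by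
    intro p
    induction p using MvPolynomial.induction_on with
    | C c => simp [killLast, algebraMap_eq]
    | add p q hp hq =>
      have := dvd_add hp hq
      rwa [map_add, map_add, show ∀ a b c d : MvPolynomial (Fin (m + 1)) K,
        a + b - (c + d) = (a - c) + (b - d) by intros; ring]
    | mul_X p i hp =>
      rw [map_mul, map_mul]
      refine Fin.lastCases ?_ (fun i => ?_) i
      · rw [killLast_X_last, map_zero, mul_zero, sub_zero]; exact dvd_mul_left _ _
      · rw [killLast_X_castSucc, rename_X, ← sub_mul]; exact dvd_mul_of_dvd_left hp _
  simpa [h] using key p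

theorem killLast_isHomogeneous {m n : ℕ} {p : MvPolynomial (Fin (m + 1)) K}
    (h : p.IsHomogeneous n) : (killLast m p).IsHomogeneous n := by
  have := h.aeval (Fin.snoc (α := fun _ => MvPolynomial (Fin m) K) X 0) (n := 1) (fun i => by
    refine Fin.lastCases ?_ (fun i => ?_) i
    · simpa using isHomogeneous_zero _ _ _
    · simpa using isHomogeneous_X _ _)
  simpa [killLast] using this

theorem eval_killLast {m : ℕ} (p : MvPolynomial (Fin (m + 1)) K) (x : Fin m → K) :
    eval x (killLast m p) = eval (Fin.snoc (α := fun _ => K) x 0) p := by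
  induction p using MvPolynomial.induction_on with
  | C c => simp [killLast, algebraMap_eq]
  | add p q hp hq => simp [hp, hq]
  | mul_X p i hp =>
    rw [map_mul, map_mul, hp, map_mul]
    refine Fin.lastCases ?_ (fun i => ?_) i
    · simp [killLast_X_last]
    · simp [killLast_X_castSucc]

theorem exists_of_X_mul_add_X_mul_eq_zero {σ : Type*} {i j : σ} (hij : i ≠ j) {n : ℕ}
    {p q : MvPolynomial σ K} (hp : p.IsHomogeneous (n + 1))
    (h : X i * p + X j * q = 0) :
    ∃ g : MvPolynomial σ K, g.IsHomogeneous n ∧ p = X j * g ∧ q = -(X i * g) := by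
  have hd : (X j : MvPolynomial σ K) ∣ X i * p := ⟨-q, by linear_combination h⟩
  have hpr : Prime (X j : MvPolynomial σ K) := X_prime
  have hni : ¬ (X j : MvPolynomial σ K) ∣ X i := by
    rw [X_dvd_X]; simpa using Ne.symm hij
  obtain ⟨g, hg, rfl⟩ := exists_homogeneous_of_dvd (m := 1) (isHomogeneous_X K j)
    (by rwa [add_comm] at hp) ((hpr.dvd_or_dvd hd).resolve_left hni)
  refine ⟨g, hg, rfl, ?_⟩
  have : X j * (q + X i * g) = 0 := by linear_combination h
  rcases mul_eq_zero.1 this with h | h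
  · exact (X_ne_zero j h).elim
  · linear_combination h

end Restrict

section Lines

theorem eval_mul_of_isHomogeneous {σ A : Type*} [Fintype σ] [CommRing A] {p : MvPolynomial σ A}
    {n : ℕ} (hp : p.IsHomogeneous n) (c : A) (x : σ → A) :
    eval (fun i => c * x i) p = c ^ n * eval x p := by
  rw [eval_eq', eval_eq', Finset.mul_sum]
  refine Finset.sum_congr rfl fun d hd => ?_
  have hd' : ∑ i, d i = n := by
    rw [← Finsupp.degree_eq_sum, Finsupp.degree_apply]
    exact (hp.degree_eq_sum_deg_support hd).symm
  simp only [mul_pow, Finset.prod_mul_distrib, Finset.prod_pow_eq_pow_sum, hd']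
  ring

variable {K : Type*} [Field K]

/-- The linear form `x₀ + s x₁ - t x₂`. -/
noncomputable def lineForm (s t : K) : MvPolynomial (Fin 3) K := X 0 + C s * X 1 - C t * X 2

/-- Substitution `x₀ ↦ t x₂ - s x₁`, which restricts polynomials to the line `lineForm s t`. -/
noncomputable def lineSubst (s t : K) : MvPolynomial (Fin 3) K →ₐ[K] MvPolynomial (Fin 3) K :=
  aeval ![C t * X 2 - C s * X 1, X 1, X 2]

theorem lineForm_isHomogeneous (s t : K) : (lineForm s t).IsHomogeneous 1 := by
  unfold lineForm
  exact ((isHomogeneous_X _ _).add (isHomogeneous_C_mul_X _ _)).sub (isHomogeneous_C_mul_X _ _)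

theorem lineForm_dvd_iff {s t : K} {p : MvPolynomial (Fin 3) K} :
    lineForm s t ∣ p ↔ lineSubst s t p = 0 := by
  constructor
  · rintro ⟨g, rfl⟩
    rw [map_mul]
    have : lineSubst s t (lineForm s t) = 0 := by
      simp [lineSubst, lineForm, algebraMap_eq]
    rw [this, zero_mul]
  · intro h
    have key : ∀ p : MvPolynomial (Fin 3) K, lineForm s t ∣ p - lineSubst s t p := by
      intro p
      induction p using MvPolynomial.induction_on with
      | C c => simp [lineSubst, algebraMap_eq]
      | add p q hp hq =>
        have := dvd_add hp hq
        rwa [map_add, show ∀ a b c d : MvPolynomial (Fin 3) K,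
          a + b - (c + d) = (a - c) + (b - d) by intros; ring]
      | mul_X p i hp =>
        rw [map_mul, show ∀ a b c d : MvPolynomial (Fin 3) K,
          a * b - c * d = (a - c) * b + c * (b - d) by intros; ring]
        refine dvd_add (dvd_mul_of_dvd_left hp _) (dvd_mul_of_dvd_right ?_ _)
        fin_cases i
        · exact ⟨1, by simp [lineSubst, lineForm]; ring⟩
        · simp [lineSubst]
        · simp [lineSubst]
    simpa [h] using key p

theorem lineForm_prime (s t : K) : Prime (lineForm s t) := by
  refine ⟨fun h => ?_, fun h => ?_, fun p q hpq => ?_⟩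
  · have := congrArg (eval (![1, 0, 0] : Fin 3 → K)) h
    simp [lineForm] at this
  · rw [isUnit_iff_dvd_one, lineForm_dvd_iff, map_one] at h
    exact one_ne_zero h
  · rw [lineForm_dvd_iff, map_mul] at hpq
    simpa only [lineForm_dvd_iff] using mul_eq_zero.1 hpq

theorem eval_lineSubst (s t : K) (x : Fin 3 → K) (p : MvPolynomial (Fin 3) K) :
    eval x (lineSubst s t p) = eval ![t * x 2 - s * x 1, x 1, x 2] p := by
  induction p using MvPolynomial.induction_on with
  | C c => simp [lineSubst, algebraMap_eq]
  | add p q hp hq => simp [hp, hq]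
  | mul_X p i hp =>
    rw [map_mul, map_mul, hp, map_mul]
    fin_cases i <;> simp [lineSubst]

theorem lineForm_isRelPrime {s s' t t' : K} (h : s ≠ s') :
    IsRelPrime (lineForm s t) (lineForm s' t') := by
  rw [(lineForm_prime s t).irreducible.isRelPrime_iff_not_dvd, lineForm_dvd_iff]
  intro h0
  have := congrArg (eval (![0, 1, 0] : Fin 3 → K)) h0
  rw [eval_lineSubst] at this
  simp [lineForm] at this
  apply h
  linear_combination -this

theorem lineForm_dvd_of_card_lt [Infinite K] {s t : K} {p : MvPolynomial (Fin 3) K} {n : ℕ}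
    (hp : p.IsHomogeneous n) (T : Finset K) (hT : n < T.card)
    (h : ∀ w ∈ T, eval ![t - s * w, w, 1] p = 0) : lineForm s t ∣ p := by
  rw [lineForm_dvd_iff]
  let P : Polynomial K := aeval ![Polynomial.C t - Polynomial.C s * Polynomial.X, Polynomial.X, 1] p
  have hPe : ∀ w, P.eval w = eval ![t - s * w, w, 1] p := by
    intro w
    have : (Polynomial.evalRingHom w).comp
        (aeval ![Polynomial.C t - Polynomial.C s * Polynomial.X, Polynomial.X, 1]).toRingHom
        = eval (![t - s * w, w, 1] : Fin 3 → K) := by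
      apply MvPolynomial.ringHom_ext
      · intro c; simp [Polynomial.algebraMap_eq]
      · intro i; fin_cases i <;> simp
    exact congrArg (fun φ => φ p) this
  have hdeg : P.natDegree ≤ n := by
    have hX : ∀ i, (![Polynomial.C t - Polynomial.C s * Polynomial.X, Polynomial.X, 1] i :
        Polynomial K).natDegree ≤ 1 := by
      intro i; fin_cases i
      · simp only [Fin.zero_eta, Matrix.cons_val_zero]
        compute_degree
      · simp
      · simp
    simp only [P, aeval_def, eval₂_eq']
    refine Polynomial.natDegree_sum_le_of_forall_le _ _ fun d hd => ?_
    refine (Polynomial.natDegree_C_mul_le _ _).trans ?_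
    refine (Polynomial.natDegree_prod_le _ _).trans ?_
    rw [hp.degree_eq_sum_deg_support hd, ← Finsupp.degree_apply, Finsupp.degree_eq_sum]
    refine Finset.sum_le_sum fun i _ => ?_
    refine Polynomial.natDegree_pow_le.trans ?_
    simpa using Nat.mul_le_mul_left (d i) (hX i)
  have hP0 : P = 0 := Polynomial.eq_zero_of_natDegree_lt_card_of_eval_eq_zero' P T
    (fun w hw => by rw [hPe, h w hw]) (by omega)
  have hz : X 2 * lineSubst s t p = 0 := by
    refine MvPolynomial.funext fun x => ?_
    rw [map_mul, eval_X, eval_lineSubst, map_zero]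
    by_cases hx : x 2 = 0
    · rw [hx, zero_mul]
    · have h1 : eval ![t - s * (x 1 / x 2), x 1 / x 2, 1] p = 0 := by rw [← hPe, hP0]; simp
      have h2 := eval_mul_of_isHomogeneous hp (x 2) ![t - s * (x 1 / x 2), x 1 / x 2, 1]
      rw [h1, mul_zero] at h2
      have h3 : (fun i => x 2 * (![t - s * (x 1 / x 2), x 1 / x 2, 1] : Fin 3 → K) i) =
          ![t * x 2 - s * x 1, x 1, x 2] := by
        funext i; fin_cases i
        · simp; field_simp
        · simp; field_simp
        · simp
      rw [← h3, h2, mul_zero]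
  exact (mul_eq_zero.1 hz).resolve_left (X_ne_zero 2)

end Lines

section Arrangement
variable {K : Type*} [Field K]

theorem prod_lineForm_dvd {a : ℕ} {s t : Fin a → K} (hs : Function.Injective s)
    {p : MvPolynomial (Fin 3) K} (h : ∀ i, lineForm (s i) (t i) ∣ p) :
    ∏ i, lineForm (s i) (t i) ∣ p :=
  Finset.prod_dvd_of_isRelPrime
    (fun _ _ _ _ hij => lineForm_isRelPrime (hs.ne hij)) fun i _ => h i

theorem prod_lineForm_isHomogeneous {a : ℕ} (s t : Fin a → K) :
    (∏ i, lineForm (s i) (t i)).IsHomogeneous a := by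
  simpa using IsHomogeneous.prod Finset.univ (fun i => lineForm (s i) (t i)) (fun _ => 1)
    fun i _ => lineForm_isHomogeneous _ _

theorem eq_zero_of_forall_lineForm_dvd {a n : ℕ} {s t : Fin a → K} (hs : Function.Injective s)
    {p : MvPolynomial (Fin 3) K} (hp : p.IsHomogeneous n) (hn : n < a)
    (h : ∀ i, lineForm (s i) (t i) ∣ p) : p = 0 :=
  eq_zero_of_dvd_of_degree_lt (prod_lineForm_isHomogeneous s t) hp (prod_lineForm_dvd hs h) hn

theorem finite_linear_zero {A B : K} (h : A ≠ 0 ∨ B ≠ 0) : {x : K | A * x + B = 0}.Finite := by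
  by_cases hA : A = 0
  · subst hA
    have : {x : K | 0 * x + B = 0} = ∅ := by
      ext x; simpa using h
    rw [this]; exact Set.finite_empty
  · refine (Set.finite_singleton (-B / A)).subset fun x hx => ?_
    rw [Set.mem_singleton_iff, eq_div_iff hA]
    have : A * x + B = 0 := hx
    linear_combination this

/-- Parameters defining the arrangement of lines used to construct special points. -/
theorem exists_line_parameters [Infinite K] : ∃ (θ : K) (r : ℕ → K), θ ≠ 0 ∧ 1 - θ ≠ 0 ∧ 1 - 2 * θ ≠ 0 ∧
    (∀ i, r i ≠ 0) ∧ ∀ i j, i ≠ j → r i ≠ r j ∧ (1 - θ) * r j ≠ θ * r i ∧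
      1 + 4 * (θ * (1 - θ)) * (r i * r j + r i + r j) ≠ 0 := by
  obtain ⟨θ, hθ⟩ : ∃ θ : K, ¬ (1 * θ + 0 = 0 ∨ (-1) * θ + 1 = 0 ∨ (-2) * θ + 1 = 0) := by
    have hf := (finite_linear_zero (K := K) (A := 1) (B := 0) (by simp)).union
      ((finite_linear_zero (K := K) (A := -1) (B := 1) (by simp)).union
        (finite_linear_zero (K := K) (A := -2) (B := 1) (by simp)))
    obtain ⟨θ, hθ⟩ := hf.exists_notMem
    exact ⟨θ, hθ⟩
  push Not at hθ
  have h1 : θ ≠ 0 := fun h => hθ.1 (by simp [h])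
  have h2 : 1 - θ ≠ 0 := fun h => hθ.2.1 (by linear_combination h)
  have h3 : 1 - 2 * θ ≠ 0 := fun h => hθ.2.2 (by linear_combination h)
  obtain ⟨r, hr0, hr⟩ := exists_seq_of_forall_finset_exists (α := K) (fun x => x ≠ 0)
    (fun x y => x ≠ y ∧ (1 - θ) * y ≠ θ * x ∧ (1 - θ) * x ≠ θ * y ∧
      1 + 4 * (θ * (1 - θ)) * (x * y + x + y) ≠ 0) (fun s hs => by
    have hbad : ∀ x ∈ (s : Set K), ({y : K | 1 * y + -x = 0} ∪ {y : K | (1 - θ) * y + -(θ * x) = 0} ∪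
        {y : K | θ * y + -((1 - θ) * x) = 0} ∪
        {y : K | (4 * (θ * (1 - θ)) * (x + 1)) * y + (1 + 4 * (θ * (1 - θ)) * x) = 0}).Finite := by
      intro x hx
      refine (((finite_linear_zero (by simp)).union (finite_linear_zero (Or.inl h2))).union
        (finite_linear_zero (Or.inl h1))).union (finite_linear_zero ?_)
      by_contra! hc
      apply h3
      have : (1 - 2 * θ) ^ 2 = 0 := by linear_combination hc.2 - hc.1
      exact pow_eq_zero_iff (two_ne_zero) |>.1 this
    obtain ⟨y, hy⟩ := ((s.finite_toSet.biUnion hbad).union (Set.finite_singleton (0 : K))).exists_notMem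
    simp only [Set.mem_union, Set.mem_iUnion, Set.mem_ofPred_eq, Set.mem_singleton_iff, not_or,
      not_exists] at hy
    refine ⟨y, hy.2, fun x hx => ?_⟩
    obtain ⟨⟨⟨e1, e2⟩, e3⟩, e4⟩ := hy.1 x hx
    exact ⟨fun h => e1 (by rw [h]; ring), fun h => e2 (by linear_combination h),
      fun h => e3 (by linear_combination -h), fun h => e4 (by linear_combination h)⟩)
  refine ⟨θ, r, h1, h2, h3, hr0, fun i j hij => ?_⟩
  rcases lt_or_gt_of_ne hij with h | h
  · obtain ⟨a1, a2, a3, a4⟩ := hr i j h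
    exact ⟨a1, a2, a4⟩
  · obtain ⟨a1, a2, a3, a4⟩ := hr j i h
    exact ⟨a1.symm, a3, fun h => a4 (by linear_combination h)⟩

end Arrangement

section Division
variable {K : Type*} [Field K]

/-- The quadratic form `(x₀ + x₂)² + x₃ (x₀ + x₁)`. -/
noncomputable def specialQuadric (K : Type*) [Field K] : MvPolynomial (Fin 4) K :=
  (X 0 + X 2) ^ 2 + X 3 * (X 0 + X 1)

theorem specialQuadric_isHomogeneous : (specialQuadric K).IsHomogeneous 2 := by
  unfold specialQuadric
  refine IsHomogeneous.add (IsHomogeneous.pow ((isHomogeneous_X _ _).add (isHomogeneous_X _ _)) 2)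
    ((isHomogeneous_X _ _).mul ((isHomogeneous_X _ _).add (isHomogeneous_X _ _)))

theorem specialQuadric_eq : specialQuadric K = X 0 ^ 2 +
    X 0 * rename Fin.succ (2 * X 1 + X 2 : MvPolynomial (Fin 3) K) +
      rename Fin.succ (X 1 ^ 2 + X 2 * X 0 : MvPolynomial (Fin 3) K) := by
  simp only [specialQuadric, map_add, map_mul, map_pow, rename_X, map_ofNat]
  have h1 : (Fin.succ 0 : Fin 4) = 1 := rfl
  have h2 : (Fin.succ 1 : Fin 4) = 2 := rfl
  have h3 : (Fin.succ 2 : Fin 4) = 3 := rfl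
  rw [h1, h2, h3]; ring

theorem exists_remainder (F : MvPolynomial (Fin 4) K) :
    ∃ (α β : MvPolynomial (Fin 3) K) (H : MvPolynomial (Fin 4) K),
      F = rename Fin.succ α + X 0 * rename Fin.succ β + specialQuadric K * H := by
  induction F using MvPolynomial.induction_on with
  | C c => exact ⟨C c, 0, 0, by simp⟩
  | add p q hp hq =>
    obtain ⟨α, β, H, rfl⟩ := hp
    obtain ⟨α', β', H', rfl⟩ := hq
    exact ⟨α + α', β + β', H + H', by simp only [map_add]; ring⟩
  | mul_X p i hp =>
    obtain ⟨α, β, H, rfl⟩ := hp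
    refine Fin.cases ?_ (fun i => ?_) i
    · refine ⟨-((X 1 ^ 2 + X 2 * X 0) * β), α - (2 * X 1 + X 2) * β,
        H * X 0 + rename Fin.succ β, ?_⟩
      simp only [map_neg, map_sub, map_mul (rename Fin.succ) (_ + _)]
      rw [specialQuadric_eq]
      ring
    · refine ⟨α * X i, β * X i, H * X i.succ, ?_⟩
      simp only [map_mul, rename_X]
      ring

theorem exists_homogeneous_remainder {F : MvPolynomial (Fin 4) K} {n : ℕ}
    (hF : F.IsHomogeneous (n + 2)) :
    ∃ (α β : MvPolynomial (Fin 3) K) (H : MvPolynomial (Fin 4) K),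
      α.IsHomogeneous (n + 2) ∧ β.IsHomogeneous (n + 1) ∧ H.IsHomogeneous n ∧
      F = rename Fin.succ α + X 0 * rename Fin.succ β + specialQuadric K * H := by
  obtain ⟨α, β, H, h⟩ := exists_remainder F
  refine ⟨homogeneousComponent (n + 2) α, homogeneousComponent (n + 1) β,
    homogeneousComponent n H, homogeneousComponent_isHomogeneous _ _,
    homogeneousComponent_isHomogeneous _ _, homogeneousComponent_isHomogeneous _ _, ?_⟩
  conv_lhs => rw [← homogeneousComponent_eq_self hF, h, map_add, map_add]
  congr 1
  · congr 1
    · exact (rename_homogeneousComponent (n + 2) α).symm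
    · rw [show n + 2 = 1 + (n + 1) by omega, homogeneousComponent_mul_left (isHomogeneous_X _ _)]
      congr 1
      exact (rename_homogeneousComponent _ _).symm
  · rw [add_comm n 2, homogeneousComponent_mul_left specialQuadric_isHomogeneous]

theorem remainder_unique {α β : MvPolynomial (Fin 3) K} {H : MvPolynomial (Fin 4) K}
    (h : rename Fin.succ α + X 0 * rename Fin.succ β = specialQuadric K * H) :
    α = 0 ∧ β = 0 := by
  have hr : ∀ p : MvPolynomial (Fin 3) K,
      finSuccEquiv K 3 (rename Fin.succ p) = Polynomial.C p := fun p => by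
    induction p using MvPolynomial.induction_on with
    | C c => simp [finSuccEquiv_apply]
    | add p q hp hq => rw [map_add, map_add, hp, hq, map_add]
    | mul_X p i hp => rw [map_mul, map_mul, rename_X, finSuccEquiv_X_succ, hp, map_mul]
  have h' := congrArg (finSuccEquiv K 3) h
  rw [specialQuadric_eq] at h'
  simp only [map_add (finSuccEquiv K 3), map_mul (finSuccEquiv K 3), map_pow (finSuccEquiv K 3), hr,
    finSuccEquiv_X_zero] at h'
  set Q : Polynomial (MvPolynomial (Fin 3) K) := Polynomial.X ^ 2 +
    Polynomial.X * Polynomial.C (2 * X 1 + X 2) + Polynomial.C (X 1 ^ 2 + X 2 * X 0) with hQ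
  have hm : Q.Monic := by rw [hQ]; monicity!
  have hd : Q.natDegree = 2 := by rw [hQ]; compute_degree!
  have hzero : Polynomial.C α + Polynomial.X * Polynomial.C β = 0 := by
    by_contra hne
    refine hm.not_dvd_of_natDegree_lt hne ?_ ⟨_, h'⟩
    rw [hd]
    have : (Polynomial.C α + Polynomial.X * Polynomial.C β).natDegree ≤ 1 := by compute_degree
    omega
  constructor
  · simpa using congrArg (Polynomial.coeff · 0) hzero
  · simpa using congrArg (Polynomial.coeff · 1) hzero

end Division

section Rigidity
variable {K : Type*} [Field K]

/-- Every degree-`a` syzygy of the coordinates modulo `f` vanishing at the points `v` is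
divisible by `f`. -/
def KoszulRigid (a : ℕ) (f : MvPolynomial (Fin 4) K) {ι : Type*} (v : ι → Fin 4 → K) : Prop :=
  ∀ F : Fin 4 → MvPolynomial (Fin 4) K, (∀ c, (F c).IsHomogeneous a) →
    f ∣ ∑ c, X c * F c → (∀ j c, eval (v j) (F c) = 0) → ∀ c, f ∣ F c

/-- The subspaces of ternary forms of which generic points have to impose enough conditions. -/
noncomputable def ternarySpaces (b : ℕ) (r : Fin (b + 3) → K) :
    Fin 3 → Submodule K (MvPolynomial (Fin 3) K) :=
  ![Submodule.span K {∏ i, (X 1 + C (r i) * X 2)} ⊔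
      (homogeneousSubmodule (Fin 3) K (b + 1) ⊓
        LinearMap.ker (aeval ![(1 : K), 0, 0]).toLinearMap).map
          (LinearMap.mulLeft K ((X 0 + X 2) ^ 2)),
    (homogeneousSubmodule (Fin 2) K (b + 1)).map
        (LinearMap.mulLeft K (X 0) ∘ₗ (rename Fin.succ).toLinearMap) ⊔
      (homogeneousSubmodule (Fin 3) K b).map (LinearMap.mulLeft K ((X 0 + X 2) ^ 2)),
    homogeneousSubmodule (Fin 3) K (b + 1)]

instance ternarySpaces_finite (b : ℕ) (r : Fin (b + 3) → K) (i : Fin 3) :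
    Module.Finite K (ternarySpaces b r i) := by
  have h3 : ∀ n, (homogeneousSubmodule (Fin 3) K n).FG := homogeneousSubmodule_fg _ _
  rw [Module.Finite.iff_fg]
  fin_cases i
  · refine Submodule.FG.sup (Submodule.fg_span_singleton _) (Submodule.FG.map _ ?_)
    have := Submodule.finiteDimensional_inf_left (homogeneousSubmodule (Fin 3) K (b + 1))
      (LinearMap.ker (aeval ![(1 : K), 0, 0]).toLinearMap)
    exact Module.Finite.iff_fg.1 this
  · exact Submodule.FG.sup ((homogeneousSubmodule_fg _ _ _).map _) ((h3 b).map _)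
  · exact h3 (b + 1)

theorem finrank_ternarySpaces_le (b : ℕ) (r : Fin (b + 3) → K) (i : Fin 3) :
    Module.finrank K (ternarySpaces b r i) ≤ (b + 3).choose 2 := by
  have h3 : Module.finrank K (homogeneousSubmodule (Fin 3) K (b + 1)) = (b + 3).choose 2 :=
    finrank_homogeneousSubmodule 2 (b + 1)
  fin_cases i
  · simp only [ternarySpaces, Fin.zero_eta, Matrix.cons_val_zero]
    refine (Submodule.finrank_add_le_finrank_add_finrank _ _).trans ?_
    have h1 : Module.finrank K (Submodule.span K
        {(∏ i, (X 1 + C (r i) * X 2) : MvPolynomial (Fin 3) K)}) ≤ 1 :=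
      (finrank_span_le_card _).trans (by simp)
    have h2 := Submodule.finrank_map_le (LinearMap.mulLeft K ((X 0 + X 2) ^ 2))
      (homogeneousSubmodule (Fin 3) K (b + 1) ⊓
        LinearMap.ker (aeval (R := K) ![(1 : K), 0, 0]).toLinearMap)
    have hlt : homogeneousSubmodule (Fin 3) K (b + 1) ⊓
        LinearMap.ker (aeval ![(1 : K), 0, 0]).toLinearMap <
          homogeneousSubmodule (Fin 3) K (b + 1) := by
      refine lt_of_le_of_ne inf_le_left fun heq => ?_
      have hm : (X 0 ^ (b + 1) : MvPolynomial (Fin 3) K) ∈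
          homogeneousSubmodule (Fin 3) K (b + 1) := isHomogeneous_X_pow _ _
      rw [← heq] at hm
      have h0 : aeval ![(1 : K), 0, 0] (X 0 ^ (b + 1) : MvPolynomial (Fin 3) K) = 0 := hm.2
      simp at h0
    have := Submodule.finrank_lt_finrank_of_lt hlt
    omega
  · simp only [ternarySpaces, Fin.mk_one, Matrix.cons_val_one, Matrix.cons_val_zero]
    refine (Submodule.finrank_add_le_finrank_add_finrank _ _).trans ?_
    have h1 := Submodule.finrank_map_le
      (LinearMap.mulLeft K (X 0 : MvPolynomial (Fin 3) K) ∘ₗ (rename Fin.succ).toLinearMap)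
      (homogeneousSubmodule (Fin 2) K (b + 1))
    have h2 := Submodule.finrank_map_le
      (LinearMap.mulLeft K ((X 0 + X 2) ^ 2 : MvPolynomial (Fin 3) K))
      (homogeneousSubmodule (Fin 3) K b)
    have h1' : Module.finrank K (homogeneousSubmodule (Fin 2) K (b + 1)) = (b + 2).choose 1 :=
      finrank_homogeneousSubmodule 1 (b + 1)
    have h2' : Module.finrank K (homogeneousSubmodule (Fin 3) K b) = (b + 2).choose 2 :=
      finrank_homogeneousSubmodule 2 b
    have := Nat.choose_succ_succ (b + 2) 1
    simp only [Nat.succ_eq_add_one] at this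
    rw [Nat.choose_one_right] at this h1'
    change (b + 3).choose 2 = _ + (b + 2).choose 2 at this
    omega
  · exact h3.le

end Rigidity

section Rigidity
variable {K : Type*} [Field K]

theorem remainder_relations {F H : Fin 4 → MvPolynomial (Fin 4) K}
    {α β : Fin 4 → MvPolynomial (Fin 3) K}
    (hF : ∀ c, F c = rename Fin.succ (α c) + X 0 * rename Fin.succ (β c) + specialQuadric K * H c)
    (hdvd : specialQuadric K ∣ ∑ c, X c * F c) :
    X 0 * α 1 + X 1 * α 2 + X 2 * α 3 = (X 1 ^ 2 + X 2 * X 0) * β 0 ∧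
      α 0 + X 0 * β 1 + X 1 * β 2 + X 2 * β 3 = (2 * X 1 + X 2) * β 0 ∧
      ∑ c, X c * F c = specialQuadric K * (rename Fin.succ (β 0) + ∑ c, X c * H c) := by
  have h1 : (1 : Fin 4) = Fin.succ 0 := rfl
  have h2 : (2 : Fin 4) = Fin.succ 1 := rfl
  have h3 : (3 : Fin 4) = Fin.succ 2 := rfl
  have hsum : ∑ c, X c * F c = rename Fin.succ
        (X 0 * α 1 + X 1 * α 2 + X 2 * α 3 - (X 1 ^ 2 + X 2 * X 0) * β 0) +
      X 0 * rename Fin.succ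
        (α 0 + X 0 * β 1 + X 1 * β 2 + X 2 * β 3 - (2 * X 1 + X 2) * β 0) +
      specialQuadric K * (rename Fin.succ (β 0) + ∑ c, X c * H c) := by
    simp only [Fin.sum_univ_four, hF]
    have hq : rename Fin.succ (X 1 ^ 2 + X 2 * X 0 : MvPolynomial (Fin 3) K) =
        specialQuadric K - X 0 ^ 2 -
          X 0 * rename Fin.succ (2 * X 1 + X 2 : MvPolynomial (Fin 3) K) := by
      rw [specialQuadric_eq]; ring
    simp only [map_sub, map_add _ _ (X 2 * α 3), map_add _ _ (X 2 * β 3), map_add _ _ (X 1 * α 2),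
      map_add _ _ (X 1 * β 2), map_add _ _ (X 0 * β 1), map_mul, hq, rename_X, ← h1, ← h2, ← h3]
    ring
  obtain ⟨G, hG⟩ := hdvd
  obtain ⟨e1, e2⟩ := remainder_unique (K := K)
    (α := X 0 * α 1 + X 1 * α 2 + X 2 * α 3 - (X 1 ^ 2 + X 2 * X 0) * β 0)
    (β := α 0 + X 0 * β 1 + X 1 * β 2 + X 2 * β 3 - (2 * X 1 + X 2) * β 0)
    (H := G - (rename Fin.succ (β 0) + ∑ c, X c * H c)) (by
    rw [mul_sub, ← hG, hsum]; ring)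
  refine ⟨sub_eq_zero.1 e1, sub_eq_zero.1 e2, ?_⟩
  rw [hsum, e1, e2]; simp

theorem eq_zero_of_lineForm_dvd_relation {a : ℕ} {s t : Fin a → K} (hs : Function.Injective s)
    {α β : Fin 4 → MvPolynomial (Fin 3) K} (hα : ∀ c, (α c).IsHomogeneous a)
    (hβ : ∀ n, n + 1 = a → (β 0).IsHomogeneous n) (ha : 0 < a)
    (hline : ∀ c i, lineForm (s i) (t i) ∣ α c)
    (h1 : X 0 * α 1 + X 1 * α 2 + X 2 * α 3 = (X 1 ^ 2 + X 2 * X 0) * β 0) :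
    β 0 = 0 ∧ (∀ c, c ≠ 0 → α c = 0) ∧
      ∃ κ : K, α 0 = C κ * ∏ i, lineForm (s i) (t i) := by
  have hβ0 : β 0 = 0 := by
    refine eq_zero_of_forall_lineForm_dvd (t := t) hs (hβ (a - 1) (by omega)) (by omega) fun i => ?_
    have hd : lineForm (s i) (t i) ∣ (X 1 ^ 2 + X 2 * X 0) * β 0 := by
      rw [← h1]
      exact dvd_add (dvd_add (dvd_mul_of_dvd_right (hline _ _) _)
        (dvd_mul_of_dvd_right (hline _ _) _)) (dvd_mul_of_dvd_right (hline _ _) _)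
    refine ((lineForm_prime _ _).dvd_or_dvd hd).resolve_left fun hq => ?_
    have := congrArg (eval (![0, 1, 0] : Fin 3 → K)) (lineForm_dvd_iff.1 hq)
    rw [eval_lineSubst] at this
    simp at this
  have hκ : ∀ c, ∃ κ : K, α c = C κ * ∏ i, lineForm (s i) (t i) := by
    intro c
    obtain ⟨G, hG, h⟩ := exists_homogeneous_of_dvd (n := 0) (prod_lineForm_isHomogeneous s t) (hα c)
      (prod_lineForm_dvd hs (hline c))
    obtain ⟨κ, rfl⟩ := exists_eq_C_of_isHomogeneous_zero hG
    exact ⟨κ, by rw [h, mul_comm]⟩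
  choose κ hκ using hκ
  have hprod : (∏ i, lineForm (s i) (t i)) ≠ 0 :=
    Finset.prod_ne_zero_iff.2 fun i _ => (lineForm_prime _ _).ne_zero
  have hlin : X 0 * C (κ 1) + X 1 * C (κ 2) + X 2 * C (κ 3) = (0 : MvPolynomial (Fin 3) K) := by
    refine mul_right_cancel₀ hprod ?_
    rw [hβ0, mul_zero, hκ 1, hκ 2, hκ 3] at h1
    linear_combination h1
  have k1 : κ 1 = 0 := by simpa using congrArg (eval (![1, 0, 0] : Fin 3 → K)) hlin
  have k2 : κ 2 = 0 := by simpa using congrArg (eval (![0, 1, 0] : Fin 3 → K)) hlin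
  have k3 : κ 3 = 0 := by simpa using congrArg (eval (![0, 0, 1] : Fin 3 → K)) hlin
  refine ⟨hβ0, fun c hc => ?_, κ 0, hκ 0⟩
  rw [hκ c]
  have : κ c = 0 := by fin_cases c <;> simp_all
  rw [this, C_0, zero_mul]

end Rigidity

section Rigidity
variable {K : Type*} [Field K]

theorem killLast_rename_succ (p : MvPolynomial (Fin 3) K) :
    killLast 3 (rename Fin.succ p) = rename Fin.succ (killLast 2 p) := by
  have : (killLast 3).comp (rename Fin.succ) =
      ((rename Fin.succ).comp (killLast 2) : MvPolynomial (Fin 3) K →ₐ[K] _) := by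
    refine MvPolynomial.algHom_ext fun i => ?_
    simp only [AlgHom.comp_apply, rename_X]
    refine Fin.lastCases ?_ (fun i => ?_) i
    · rw [killLast_X_last, map_zero]; exact killLast_X_last
    · rw [killLast_X_castSucc, rename_X, Fin.succ_castSucc, killLast_X_castSucc]
  exact congrArg (fun φ => φ p) this

theorem killLast_specialQuadric : killLast 3 (specialQuadric K) = (X 0 + X 2) ^ 2 := by
  have h0 : killLast (K := K) 3 (X 0) = X 0 := killLast_X_castSucc 0
  have h2 : killLast (K := K) 3 (X 2) = X 2 := killLast_X_castSucc 2
  have h3 : killLast (K := K) 3 (X 3) = 0 := killLast_X_last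
  simp [specialQuadric, h0, h2, h3]

theorem killLast_prod_lineForm {a : ℕ} (s t : Fin a → K) :
    killLast 3 (rename Fin.succ (∏ i, lineForm (s i) (t i))) = ∏ i, (X 1 + C (s i) * X 2) := by
  have h1 : killLast (K := K) 3 (X 1) = X 1 := killLast_X_castSucc 1
  have h2 : killLast (K := K) 3 (X 2) = X 2 := killLast_X_castSucc 2
  have h3 : killLast (K := K) 3 (X 3) = 0 := killLast_X_last
  have e1 : (Fin.succ 0 : Fin 4) = 1 := rfl
  have e2 : (Fin.succ 1 : Fin 4) = 2 := rfl
  have e3 : (Fin.succ 2 : Fin 4) = 3 := rfl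
  simp only [map_prod, lineForm, map_add, map_sub, map_mul, rename_X, rename_C, e1, e2, e3, h1, h2, h3,
    mul_zero, sub_zero]
  refine Finset.prod_congr rfl fun i _ => ?_
  congr 2
  exact (killLast 3).commutes (s i)

theorem restriction_eq_zero {b N : ℕ} {s t : Fin (b + 3) → K} {κ : K}
    {β : Fin 4 → MvPolynomial (Fin 3) K} {F H : Fin 4 → MvPolynomial (Fin 4) K}
    {p : Fin N → Fin 3 → K}
    (hβ : ∀ c, (β c).IsHomogeneous (b + 2)) (hH : ∀ c, (H c).IsHomogeneous (b + 1))
    (hrel : C κ * ∏ i, lineForm (s i) (t i) + X 0 * β 1 + X 1 * β 2 + X 2 * β 3 = 0)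
    (hdvd : X 3 ∣ ∑ c, X c * H c)
    (hF0 : F 0 = rename Fin.succ (C κ * ∏ i, lineForm (s i) (t i)) + specialQuadric K * H 0)
    (hF : ∀ c, c ≠ 0 → F c = X 0 * rename Fin.succ (β c) + specialQuadric K * H c)
    (hp : ∀ j, p j 1 ≠ 0) (hsep : ∀ i, ∀ e ∈ ternarySpaces b s i, (∀ j, eval (p j) e = 0) → e = 0)
    (hvan : ∀ j c, eval (Fin.snoc (α := fun _ => K) (p j) 0) (F c) = 0) :
    κ = 0 ∧ killLast 2 (β 1) = 0 ∧ killLast 2 (β 2) = 0 ∧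
      ∀ c, c ≠ 3 → killLast 3 (H c) = 0 := by
  have k0 : killLast (K := K) 3 (X 0) = X 0 := killLast_X_castSucc 0
  have k1 : killLast (K := K) 3 (X 1) = X 1 := killLast_X_castSucc 1
  have k2 : killLast (K := K) 3 (X 2) = X 2 := killLast_X_castSucc 2
  have k3 : killLast (K := K) 3 (X 3) = 0 := killLast_X_last
  have l0 : killLast (K := K) 2 (X 0) = X 0 := killLast_X_castSucc 0
  have l1 : killLast (K := K) 2 (X 1) = X 1 := killLast_X_castSucc 1
  have l2 : killLast (K := K) 2 (X 2) = 0 := killLast_X_last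
  have hHrel : X 0 * killLast 3 (H 0) + X 1 * killLast 3 (H 1) + X 2 * killLast 3 (H 2) = 0 := by
    obtain ⟨G, hG⟩ := hdvd
    have := congrArg (killLast 3) hG
    simpa [Fin.sum_univ_four, k0, k1, k2, k3] using this
  have hvan' : ∀ j c, eval (p j) (killLast 3 (F c)) = 0 := fun j c => by
    rw [eval_killLast, hvan]
  have hC : killLast 3 (C κ) = C κ := (killLast 3).commutes κ
  -- the component along the first coordinate
  have hE0 : C κ * ∏ i, (X 1 + C (s i) * X 2) + (X 0 + X 2) ^ 2 * killLast 3 (H 0) = 0 := by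
    have e : killLast 3 (F 0) =
        C κ * ∏ i, (X 1 + C (s i) * X 2) + (X 0 + X 2) ^ 2 * killLast 3 (H 0) := by
      rw [hF0, map_add, map_mul (rename _), map_mul, map_mul, killLast_prod_lineForm,
        killLast_specialQuadric, rename_C, hC]
    rw [← e]
    refine hsep 0 _ ?_ fun j => hvan' j 0
    rw [e]
    refine Submodule.add_mem_sup ?_ ⟨killLast 3 (H 0), ⟨killLast_isHomogeneous (hH 0), ?_⟩, ?_⟩
    · rw [C_mul']; exact Submodule.smul_mem _ _ (Submodule.mem_span_singleton_self _)
    · change aeval _ _ = 0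
      have := congrArg (eval (![1, 0, 0] : Fin 3 → K)) hHrel
      rw [aeval_eq_eval]
      simpa using this
    · simp
  have hκ : κ = 0 := by
    have := congrArg (eval (![0, 1, 0] : Fin 3 → K)) hE0
    simpa [eval_prod] using this
  have hQ : ((X 0 + X 2) ^ 2 : MvPolynomial (Fin 3) K) ≠ 0 := by
    intro h
    simpa using congrArg (eval (![1, 0, 0] : Fin 3 → K)) h
  have hH0 : killLast 3 (H 0) = 0 := by
    rw [hκ, C_0, zero_mul, zero_add] at hE0
    exact (mul_eq_zero.1 hE0).resolve_left hQ
  rw [hH0, mul_zero, zero_add] at hHrel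
  obtain ⟨h, hh, hH1, hH2⟩ := exists_of_X_mul_add_X_mul_eq_zero (by decide)
    (killLast_isHomogeneous (hH 1)) hHrel
  have hβrel : X 0 * killLast 2 (β 1) + X 1 * killLast 2 (β 2) = 0 := by
    have := congrArg (killLast 2) hrel
    simpa [hκ, l0, l1, l2] using this
  obtain ⟨g, hg, hβ1, hβ2⟩ := exists_of_X_mul_add_X_mul_eq_zero (by decide)
    (killLast_isHomogeneous (hβ 1)) hβrel
  have e1 : (Fin.succ 1 : Fin 3) = 2 := rfl
  have hG : X 0 * rename Fin.succ g + (X 0 + X 2) ^ 2 * h = 0 := by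
    refine hsep 1 _ (Submodule.add_mem_sup ⟨g, hg, rfl⟩ ⟨h, hh, rfl⟩) fun j => ?_
    have h2 := hvan' j 2
    rw [hF 2 (by decide), map_add, map_mul, map_mul, killLast_rename_succ, k0,
      killLast_specialQuadric, hH2, hβ2, map_neg, map_mul (rename _), rename_X] at h2
    have e0 : (Fin.succ 0 : Fin 3) = 1 := rfl
    rw [e0] at h2
    have : p j 1 * eval (p j) (X 0 * rename Fin.succ g + (X 0 + X 2) ^ 2 * h) = 0 := by
      rw [← neg_eq_zero, ← h2]
      simp only [map_add, map_mul, map_neg, eval_X]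
      ring
    exact (mul_eq_zero.1 this).resolve_left (hp j)
  have hg0 : g = 0 := by
    have := congrArg (aeval (R := K) (![-X 1, X 0, X 1] : Fin 3 → MvPolynomial (Fin 2) K)) hG
    have hren : aeval (![-X 1, X 0, X 1] : Fin 3 → MvPolynomial (Fin 2) K) (rename Fin.succ g) =
        g := by
      rw [aeval_rename]
      have : ((![-X 1, X 0, X 1] : Fin 3 → MvPolynomial (Fin 2) K) ∘ Fin.succ) = X := by
        funext i; fin_cases i <;> rfl
      rw [this, aeval_X_left_apply]
    simp only [map_add, map_mul, hren, map_pow, aeval_X, map_zero] at this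
    simpa using this
  have hh0 : h = 0 := by
    rw [hg0, map_zero, mul_zero, zero_add] at hG
    exact (mul_eq_zero.1 hG).resolve_left hQ
  refine ⟨hκ, by rw [hβ1, hg0, mul_zero], by rw [hβ2, hg0, mul_zero, neg_zero], fun c hc => ?_⟩
  fin_cases c
  · exact hH0
  · exact hH1.trans (by rw [hh0, mul_zero])
  · exact hH2.trans (by rw [hh0, mul_zero, neg_zero])
  · exact (hc rfl).elim

end Rigidity

section Rigidity
variable {K : Type*} [Field K]

/-- The point with coordinates `(y - w, u, w, 1)` where `w = θ(1-θ)(x + x')`, `u = -θ(1-θ) x x'`. -/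
def nodePoint (θ : K) (x x' y : K) : Fin 4 → K :=
  ![y - θ * (1 - θ) * (x + x'), -(θ * (1 - θ) * (x * x')), θ * (1 - θ) * (x + x'), 1]

/-- Special points on the surface `X 3 * specialQuadric`. -/
def specialPoint {a N : ℕ} (θ : K) (r : Fin a → K) (y : Fin a → Fin a → K) (p : Fin N → Fin 3 → K) :
    {x : Fin a × Fin a // x.1 ≠ x.2} ⊕ (Fin a × Bool) ⊕ Fin N → Fin 4 → K
  | .inl x => nodePoint θ (r x.1.1) (r x.1.2) (y x.1.1 x.1.2)
  | .inr (.inl x) =>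
    ![0, -((if x.2 then θ else 1 - θ) * r x.1) ^ 2, (if x.2 then θ else 1 - θ) * r x.1, 1]
  | .inr (.inr j) => Fin.snoc (α := fun _ => K) (p j) 0

theorem eval_vecCons_rename_succ (y : K) (x : Fin 3 → K) (p : MvPolynomial (Fin 3) K) :
    eval (Matrix.vecCons y x) (rename Fin.succ p) = eval x p := by
  rw [eval_rename]; rfl

theorem koszulRigid_specialPoint [Infinite K] {b N : ℕ} {θ : K} {r : Fin (b + 3) → K}
    {y : Fin (b + 3) → Fin (b + 3) → K} {p : Fin N → Fin 3 → K}
    (hθ : θ ≠ 0) (hθ1 : 1 - θ ≠ 0) (hθ2 : 1 - 2 * θ ≠ 0) (hr0 : ∀ i, r i ≠ 0)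
    (hr : ∀ i j, i ≠ j → r i ≠ r j ∧ (1 - θ) * r j ≠ θ * r i)
    (hy : ∀ i j, i ≠ j → y i j ≠ y j i)
    (hyq : ∀ i j, i ≠ j → eval (nodePoint θ (r i) (r j) (y i j)) (specialQuadric K) = 0)
    (hp : ∀ j, p j 1 ≠ 0 ∧ p j 0 + p j 2 ≠ 0)
    (hsep : ∀ i, ∀ e ∈ ternarySpaces b r i, (∀ j, eval (p j) e = 0) → e = 0) :
    KoszulRigid (b + 3) (X 3 * specialQuadric K) (specialPoint θ r y p) := by
  classical
  intro F hFhom hdvd hvan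
  choose α β H hα hβ hH hF using fun c => exists_homogeneous_remainder (n := b + 1) (hFhom c)
  have hrinj : Function.Injective r := fun i j h => by
    by_contra hne; exact (hr i j hne).1 h
  obtain ⟨hrel1, hrel2, hrel3⟩ := remainder_relations hF ((dvd_mul_left _ _).trans hdvd)
  -- remainders vanish at the nodes
  have hnode : ∀ i j, i ≠ j → ∀ c,
      eval ![-(θ * (1 - θ) * (r i * r j)), θ * (1 - θ) * (r i + r j), 1] (α c) = 0 ∧
      eval ![-(θ * (1 - θ) * (r i * r j)), θ * (1 - θ) * (r i + r j), 1] (β c) = 0 := by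
    intro i j hij c
    have hv1 := hvan (.inl ⟨(i, j), hij⟩) c
    have hv2 := hvan (.inl ⟨(j, i), hij.symm⟩) c
    have hq1 := hyq i j hij
    have hq2 := hyq j i hij.symm
    simp only [specialPoint] at hv1 hv2
    rw [hF c, map_add, map_add, map_mul, map_mul, hq1] at hv1
    rw [hF c, map_add, map_add, map_mul, map_mul, hq2] at hv2
    simp only [nodePoint, eval_X, Matrix.cons_val_zero, eval_vecCons_rename_succ, zero_mul, add_zero]
      at hv1 hv2
    rw [mul_comm (r j) (r i), add_comm (r j) (r i)] at hv2
    have hβ0 : (y i j - y j i) * eval ![-(θ * (1 - θ) * (r i * r j)), θ * (1 - θ) * (r i + r j), 1]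
        (β c) = 0 := by linear_combination hv1 - hv2
    have hβ0' := (mul_eq_zero.1 hβ0).resolve_left (sub_ne_zero.2 (hy i j hij))
    rw [hβ0'] at hv1
    exact ⟨by linear_combination hv1, hβ0'⟩
  let T : Fin (b + 3) → Finset K := fun i =>
    (Finset.univ.erase i).image fun j => θ * (1 - θ) * (r i + r j)
  have hT : ∀ i, (T i).card = b + 2 := fun i => by
    rw [Finset.card_image_of_injective, Finset.card_erase_of_mem (Finset.mem_univ i),
      Finset.card_univ, Fintype.card_fin]
    · rfl
    · intro j j' h
      exact hrinj (add_left_cancel (mul_left_cancel₀ (mul_ne_zero hθ hθ1) h))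
  let t : Fin (b + 3) → K := fun i => θ * (1 - θ) * r i ^ 2
  have hTmem : ∀ i, ∀ w ∈ T i, ∃ j, i ≠ j ∧ w = θ * (1 - θ) * (r i + r j) ∧
      ![t i - r i * w, w, 1] =
        ![-(θ * (1 - θ) * (r i * r j)), θ * (1 - θ) * (r i + r j), 1] := by
    intro i w hw
    obtain ⟨j, hj, rfl⟩ := Finset.mem_image.1 hw
    refine ⟨j, (Finset.ne_of_mem_erase hj).symm, rfl, ?_⟩
    congr 1
    simp only [t]; ring
  have hline : ∀ c i, lineForm (r i) (t i) ∣ α c := by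
    intro c i
    have hside : ∀ bb : Bool, eval ![-((if bb then θ else 1 - θ) * r i) ^ 2,
        (if bb then θ else 1 - θ) * r i, 1] (α c) = 0 := by
      intro bb
      have hv := hvan (.inr (.inl (i, bb))) c
      simp only [specialPoint] at hv
      rw [hF c, map_add, map_add, map_mul, map_mul, eval_X, eval_vecCons_rename_succ,
        eval_vecCons_rename_succ] at hv
      have hq : eval ![0, -((if bb then θ else 1 - θ) * r i) ^ 2,
          (if bb then θ else 1 - θ) * r i, 1] (specialQuadric K) = 0 := by
        simp [specialQuadric]
      rw [hq] at hv
      simpa using hv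
    refine lineForm_dvd_of_card_lt (hα c) (insert (θ * r i) (insert ((1 - θ) * r i) (T i))) ?_ ?_
    · rw [Finset.card_insert_of_notMem, Finset.card_insert_of_notMem, hT]
      · omega
      · intro h
        obtain ⟨j, hij, h, -⟩ := hTmem i _ h
        apply (hr j i hij.symm).2
        refine mul_left_cancel₀ hθ1 ?_
        linear_combination h
      · rw [Finset.mem_insert, not_or]
        refine ⟨fun h => ?_, fun h => ?_⟩
        · have : (1 - 2 * θ) * r i = 0 := by linear_combination -h
          exact (mul_ne_zero hθ2 (hr0 i)) this
        · obtain ⟨j, hij, h, -⟩ := hTmem i _ h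
          apply (hr i j hij).2
          refine mul_left_cancel₀ hθ ?_
          linear_combination -h
    · intro w hw
      rw [Finset.mem_insert, Finset.mem_insert] at hw
      rcases hw with rfl | rfl | hw
      · have := hside true
        simp only [if_true] at this
        rw [← this]; congr 2; simp only [t]
        congr 1; ring
      · have := hside false
        simp only [Bool.false_eq_true, if_false] at this
        rw [← this]; congr 2; simp only [t]
        congr 1; ring
      · obtain ⟨j, hij, -, h⟩ := hTmem i w hw
        rw [h]; exact (hnode i j hij c).1
  obtain ⟨hβ0, hα0, κ, hκ⟩ := eq_zero_of_lineForm_dvd_relation hrinj hα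
    (fun n hn => by obtain rfl : n = b + 2 := by omega
                    exact hβ 0) (by omega) hline hrel1
  have hdvd3 : X 3 ∣ ∑ c, X c * H c := by
    rw [hrel3, hβ0, map_zero, zero_add, mul_comm (X 3)] at hdvd
    refine (mul_dvd_mul_iff_left ?_).1 hdvd
    intro h
    simpa [specialQuadric] using congrArg (eval (![1, 0, 0, 0] : Fin 4 → K)) h
  have hF0 : F 0 = rename Fin.succ (C κ * ∏ i, lineForm (r i) (t i)) + specialQuadric K * H 0 := by
    rw [hF 0, hκ, hβ0, map_zero, mul_zero, add_zero]
  have hF' : ∀ c, c ≠ 0 → F c = X 0 * rename Fin.succ (β c) + specialQuadric K * H c := by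
    intro c hc
    rw [hF c, hα0 c hc, map_zero, zero_add]
  have hrel : C κ * ∏ i, lineForm (r i) (t i) + X 0 * β 1 + X 1 * β 2 + X 2 * β 3 = 0 := by
    rw [← hκ, hrel2, hβ0, mul_zero]
  have hvanp : ∀ j c, eval (Fin.snoc (α := fun _ => K) (p j) 0) (F c) = 0 :=
    fun j c => hvan (.inr (.inr j)) c
  obtain ⟨hκ0, hβ1, hβ2, hH3⟩ := restriction_eq_zero hβ hH hrel hdvd3 hF0 hF'
    (fun j => (hp j).1) hsep hvanp
  have hβz : ∀ c, killLast 2 (β c) = 0 → β c = 0 := by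
    intro c hc
    obtain ⟨G, hG, hβG⟩ := exists_homogeneous_of_dvd (m := 1) (n := b + 1) (isHomogeneous_X K _)
      (by have := hβ c; rwa [add_comm] at this) (X_last_dvd_of_killLast_eq_zero hc)
    rw [hβG, eq_zero_of_forall_lineForm_dvd (s := r) (t := t) hrinj hG (by omega), mul_zero]
    intro i
    refine lineForm_dvd_of_card_lt hG (T i) (by rw [hT]; omega) fun w hw => ?_
    obtain ⟨j, hij, -, h⟩ := hTmem i w hw
    have := (hnode i j hij c).2
    rw [← h, hβG, map_mul] at this
    simpa using this
  have hβ10 := hβz 1 hβ1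
  have hβ20 := hβz 2 hβ2
  have hβ30 : β 3 = 0 := by
    rw [hκ0, hβ10, hβ20, C_0, zero_mul, mul_zero, mul_zero, zero_add, zero_add, zero_add] at hrel
    exact (mul_eq_zero.1 hrel).resolve_left (X_ne_zero 2)
  have hFH : ∀ c, F c = specialQuadric K * H c := by
    intro c
    fin_cases c
    · exact hF0.trans (by rw [hκ0]; simp)
    · exact (hF' 1 (by decide)).trans (by rw [hβ10]; simp)
    · exact (hF' 2 (by decide)).trans (by rw [hβ20]; simp)
    · exact (hF' 3 (by decide)).trans (by rw [hβ30]; simp)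
  have hHall : ∀ c, killLast 3 (H c) = 0 := by
    intro c
    by_cases hc : c = 3
    · refine hsep 2 _ (killLast_isHomogeneous (hH c)) fun j => ?_
      have h := hvanp j c
      rw [← eval_killLast, hFH c, map_mul, map_mul, killLast_specialQuadric] at h
      refine (mul_eq_zero.1 h).resolve_left ?_
      simpa using (hp j).2
    · exact hH3 c hc
  intro c
  rw [hFH c, mul_comm]
  exact mul_dvd_mul_left _ (X_last_dvd_of_killLast_eq_zero (hHall c))

/-- There are sufficiently many points on `x₃ ((x₀ + x₂)² + x₃ (x₀ + x₁)) = 0` imposing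
independent conditions on syzygies. -/
theorem exists_koszulRigid_special [IsAlgClosed K] {a : ℕ} (ha : 3 ≤ a) :
    ∃ v : Fin (3 * (a * (a - 1) / 2) + 2 * a) → Fin 4 → K,
      KoszulRigid a (X 3 * specialQuadric K) v ∧
      ∀ j, eval (v j) (X 3 * specialQuadric K) = 0 ∧ (v j 3 ≠ 0 ∨ v j 0 + v j 2 ≠ 0) := by
  obtain ⟨b, rfl⟩ : ∃ b, a = b + 3 := ⟨a - 3, by omega⟩
  have : Infinite K := IsAlgClosed.instInfinite
  obtain ⟨θ, r, h1, h2, h3, hr0, hr⟩ := exists_line_parameters (K := K)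
  have hroot : ∀ e : K, ∃ y : K, y ^ 2 + y + e = 0 := by
    intro e
    obtain ⟨y, hy⟩ := IsAlgClosed.exists_root (k := K) (Polynomial.X ^ 2 + Polynomial.X + Polynomial.C e)
      (by
        have : (Polynomial.X ^ 2 + Polynomial.X + Polynomial.C e : Polynomial K).degree = 2 := by
          compute_degree!
        rw [this]; decide)
    exact ⟨y, by simpa using hy⟩
  choose root hroot using hroot
  let e : Fin (b + 3) → Fin (b + 3) → K := fun i j =>
    -(θ * (1 - θ) * (r i * r j)) - θ * (1 - θ) * (r i + r j)
  have he : ∀ i j, e i j = e j i := fun i j => by simp only [e]; ring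
  let y : Fin (b + 3) → Fin (b + 3) → K := fun i j =>
    if i < j then root (e i j) else -1 - root (e i j)
  have hne : ∀ i j : Fin (b + 3), i ≠ j → root (e i j) ≠ -1 - root (e i j) := by
    intro i j hij h
    apply (hr i j (by simpa [Fin.ext_iff] using hij)).2.2
    have := hroot (e i j)
    simp only [e] at this h ⊢
    linear_combination (2 * root (-(θ * (1 - θ) * (r i * r j)) - θ * (1 - θ) * (r i + r j)) + 1) * h
      - 4 * this
  have hh0 : (X 1 * (X 0 + X 2) : MvPolynomial (Fin 3) K) ≠ 0 := by
    intro h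
    simpa using congrArg (eval (![1, 1, 0] : Fin 3 → K)) h
  obtain ⟨p, hp, hsep⟩ := exists_points_separating ((b + 3).choose 2)
    (ternarySpaces b fun i => r i) (fun i => ternarySpaces_finite _ _ i)
    (fun i => finrank_ternarySpaces_le b _ i) hh0
  have hyq : ∀ i j : Fin (b + 3),
      eval (nodePoint θ (r i) (r j) (y i j)) (specialQuadric K) = 0 := by
    intro i j
    have := hroot (e i j)
    by_cases hij : i < j
    · simp only [y, if_pos hij, specialQuadric, nodePoint]
      simp
      simp only [e] at this ⊢
      linear_combination this
    · simp only [y, if_neg hij, specialQuadric, nodePoint]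
      simp
      simp only [e] at this ⊢
      linear_combination this
  have hp' : ∀ j, p j 1 ≠ 0 ∧ p j 0 + p j 2 ≠ 0 := fun j => by
    have := hp j
    simp only [map_mul, map_add, eval_X] at this
    exact ⟨left_ne_zero_of_mul this, right_ne_zero_of_mul this⟩
  have hrig := koszulRigid_specialPoint (r := fun i : Fin (b + 3) => r i) (y := y) h1 h2 h3
    (fun i => hr0 i) (fun i j hij => by
      have := hr i j (by simpa [Fin.ext_iff] using hij)
      exact ⟨this.1, this.2.1⟩)
    (fun i j hij => by
      rcases lt_or_gt_of_ne hij with h | h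
      · simp only [y, if_pos h, if_neg h.asymm, he j i]; exact hne i j hij
      · simp only [y, if_pos h, if_neg h.asymm, he j i]; exact (hne i j hij).symm)
    (fun i j _ => hyq i j) hp' hsep
  have hcard : Fintype.card ({x : Fin (b + 3) × Fin (b + 3) // x.1 ≠ x.2} ⊕ (Fin (b + 3) × Bool) ⊕
      Fin ((b + 3).choose 2)) = 3 * ((b + 3) * (b + 3 - 1) / 2) + 2 * (b + 3) := by
    have hoff : Fintype.card {x : Fin (b + 3) × Fin (b + 3) // x.1 ≠ x.2} =
        (b + 3) * (b + 3 - 1) := by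
      rw [Fintype.card_subtype]
      have := Finset.offDiag_card (s := (Finset.univ : Finset (Fin (b + 3))))
      rw [Finset.card_univ, Fintype.card_fin] at this
      rw [Nat.mul_sub_one, ← this]
      congr 1
      ext x; simp
    have heven : 2 * ((b + 3) * (b + 3 - 1) / 2) = (b + 3) * (b + 3 - 1) :=
      Nat.mul_div_cancel' (even_iff_two_dvd.1 (Nat.even_mul_pred_self _))
    rw [Fintype.card_sum, Fintype.card_sum, hoff, Fintype.card_prod, Fintype.card_fin,
      Fintype.card_fin, Fintype.card_bool, Nat.choose_two_right]
    omega
  let E := Fintype.equivFinOfCardEq hcard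
  have hzero : ∀ z, eval (specialPoint θ (fun i : Fin (b + 3) => r i) y p z)
      (X 3 * specialQuadric K) = 0 ∧ (specialPoint θ (fun i : Fin (b + 3) => r i) y p z 3 ≠ 0 ∨
      specialPoint θ (fun i : Fin (b + 3) => r i) y p z 0 +
      specialPoint θ (fun i : Fin (b + 3) => r i) y p z 2 ≠ 0) := by
    rintro (x | x | x)
    · refine ⟨?_, Or.inl ?_⟩
      · rw [map_mul]; simp only [specialPoint]; rw [hyq, mul_zero]
      · simp [specialPoint, nodePoint]
    · refine ⟨?_, Or.inl ?_⟩
      · simp [specialPoint, specialQuadric]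
      · simp [specialPoint]
    · refine ⟨?_, Or.inr ?_⟩
      · have : eval (Fin.snoc (α := fun _ => K) (p x) 0) (X 3) = 0 := by
          rw [eval_X]; exact Fin.snoc_last _ _
        simp only [specialPoint]; rw [map_mul, this, zero_mul]
      · exact (hp' x).2
  exact ⟨fun j => specialPoint θ (fun i : Fin (b + 3) => r i) y p (E.symm j),
    fun F h1 h2 h3 => hrig F h1 h2 fun j c => by simpa using h3 (E j) c, fun j => hzero _⟩

end Rigidity

section LinearChange
variable {K : Type*} [Field K]

/-- Linear substitution `X i ↦ ∑ j, A i j * X j`. -/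
noncomputable def linSubst {n : ℕ} (A : Matrix (Fin n) (Fin n) K) :
    MvPolynomial (Fin n) K →ₐ[K] MvPolynomial (Fin n) K :=
  aeval fun i => ∑ j, C (A i j) * X j

theorem linSubst_X {n : ℕ} (A : Matrix (Fin n) (Fin n) K) (i : Fin n) :
    linSubst A (X i) = ∑ j, C (A i j) * X j := aeval_X _ _

theorem eval_linSubst {n : ℕ} (A : Matrix (Fin n) (Fin n) K) (v : Fin n → K)
    (p : MvPolynomial (Fin n) K) : eval v (linSubst A p) = eval (A.mulVec v) p := by
  have : (aeval v : _ →ₐ[K] K).comp (linSubst A) = aeval (A.mulVec v) := by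
    ext i
    simp [linSubst_X, Matrix.mulVec, dotProduct]
  have := DFunLike.congr_fun this p
  simpa [aeval_eq_eval] using this

theorem linSubst_isHomogeneous {n d : ℕ} (A : Matrix (Fin n) (Fin n) K)
    {p : MvPolynomial (Fin n) K} (hp : p.IsHomogeneous d) : (linSubst A p).IsHomogeneous d := by
  have := hp.aeval (fun i => ∑ j, C (A i j) * X j) (n := 1) fun i =>
    IsHomogeneous.sum _ _ _ fun j _ => by
      simpa using (isHomogeneous_C (Fin n) (A i j)).mul (isHomogeneous_X K j)
  simpa [linSubst] using this

theorem linSubst_linSubst {n : ℕ} {A B : Matrix (Fin n) (Fin n) K}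
    (h : A * B = 1) (p : MvPolynomial (Fin n) K) : linSubst B (linSubst A p) = p := by
  have : (linSubst B).comp (linSubst A) = AlgHom.id K _ := by
    ext1 i
    have hi : ∀ k, ∑ j, A i j * B j k = if i = k then 1 else 0 := fun k => by
      rw [← Matrix.mul_apply, h, Matrix.one_apply]
    simp only [AlgHom.comp_apply, linSubst_X, map_sum, map_mul, AlgHom.id_apply]
    simp only [← algebraMap_eq, AlgHom.commutes]
    simp only [algebraMap_eq, Finset.mul_sum]
    rw [Finset.sum_comm]
    simp only [← mul_assoc, ← C_mul, ← Finset.sum_mul, ← map_sum, hi]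
    simp
  exact DFunLike.congr_fun this p

theorem KoszulRigid.of_linSubst {ι : Type*} {a : ℕ} {f : MvPolynomial (Fin 4) K}
    {v : ι → Fin 4 → K} {A B : Matrix (Fin 4) (Fin 4) K} (hAB : A * B = 1)
    (h : KoszulRigid a f fun j => A.mulVec (v j)) : KoszulRigid a (linSubst A f) v := by
  intro F hF hdvd hvan
  have hBA : B * A = 1 := mul_eq_one_comm.1 hAB
  have key := h (fun b => ∑ c, C (B c b) * linSubst B (F c)) (fun b =>
      IsHomogeneous.sum _ _ _ fun c _ => by
        simpa using (isHomogeneous_C _ _).mul (linSubst_isHomogeneous B (hF c)))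
    (by
      have h1 := map_dvd (linSubst B) hdvd
      rw [linSubst_linSubst hAB] at h1
      convert h1 using 1
      simp only [map_sum, map_mul, linSubst_X, Finset.mul_sum, Finset.sum_mul]
      rw [Finset.sum_comm]
      refine Finset.sum_congr rfl fun c _ => Finset.sum_congr rfl fun b _ => by ring)
    (fun j b => by
      simp only [map_sum, map_mul, eval_C, eval_linSubst, Matrix.mulVec_mulVec, hBA,
        Matrix.one_mulVec, hvan, mul_zero, Finset.sum_const_zero])
  intro d
  have h2 : F d = ∑ b, C (A b d) * linSubst A (∑ c, C (B c b) * linSubst B (F c)) := by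
    have hd : ∀ c, ∑ b, B c b * A b d = if c = d then 1 else 0 := fun c => by
      rw [← Matrix.mul_apply, hBA, Matrix.one_apply]
    simp only [map_sum, map_mul, linSubst_linSubst hBA, Finset.mul_sum]
    simp only [← algebraMap_eq, AlgHom.commutes]
    simp only [algebraMap_eq]
    rw [Finset.sum_comm]
    simp only [← mul_assoc, ← C_mul, ← Finset.sum_mul, ← map_sum, mul_comm (A _ _), hd]
    simp
  rw [h2]
  exact Finset.dvd_sum fun b _ => (map_dvd (linSubst A) (key b)).mul_left _

theorem KoszulRigid.of_associated {ι : Type*} {a : ℕ} {f g : MvPolynomial (Fin 4) K}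
    {v : ι → Fin 4 → K} (hfg : Associated f g) (h : KoszulRigid a f v) : KoszulRigid a g v :=
  fun F h1 h2 h3 c => hfg.dvd_iff_dvd_left.1 (h F h1 (hfg.dvd_iff_dvd_left.2 h2) h3 c)

end LinearChange

section LinearAlgebra
variable {K : Type*} [Field K] {m n V : Type*} [Fintype m] [Fintype n] [DecidableEq n]
  [AddCommGroup V] [Module K V]

/-- A matrix whose kernel is the image of `T` becomes invertible after composing and adding
suitable fixed maps. -/
theorem Matrix.exists_det_ne_zero_of_ker_le_range (L : Matrix m n K) (T : V →ₗ[K] n → K)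
    (hT : Function.Injective T) (hL : ∀ u, L.mulVec u = 0 → ∃ h, T h = u) :
    ∃ (E : Matrix n m K) (N : (n → K) →ₗ[K] V) (P : V →ₗ[K] n → K),
      (E * L + LinearMap.toMatrix' (P ∘ₗ N)).det ≠ 0 := by
  classical
  obtain ⟨N, hN⟩ := LinearMap.exists_leftInverse_of_injective T (LinearMap.ker_eq_bot.2 hT)
  obtain ⟨E, hE⟩ := LinearMap.exists_leftInverse_of_injective (L.mulVecLin.prod N) (by
    rw [LinearMap.ker_eq_bot']
    intro u hu
    obtain ⟨hu1, hu2⟩ : L.mulVec u = 0 ∧ N u = 0 := Prod.mk_eq_zero.1 hu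
    obtain ⟨h, rfl⟩ := hL u hu1
    have : N (T h) = h := LinearMap.congr_fun hN h
    rw [← this, hu2, map_zero])
  refine ⟨LinearMap.toMatrix' (E ∘ₗ LinearMap.inl K _ _), N, E ∘ₗ LinearMap.inr K _ _, ?_⟩
  have : LinearMap.toMatrix' (E ∘ₗ LinearMap.inl K _ _) * L +
      LinearMap.toMatrix' ((E ∘ₗ LinearMap.inr K _ _) ∘ₗ N) = 1 := by
    rw [← LinearMap.toMatrix'_id, ← hE]
    conv_lhs => enter [1, 2]; rw [← LinearMap.toMatrix'_toLin' L]
    rw [← LinearMap.toMatrix'_comp, ← map_add]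
    congr 1
    refine LinearMap.ext fun u => ?_
    simp only [LinearMap.add_apply, LinearMap.comp_apply, LinearMap.inl_apply,
      LinearMap.inr_apply, LinearMap.prod_apply, ← map_add]
    simp
  rw [this, Matrix.det_one]
  exact one_ne_zero

theorem Matrix.ker_le_range_of_det_ne_zero [FiniteDimensional K V] {L : Matrix m n K}
    {T : V →ₗ[K] n → K} (hT : Function.Injective T) (hLT : ∀ h, L.mulVec (T h) = 0)
    {E : Matrix n m K} {N : (n → K) →ₗ[K] V} {P : V →ₗ[K] n → K}
    (hdet : (E * L + LinearMap.toMatrix' (P ∘ₗ N)).det ≠ 0) {u : n → K} (hu : L.mulVec u = 0) :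
    ∃ h, T h = u := by
  classical
  have hinj : ∀ x, L.mulVec x = 0 → N x = 0 → x = 0 := by
    intro x hx hN
    refine Matrix.eq_zero_of_mulVec_eq_zero hdet ?_
    rw [Matrix.add_mulVec, ← Matrix.mulVec_mulVec, hx, Matrix.mulVec_zero,
      LinearMap.toMatrix'_mulVec, LinearMap.comp_apply, hN, map_zero, add_zero]
  have hNT : Function.Injective (N ∘ₗ T) := by
    rw [← LinearMap.ker_eq_bot, LinearMap.ker_eq_bot']
    intro h hh
    exact hT ((hinj (T h) (hLT h) hh).trans (map_zero T).symm)
  obtain ⟨h, hh⟩ := LinearMap.injective_iff_surjective.1 hNT (N u)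
  refine ⟨h, sub_eq_zero.1 (hinj _ ?_ ?_)⟩
  · rw [Matrix.mulVec_sub, hLT, hu, sub_zero]
  · rw [map_sub, ← hh, LinearMap.comp_apply, sub_self]

end LinearAlgebra

section RelationMatrix

/-- The exponents of degree `d`. -/
abbrev Exponents (d : ℕ) : Type := ↥(Finset.finsuppAntidiag (Finset.univ : Finset (Fin 4)) d)

theorem mem_exponents {d : ℕ} {m : Fin 4 →₀ ℕ} :
    m ∈ Finset.finsuppAntidiag (Finset.univ : Finset (Fin 4)) d ↔ m.degree = d := by
  simp [Finset.mem_finsuppAntidiag, Finsupp.degree_eq_sum]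

variable {A B : Type*} [CommRing A] [CommRing B]

/-- The form with given coefficients. -/
noncomputable def formOf {d : ℕ} (u : Exponents d → A) : MvPolynomial (Fin 4) A :=
  ∑ m, monomial m.1 (u m)

theorem formOf_isHomogeneous {d : ℕ} (u : Exponents d → A) : (formOf u).IsHomogeneous d :=
  IsHomogeneous.sum _ _ _ fun m _ => isHomogeneous_monomial _ (mem_exponents.1 m.2)

theorem coeff_formOf {d : ℕ} (u : Exponents d → A) (m : Exponents d) :
    coeff m.1 (formOf u) = u m := by
  classical
  rw [formOf, coeff_sum, Finset.sum_eq_single m]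
  · simp
  · intro b _ hb
    rw [coeff_monomial, if_neg fun h => hb (Subtype.ext h)]
  · simp

theorem eq_of_forall_coeff_eq {d : ℕ} {p q : MvPolynomial (Fin 4) A} (hp : p.IsHomogeneous d)
    (hq : q.IsHomogeneous d) (h : ∀ m : Exponents d, coeff m.1 p = coeff m.1 q) : p = q := by
  ext m
  by_cases hm : m.degree = d
  · exact h ⟨m, mem_exponents.2 hm⟩
  · rw [hp.coeff_eq_zero hm, hq.coeff_eq_zero hm]

theorem formOf_coeff {d : ℕ} {p : MvPolynomial (Fin 4) A} (hp : p.IsHomogeneous d) :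
    formOf (fun m : Exponents d => coeff m.1 p) = p :=
  eq_of_forall_coeff_eq (formOf_isHomogeneous _) hp (coeff_formOf _)

/-- The matrix of the linear system `∑ c, X c * F c = f * G`, `F c (v j) = 0` in the coefficients
of the forms `F c` of degree `a` and `G` of degree `a - 2`. -/
noncomputable def relMatrix {ι : Type*} (a : ℕ) (f : MvPolynomial (Fin 4) A) (v : ι → Fin 4 → A) :
    Matrix (Exponents (a + 1) ⊕ ι × Fin 4) (Fin 4 × Exponents a ⊕ Exponents (a - 2)) A :=
  Matrix.of fun r s => match r, s with
    | .inl m, .inl (c, n) => coeff m.1 (X c * monomial n.1 1)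
    | .inl m, .inr n => -coeff m.1 (f * monomial n.1 1)
    | .inr (j, c'), .inl (c, n) => if c' = c then eval (v j) (monomial n.1 1) else 0
    | .inr _, .inr _ => 0

theorem relMatrix_map {ι : Type*} (a : ℕ) (f : MvPolynomial (Fin 4) A) (v : ι → Fin 4 → A)
    (φ : A →+* B) : (relMatrix a f v).map φ = relMatrix a (map φ f) fun j i => φ (v j i) := by
  ext r s
  rcases r with m | ⟨j, c'⟩ <;> rcases s with ⟨c, n⟩ | n
  · simp only [relMatrix, Matrix.map_apply, Matrix.of_apply, ← coeff_map]
    simp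
  · simp only [relMatrix, Matrix.map_apply, Matrix.of_apply, map_neg, ← coeff_map]
    simp
  · simp only [relMatrix, Matrix.map_apply, Matrix.of_apply, apply_ite φ, map_zero, eval_monomial]
    simp [Finsupp.prod]
  · simp [relMatrix]

theorem relMatrix_mulVec {ι : Type*} (a : ℕ) (f : MvPolynomial (Fin 4) A) (v : ι → Fin 4 → A)
    (u : Fin 4 × Exponents a ⊕ Exponents (a - 2) → A) :
    (relMatrix a f v).mulVec u = Sum.elim
      (fun m => coeff m.1 (∑ c, X c * formOf (fun n => u (.inl (c, n))) -
        f * formOf fun n => u (.inr n)))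
      fun x => eval (v x.1) (formOf fun n => u (.inl (x.2, n))) := by
  have hmon : ∀ (n : Fin 4 →₀ ℕ) (x : A), monomial n x = C x * monomial n 1 := fun n x => by
    rw [C_mul_monomial, mul_one]
  ext r
  rw [Matrix.mulVec, dotProduct, Fintype.sum_sum_type, Fintype.sum_prod_type]
  rcases r with m | ⟨j, c'⟩
  · simp only [relMatrix, Matrix.of_apply, Sum.elim_inl, coeff_sub, coeff_sum, formOf,
      Finset.mul_sum]
    rw [sub_eq_add_neg, ← Finset.sum_neg_distrib]
    refine congrArg₂ (· + ·) ?_ ?_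
    · refine Finset.sum_congr rfl fun c _ => Finset.sum_congr rfl fun n _ => ?_
      rw [hmon _ (u _), mul_left_comm, coeff_C_mul, mul_comm]
    · refine Finset.sum_congr rfl fun n _ => ?_
      rw [hmon _ (u _), mul_left_comm, coeff_C_mul, mul_comm, mul_neg]
  · simp only [relMatrix, Matrix.of_apply, Sum.elim_inr, zero_mul, Finset.sum_const_zero,
      add_zero, formOf, map_sum, ite_mul]
    rw [Finset.sum_eq_single c']
    · refine Finset.sum_congr rfl fun n _ => ?_
      rw [if_pos rfl, hmon _ (u _), map_mul, eval_C, mul_comm]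
    · intro c _ hc
      simp [hc.symm]
    · simp

end RelationMatrix

section Rigid
variable {K : Type*} [Field K] {ι : Type*}

/-- The trivial solutions `F c = f * H c`, `G = ∑ c, X c * H c`. -/
noncomputable def trivialRel (a : ℕ) (f : MvPolynomial (Fin 4) K) :
    (Fin 4 → homogeneousSubmodule (Fin 4) K (a - 3)) →ₗ[K]
      (Fin 4 × Exponents a ⊕ Exponents (a - 2) → K) where
  toFun H := Sum.elim (fun x => coeff x.2.1 (f * (H x.1).1))
    fun n => coeff n.1 (∑ c, X c * (H c).1)
  map_add' H H' := by
    ext (x | x) <;> simp [mul_add, Finset.sum_add_distrib]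
  map_smul' r H := by
    ext (x | x) <;> simp [Finset.mul_sum, coeff_sum]

variable {a : ℕ} {f : MvPolynomial (Fin 4) K} {v : ι → Fin 4 → K}

theorem trivialRel_injective (ha : 3 ≤ a) (hf0 : f ≠ 0) (hf : f.IsHomogeneous 3) :
    Function.Injective (trivialRel a f) := by
  rw [← LinearMap.ker_eq_bot, LinearMap.ker_eq_bot']
  intro H hH
  ext1 c
  have hd : (f * (H c).1).IsHomogeneous a := by
    have := hf.mul (H c).2
    rwa [show 3 + (a - 3) = a by omega] at this
  have : f * (H c).1 = 0 := eq_of_forall_coeff_eq hd (isHomogeneous_zero _ _ _) fun m =>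
    congrFun hH (.inl (c, m))
  exact Subtype.ext ((mul_eq_zero.1 this).resolve_left hf0)

theorem formOf_trivialRel_inl (ha : 3 ≤ a) (hf : f.IsHomogeneous 3)
    (H : Fin 4 → homogeneousSubmodule (Fin 4) K (a - 3)) (c : Fin 4) :
    formOf (fun n => trivialRel a f H (.inl (c, n))) = f * (H c).1 :=
  formOf_coeff (p := f * (H c).1) (by
    have := hf.mul (H c).2
    rwa [show 3 + (a - 3) = a by omega] at this)

theorem formOf_trivialRel_inr (ha : 3 ≤ a) (H : Fin 4 → homogeneousSubmodule (Fin 4) K (a - 3)) :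
    formOf (fun n => trivialRel a f H (.inr n)) = ∑ c, X c * (H c).1 :=
  formOf_coeff (p := ∑ c, X c * (H c).1) (IsHomogeneous.sum _ _ _ fun c _ => by
    have := (isHomogeneous_X K c).mul (H c).2
    rwa [show 1 + (a - 3) = a - 2 by omega] at this)

theorem relMatrix_mulVec_trivialRel (ha : 3 ≤ a) (hf : f.IsHomogeneous 3)
    (hv : ∀ j, eval (v j) f = 0) (H : Fin 4 → homogeneousSubmodule (Fin 4) K (a - 3)) :
    (relMatrix a f v).mulVec (trivialRel a f H) = 0 := by
  rw [relMatrix_mulVec]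
  ext (m | x)
  · simp only [Sum.elim_inl, formOf_trivialRel_inl ha hf, formOf_trivialRel_inr ha]
    simp [Finset.mul_sum, mul_left_comm]
  · simp [formOf_trivialRel_inl ha hf, hv]

theorem koszulRigid_iff (ha : 3 ≤ a) (hf0 : f ≠ 0) (hf : f.IsHomogeneous 3) :
    KoszulRigid a f v ↔ ∀ u, (relMatrix a f v).mulVec u = 0 → ∃ H, trivialRel a f H = u := by
  constructor
  · intro h u hu
    rw [relMatrix_mulVec] at hu
    have hsum : ∑ c, X c * formOf (fun n => u (.inl (c, n))) = f * formOf fun n => u (.inr n) := by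
      refine eq_of_forall_coeff_eq (d := a + 1) ?_ ?_ fun m => ?_
      · refine IsHomogeneous.sum _ _ _ fun c _ => ?_
        rw [add_comm a]
        exact (isHomogeneous_X K c).mul (formOf_isHomogeneous _)
      · have := hf.mul (formOf_isHomogeneous fun n => u (.inr n))
        rwa [show 3 + (a - 2) = a + 1 by omega] at this
      · have := congrFun hu (.inl m)
        rw [Sum.elim_inl, coeff_sub] at this
        exact sub_eq_zero.1 this
    have hdvd := h (fun c => formOf fun n => u (.inl (c, n))) (fun c => formOf_isHomogeneous _)
      ⟨_, hsum⟩ fun j c => congrFun hu (.inr (j, c))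
    choose H hH hFH using fun c => exists_homogeneous_of_dvd (n := a - 3) hf (by
      rw [show 3 + (a - 3) = a by omega]; exact formOf_isHomogeneous _) (hdvd c)
    refine ⟨fun c => ⟨H c, hH c⟩, ?_⟩
    ext (⟨c, n⟩ | n)
    · change coeff n.1 (f * H c) = _
      rw [← hFH, coeff_formOf]
    · change coeff n.1 (∑ c, X c * H c) = _
      have : ∑ c, X c * H c = formOf fun n => u (.inr n) := by
        refine mul_left_cancel₀ hf0 ?_
        rw [← hsum, Finset.mul_sum]
        exact Finset.sum_congr rfl fun c _ => by rw [hFH c]; ring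
      rw [this, coeff_formOf]
  · intro h F hF hdvd hvan c
    obtain ⟨G, hG, hFG⟩ := exists_homogeneous_of_dvd (n := a - 2) hf (F := ∑ c, X c * F c) (by
      rw [show 3 + (a - 2) = 1 + a by omega]
      exact IsHomogeneous.sum _ _ _ fun c _ => (isHomogeneous_X K c).mul (hF c)) hdvd
    obtain ⟨H, hH⟩ := h (Sum.elim (fun x => coeff x.2.1 (F x.1)) fun n => coeff n.1 G) (by
      rw [relMatrix_mulVec]
      ext (m | x)
      · simp only [Sum.elim_inl, Sum.elim_inr, formOf_coeff (hF _), formOf_coeff hG, hFG, sub_self,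
          coeff_zero, Pi.zero_apply]
      · simpa [formOf_coeff (hF _)] using hvan x.1 x.2)
    refine ⟨(H c).1, ?_⟩
    rw [← formOf_trivialRel_inl ha hf H c, hH]
    simp [formOf_coeff (hF c)]

/-- Rigidity is implied by the nonvanishing of a determinant. -/
theorem KoszulRigid.exists_det [Fintype ι] (ha : 3 ≤ a) (hf0 : f ≠ 0) (hf : f.IsHomogeneous 3)
    (h : KoszulRigid a f v) :
    ∃ (E : Matrix (Fin 4 × Exponents a ⊕ Exponents (a - 2)) (Exponents (a + 1) ⊕ ι × Fin 4) K)
      (M : Matrix (Fin 4 × Exponents a ⊕ Exponents (a - 2))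
        (Fin 4 × Exponents a ⊕ Exponents (a - 2)) K),
      (E * relMatrix a f v + M).det ≠ 0 ∧
      ∀ (f' : MvPolynomial (Fin 4) K) (v' : ι → Fin 4 → K), f' ≠ 0 → f'.IsHomogeneous 3 →
        (∀ j, eval (v' j) f' = 0) → (E * relMatrix a f' v' + M).det ≠ 0 → KoszulRigid a f' v' := by
  obtain ⟨E, N, P, hdet⟩ := Matrix.exists_det_ne_zero_of_ker_le_range (relMatrix a f v)
    (trivialRel a f) (trivialRel_injective ha hf0 hf) ((koszulRigid_iff ha hf0 hf).1 h)
  exact ⟨E, _, hdet, fun f' v' hf0' hf' hv' hdet' => (koszulRigid_iff ha hf0' hf').2 fun u hu =>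
    Matrix.ker_le_range_of_det_ne_zero (trivialRel_injective ha hf0' hf')
      (relMatrix_mulVec_trivialRel ha hf' hv') hdet' hu⟩

end Rigid

section Newton

theorem map_eval_eq_eval_map {σ A B : Type*} [CommRing A] [CommRing B] (φ : A →+* B) (g : σ → A)
    (p : MvPolynomial σ A) : φ (eval g p) = eval (fun i => φ (g i)) (map φ p) := by
  rw [eval_map, ← coe_eval₂Hom, eval, coe_eval₂Hom, eval₂_comp_left]
  rfl

/-- First-order Taylor expansion in one coordinate. -/
theorem exists_eval_update {σ A : Type*} [DecidableEq σ] [CommRing A] (f : MvPolynomial σ A)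
    (z : σ → A) (c : σ) (y : A) :
    ∃ r, eval (Function.update z c (z c + y)) f = eval z f + y * eval z (pderiv c f) + y ^ 2 * r := by
  induction f using MvPolynomial.induction_on with
  | C a => exact ⟨0, by simp⟩
  | add p q hp hq =>
    obtain ⟨r, hr⟩ := hp
    obtain ⟨s, hs⟩ := hq
    exact ⟨r + s, by simp only [map_add, hr, hs]; ring⟩
  | mul_X p i hp =>
    obtain ⟨r, hr⟩ := hp
    by_cases hi : i = c
    · subst hi
      refine ⟨r * (z i + y) + eval z (pderiv i p), ?_⟩
      rw [pderiv_mul, pderiv_X_self]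
      simp only [map_mul, map_add, hr, eval_X, Function.update_self, mul_one]
      ring
    · refine ⟨r * z i, ?_⟩
      rw [pderiv_mul, pderiv_X_of_ne hi]
      simp only [map_mul, hr, eval_X, Function.update_of_ne hi, mul_zero, add_zero]
      ring

variable {K : Type*} [Field K]

/-- Smooth zeros of the special fibre lift to zeros modulo any power of the parameter. -/
theorem exists_approximate_zero {σ : Type*} (F : MvPolynomial σ (Polynomial K))
    (z : σ → K) (hz : eval z (map (Polynomial.evalRingHom 0) F) = 0) (c : σ)
    (hc : eval z (pderiv c (map (Polynomial.evalRingHom 0) F)) ≠ 0) (N : ℕ) :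
    ∃ ζ : σ → Polynomial K, Polynomial.X ^ (N + 1) ∣ eval ζ F ∧ ∀ i, (ζ i).eval 0 = z i := by
  classical
  have hev : ∀ (G : MvPolynomial σ (Polynomial K)) (ζ : σ → Polynomial K),
      (∀ i, (ζ i).eval 0 = z i) →
      (eval ζ G).eval 0 = eval z (map (Polynomial.evalRingHom 0) G) := fun G ζ h => by
    rw [← Polynomial.coe_evalRingHom, map_eval_eq_eval_map]
    simp [h]
  induction N with
  | zero =>
    refine ⟨fun i => Polynomial.C (z i), ?_, fun i => by simp⟩
    rw [zero_add, pow_one, Polynomial.X_dvd_iff, Polynomial.coeff_zero_eq_eval_zero,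
      hev _ _ fun i => by simp, hz]
  | succ N ih =>
    obtain ⟨ζ, ⟨q, hq⟩, hζ⟩ := ih
    set d := eval z (pderiv c (map (Polynomial.evalRingHom 0) F)) with hd
    set y : Polynomial K := -(Polynomial.X ^ (N + 1) * Polynomial.C (q.eval 0 / d))
    obtain ⟨r, hr⟩ := exists_eval_update F ζ c y
    refine ⟨Function.update ζ c (ζ c + y), ?_, fun i => ?_⟩
    · have h0 : Polynomial.X ∣ q - Polynomial.C (q.eval 0 / d) * eval ζ (pderiv c F) := by
        rw [Polynomial.X_dvd_iff, Polynomial.coeff_zero_eq_eval_zero, Polynomial.eval_sub,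
          Polynomial.eval_mul, hev _ _ hζ, Polynomial.eval_C, ← pderiv_map, div_mul_cancel₀ _ hc,
          sub_self]
      obtain ⟨q', hq'⟩ := h0
      refine ⟨q' + Polynomial.X ^ N * Polynomial.C (q.eval 0 / d) ^ 2 * r, ?_⟩
      rw [hr, hq]
      linear_combination Polynomial.X ^ (N + 1) * hq'
    · by_cases hi : i = c
      · subst hi; simp [y, hζ]
      · rw [Function.update_of_ne hi, hζ]

end Newton

section Degeneration
variable {K : Type*} [Field K] {A B : Type*} [CommRing A] [CommRing B] [Algebra K A] [Algebra K B]

/-- The deformation `s⁻² f(s² x₀, s x₁, s² x₂, x₃)` of a form `f`. -/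
noncomputable def degeneration (s : A) (f : MvPolynomial (Fin 4) K) : MvPolynomial (Fin 4) A :=
  ∑ m ∈ f.support, monomial m (algebraMap K A (coeff m f) * s ^ (2 * m 0 + m 1 + 2 * m 2 - 2))

theorem map_degeneration (φ : A →ₐ[K] B) (s : A) (f : MvPolynomial (Fin 4) K) :
    map (φ : A →+* B) (degeneration s f) = degeneration (φ s) f := by
  simp [degeneration, map_sum, map_monomial]

theorem degeneration_isHomogeneous {f : MvPolynomial (Fin 4) K} (hf : f.IsHomogeneous 3) (s : A) :
    (degeneration s f).IsHomogeneous 3 :=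
  IsHomogeneous.sum _ _ _ fun m hm => isHomogeneous_monomial _ (by
    by_contra hd
    exact mem_support_iff.1 hm (hf.coeff_eq_zero hd))

/-- A normal form of a cubic at a point which is not an inflection in the given tangent
direction. -/
structure IsAdaptedCubic (f : MvPolynomial (Fin 4) K) : Prop where
  homog : f.IsHomogeneous 3
  coeff_3 : coeff (Finsupp.single 3 3) f = 0
  coeff_31 : coeff (Finsupp.single 3 2 + Finsupp.single 1 1) f = 0
  coeff_32 : coeff (Finsupp.single 3 2 + Finsupp.single 2 1) f = 0
  coeff_30 : coeff (Finsupp.single 3 2 + Finsupp.single 0 1) f = 1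
  coeff_13 : coeff (Finsupp.single 1 2 + Finsupp.single 3 1) f = 1

theorem exponent_cases {m : Fin 4 →₀ ℕ} (hm : m.degree = 3)
    (hw : 2 * m 0 + m 1 + 2 * m 2 ≤ 2) :
    m = Finsupp.single 3 3 ∨ m = Finsupp.single 3 2 + Finsupp.single 1 1 ∨
    m = Finsupp.single 3 2 + Finsupp.single 2 1 ∨ m = Finsupp.single 3 2 + Finsupp.single 0 1 ∨
    m = Finsupp.single 1 2 + Finsupp.single 3 1 := by
  rw [Finsupp.degree_eq_sum, Fin.sum_univ_four] at hm
  simp only [Finsupp.ext_iff, Fin.forall_fin_succ, IsEmpty.forall_iff, and_true]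
  simp
  omega

theorem IsAdaptedCubic.two_le {f : MvPolynomial (Fin 4) K} (hf : IsAdaptedCubic f)
    {m : Fin 4 →₀ ℕ} (hm : m ∈ f.support) : 2 ≤ 2 * m 0 + m 1 + 2 * m 2 := by
  by_contra h
  have hd : m.degree = 3 := by
    by_contra hd
    exact mem_support_iff.1 hm (hf.homog.coeff_eq_zero hd)
  rcases exponent_cases hd (by omega) with rfl | rfl | rfl | rfl | rfl
  · exact mem_support_iff.1 hm hf.coeff_3
  · exact mem_support_iff.1 hm hf.coeff_31
  all_goals simp at h

theorem IsAdaptedCubic.degeneration_zero {f : MvPolynomial (Fin 4) K} (hf : IsAdaptedCubic f) :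
    degeneration (0 : K) f = X 3 * (X 3 * X 0 + X 1 ^ 2) := by
  have h1 : (X 3 * (X 3 * X 0 + X 1 ^ 2) : MvPolynomial (Fin 4) K) =
      monomial (Finsupp.single 3 2 + Finsupp.single 0 1) 1 +
      monomial (Finsupp.single 1 2 + Finsupp.single 3 1) 1 := by
    rw [show (1 : K) = 1 * 1 by simp, ← monomial_mul, ← monomial_mul, ← X_pow_eq_monomial,
      ← X_pow_eq_monomial, ← X_pow_eq_monomial, ← X_pow_eq_monomial]
    ring
  rw [h1]
  ext m
  have hdeg : coeff m (degeneration (0 : K) f) =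
      coeff m f * 0 ^ (2 * m 0 + m 1 + 2 * m 2 - 2) := by
    simp only [degeneration, coeff_sum, coeff_monomial]
    rw [Finset.sum_ite_eq']
    split_ifs with h
    · rfl
    · rw [notMem_support_iff.1 h, zero_mul]
  rw [hdeg, coeff_add, coeff_monomial, coeff_monomial]
  by_cases hm : m.degree = 3 ∧ 2 * m 0 + m 1 + 2 * m 2 ≤ 2
  · rcases exponent_cases hm.1 hm.2 with rfl | rfl | rfl | rfl | rfl
    · rw [hf.coeff_3, if_neg, if_neg] <;> simp [Finsupp.ext_iff, Fin.forall_fin_succ, Finsupp.single_apply]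
    · rw [hf.coeff_31, if_neg, if_neg] <;> simp [Finsupp.ext_iff, Fin.forall_fin_succ, Finsupp.single_apply]
    · rw [hf.coeff_32, if_neg, if_neg] <;> simp [Finsupp.ext_iff, Fin.forall_fin_succ, Finsupp.single_apply]
    · rw [hf.coeff_30, if_pos rfl, if_neg] <;> simp [Finsupp.ext_iff, Fin.forall_fin_succ, Finsupp.single_apply]
    · rw [hf.coeff_13, if_neg, if_pos rfl] <;> simp [Finsupp.ext_iff, Fin.forall_fin_succ, Finsupp.single_apply]
  · have h2 : coeff m f * 0 ^ (2 * m 0 + m 1 + 2 * m 2 - 2) = 0 := by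
      by_cases hd : m.degree = 3
      · rw [zero_pow, mul_zero]; omega
      · rw [hf.homog.coeff_eq_zero hd, zero_mul]
    rw [h2, if_neg, if_neg, add_zero]
    all_goals
      rintro rfl
      apply hm
      simp [Finsupp.degree_eq_sum, Fin.sum_univ_four, Finsupp.single_apply]

theorem IsAdaptedCubic.C_mul_degeneration {f : MvPolynomial (Fin 4) K} (hf : IsAdaptedCubic f)
    (s : K) : C (s ^ 2) * degeneration s f =
      linSubst (Matrix.diagonal ![s ^ 2, s, s ^ 2, 1]) f := by
  conv_rhs => rw [f.as_sum, map_sum]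
  rw [degeneration, Finset.mul_sum]
  refine Finset.sum_congr rfl fun m hm => ?_
  have hX : ∀ i, linSubst (Matrix.diagonal ![s ^ 2, s, s ^ 2, 1]) (X i) =
      C ((![s ^ 2, s, s ^ 2, 1] : Fin 4 → K) i) * X i := fun i => by
    rw [linSubst_X, Finset.sum_eq_single i]
    · rw [Matrix.diagonal_apply_eq]
    · intro j _ hj; rw [Matrix.diagonal_apply_ne _ hj.symm, C_0, zero_mul]
    · simp
  obtain ⟨e, he⟩ := Nat.exists_eq_add_of_le (hf.two_le hm)
  have hC : ∀ c : K, linSubst (Matrix.diagonal ![s ^ 2, s, s ^ 2, 1]) (C c) = C c := fun c => by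
    rw [← algebraMap_eq, AlgHom.commutes]
  rw [monomial_eq, monomial_eq, he, Nat.add_sub_cancel_left, Finsupp.prod_pow]
  simp only [map_mul, map_pow, hX, hC, Fin.prod_univ_four, Algebra.algebraMap_self,
    RingHom.id_apply, mul_pow]
  have : (C s : MvPolynomial (Fin 4) K) ^ (2 * m 0 + m 1 + 2 * m 2) = C s ^ (2 + e) := by rw [he]
  simp
  linear_combination (-C (coeff m f) * X 0 ^ m 0 * X 1 ^ m 1 * X 2 ^ m 2 * X 3 ^ m 3) * this

end Degeneration

section Degeneration
variable {K : Type*} [Field K]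

theorem map_relMatrix_det {A B ι : Type*} [CommRing A] [CommRing B] [Algebra K A] [Algebra K B]
    [Fintype ι] (φ : A →ₐ[K] B) {a : ℕ}
    (E : Matrix (Fin 4 × Exponents a ⊕ Exponents (a - 2)) (Exponents (a + 1) ⊕ ι × Fin 4) K)
    (M : Matrix (Fin 4 × Exponents a ⊕ Exponents (a - 2))
      (Fin 4 × Exponents a ⊕ Exponents (a - 2)) K) (f : MvPolynomial (Fin 4) A) (v : ι → Fin 4 → A) :
    φ (E.map (algebraMap K A) * relMatrix a f v + M.map (algebraMap K A)).det =
      (E.map (algebraMap K B) * relMatrix a (map (φ : A →+* B) f) (fun j i => φ (v j i)) +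
        M.map (algebraMap K B)).det := by
  have h1 : (algebraMap K B : K → B) = φ ∘ algebraMap K A := by ext; simp
  rw [AlgHom.map_det]
  congr 1
  rw [map_add, AlgHom.mapMatrix_apply, AlgHom.mapMatrix_apply, Matrix.map_mul, h1,
    ← Matrix.map_map, ← Matrix.map_map]
  congr 2
  exact relMatrix_map a f v (φ : A →+* B)

theorem exists_degeneration_point [IsAlgClosed K] {f : MvPolynomial (Fin 4) K}
    {n : ℕ} {z : Fin n → Fin 4 → K}
    (hz : ∀ j, eval (z j) (degeneration (0 : K) f) = 0)
    (hz1 : ∀ j, ∃ c, eval (z j) (pderiv c (degeneration (0 : K) f)) ≠ 0)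
    (D : MvPolynomial (Option (Fin n × Fin 4)) K)
    (hD : eval (fun o => o.elim 0 fun x => z x.1 x.2) D ≠ 0) :
    ∃ (s : K) (v : Fin n → Fin 4 → K), s ≠ 0 ∧ (∀ j, eval (v j) (degeneration s f) = 0) ∧
      eval (fun o => o.elim s fun x => v x.1 x.2) D ≠ 0 := by
  by_contra hcon
  push Not at hcon
  let F : Fin n → MvPolynomial (Option (Fin n × Fin 4)) K := fun j =>
    eval (fun i => X (some (j, i))) (degeneration (X none) f)
  have hF : ∀ {B : Type _} [CommRing B] [Algebra K B] (x : Option (Fin n × Fin 4) → B) (j),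
      aeval x (F j) = eval (fun i => x (some (j, i))) (degeneration (x none) f) := by
    intro B _ _ x j
    have := map_eval_eq_eval_map ((aeval x : MvPolynomial (Option (Fin n × Fin 4)) K →ₐ[K] B) :
        MvPolynomial (Option (Fin n × Fin 4)) K →+* B)
      (fun i => X (some (j, i))) (degeneration (X none) f)
    rw [map_degeneration] at this
    simpa [F] using this
  have hmem : X none * D ∈ vanishingIdeal K (zeroLocus K (Ideal.span (Set.range F))) := by
    rw [mem_vanishingIdeal_iff]
    intro x hx
    rw [zeroLocus_span] at hx
    have hx' : ∀ j, eval (fun i => x (some (j, i))) (degeneration (x none) f) = 0 := fun j => by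
      rw [← hF]; exact hx _ ⟨j, rfl⟩
    by_cases h0 : x none = 0
    · simp [h0]
    · have := hcon (x none) (fun j i => x (some (j, i))) h0 hx'
      have hxe : (fun o : Option (Fin n × Fin 4) => o.elim (x none) fun y => x (some (y.1, y.2))) = x := by
        funext o; cases o <;> rfl
      rw [hxe] at this
      rw [aeval_eq_eval, map_mul, this, mul_zero]
  rw [vanishingIdeal_zeroLocus_eq_radical, Ideal.mem_radical_iff] at hmem
  obtain ⟨N, hN⟩ := hmem
  have hmap : map (Polynomial.evalRingHom (0 : K)) (degeneration (Polynomial.X : Polynomial K) f) =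
      degeneration (0 : K) f := by
    have := map_degeneration (Polynomial.aeval (0 : K)) (Polynomial.X : Polynomial K) f
    rw [Polynomial.aeval_X] at this
    rw [← this]
    congr 1
  choose c hc using hz1
  choose ζ hζ hζ0 using fun j => exists_approximate_zero
    (degeneration (Polynomial.X : Polynomial K) f) (z j) (by rw [hmap]; exact hz j) (c j)
    (by rw [hmap]; exact hc j) N
  let x : Option (Fin n × Fin 4) → Polynomial K := fun o => o.elim Polynomial.X fun y => ζ y.1 y.2
  have hdvd : Polynomial.X ^ (N + 1) ∣ aeval x ((X none * D) ^ N) := by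
    have hle : Ideal.span (Set.range F) ≤
        (Ideal.span {(Polynomial.X : Polynomial K) ^ (N + 1)}).comap (aeval x) := by
      rw [Ideal.span_le]
      rintro _ ⟨j, rfl⟩
      rw [SetLike.mem_coe, Ideal.mem_comap, Ideal.mem_span_singleton, hF]
      exact hζ j
    exact Ideal.mem_span_singleton.1 (hle hN)
  have hxn : aeval x (X none : MvPolynomial (Option (Fin n × Fin 4)) K) = Polynomial.X :=
    aeval_X _ _
  rw [map_pow, map_mul, hxn, mul_pow, pow_succ] at hdvd
  have h2 := Polynomial.prime_X.dvd_of_dvd_pow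
    ((mul_dvd_mul_iff_left (pow_ne_zero N Polynomial.X_ne_zero)).1 hdvd)
  rw [Polynomial.X_dvd_iff, Polynomial.coeff_zero_eq_eval_zero] at h2
  refine hD (Eq.trans ?_ h2)
  have h3 : (Polynomial.aeval (0 : K)).comp (aeval x) =
      (aeval fun o : Option (Fin n × Fin 4) => o.elim 0 fun y => z y.1 y.2 : _ →ₐ[K] K) := by
    ext o
    cases o with
    | none => simp [x]
    | some y => simpa [x] using hζ0 y.1 y.2
  have h4 := DFunLike.congr_fun h3 D
  rw [aeval_eq_eval] at h4
  simpa using h4.symm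

theorem IsAdaptedCubic.exists_koszulRigid [IsAlgClosed K] {f : MvPolynomial (Fin 4) K}
    (hf : IsAdaptedCubic f) {a n : ℕ} (ha : 3 ≤ a) {z : Fin n → Fin 4 → K}
    (hz : KoszulRigid a (X 3 * (X 3 * X 0 + X 1 ^ 2)) z)
    (hz0 : ∀ j, eval (z j) (X 3 * (X 3 * X 0 + X 1 ^ 2)) = 0)
    (hz1 : ∀ j, z j 3 ≠ 0 ∨ z j 1 ≠ 0) :
    ∃ v : Fin n → Fin 4 → K, KoszulRigid a f v ∧ ∀ j, eval (v j) f = 0 ∧ v j ≠ 0 := by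
  have hzero := hf.degeneration_zero
  rw [← hzero] at hz hz0
  have hsing : ∀ j, ∃ c, eval (z j) (pderiv c (degeneration (0 : K) f)) ≠ 0 := by
    intro j
    by_cases h3 : z j 3 = 0
    · refine ⟨3, ?_⟩
      rw [hzero]
      have h1 := (hz1 j).resolve_left (not_not.2 h3)
      simp [h3, h1, pderiv_X]
    · refine ⟨0, ?_⟩
      rw [hzero]
      simp [h3, pderiv_X]
  have hne0 : degeneration (0 : K) f ≠ 0 := by
    rw [hzero]
    intro h
    simpa using congrArg (eval (![1, 0, 0, 1] : Fin 4 → K)) h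
  obtain ⟨E, M, hdet, hE⟩ := hz.exists_det ha hne0 (degeneration_isHomogeneous hf.homog 0)
  have hcoord : ∀ j, ∃ c, z j c ≠ 0 := fun j => (hz1 j).elim (fun h => ⟨_, h⟩) fun h => ⟨_, h⟩
  choose c hc using hcoord
  let P := MvPolynomial (Option (Fin n × Fin 4)) K
  let D : P := (E.map (algebraMap K P) * relMatrix a (degeneration (X none : P) f)
    (fun j i => X (some (j, i))) + M.map (algebraMap K P)).det
  have hD : ∀ (s : K) (v : Fin n → Fin 4 → K), eval (fun o => o.elim s fun x => v x.1 x.2) D =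
      (E * relMatrix a (degeneration s f) v + M).det := by
    intro s v
    have := map_relMatrix_det (K := K)
      (aeval (fun o : Option (Fin n × Fin 4) => o.elim s fun x => v x.1 x.2) : P →ₐ[K] K) E M
      (degeneration (X none : P) f) (fun j i => X (some (j, i)))
    rw [map_degeneration] at this
    have hid : ((algebraMap K K : K →+* K) : K → K) = id := rfl
    simp only [aeval_X, Option.elim_none, Option.elim_some, aeval_eq_eval, hid, Matrix.map_id]
      at this
    exact this
  obtain ⟨s, v, hs, hv, hDv⟩ := exists_degeneration_point hz0 hsing
    (D * ∏ j, X (some (j, c j))) (by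
      rw [map_mul, hD, map_prod]
      refine mul_ne_zero hdet (Finset.prod_ne_zero_iff.2 fun j _ => ?_)
      simpa using hc j)
  rw [map_mul, hD, map_prod] at hDv
  have hv0 : ∀ j, v j ≠ 0 := fun j hj => by
    have := Finset.prod_ne_zero_iff.1 (right_ne_zero_of_mul hDv) j (Finset.mem_univ j)
    simp [hj] at this
  set A : Matrix (Fin 4) (Fin 4) K := Matrix.diagonal ![s ^ 2, s, s ^ 2, 1] with hA
  set B : Matrix (Fin 4) (Fin 4) K := Matrix.diagonal ![(s ^ 2)⁻¹, s⁻¹, (s ^ 2)⁻¹, 1] with hB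
  have hAB : A * B = 1 := by
    rw [hA, hB, Matrix.diagonal_mul_diagonal, ← Matrix.diagonal_one]
    congr 1
    funext i
    fin_cases i <;> simp [hs]
  have hBA : B * A = 1 := mul_eq_one_comm.1 hAB
  have hassoc : Associated (degeneration s f) (linSubst A f) := by
    rw [← hf.C_mul_degeneration]
    exact associated_unit_mul_right _ _ ((isUnit_iff_ne_zero.2 (pow_ne_zero 2 hs)).map C)
  have hne : degeneration s f ≠ 0 := fun h => by
    rw [h] at hassoc
    have h0 := (associated_zero_iff_eq_zero _).1 hassoc.symm
    have := linSubst_linSubst hAB f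
    rw [h0, map_zero] at this
    have h1 := hf.coeff_13
    rw [← this] at h1
    simp at h1
  have hrig := (hE _ v hne (degeneration_isHomogeneous hf.homog s) hv
    (left_ne_zero_of_mul hDv)).of_associated hassoc
  refine ⟨fun j => A.mulVec (v j), ?_, fun j => ⟨?_, fun h => hv0 j ?_⟩⟩
  · rw [← linSubst_linSubst hAB f]
    refine KoszulRigid.of_linSubst hBA ?_
    simpa [Matrix.mulVec_mulVec, hBA] using hrig
  · rw [← eval_linSubst, ← hf.C_mul_degeneration, map_mul, hv, mul_zero]
  · have h : A.mulVec (v j) = 0 := h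
    rw [← Matrix.one_mulVec (v j), ← hBA, ← Matrix.mulVec_mulVec, h, Matrix.mulVec_zero]

end Degeneration

section Cubic
variable {K V : Type*} [Field K] [AddCommGroup V] [Module K V]

/-- The derivative at `p` of the cubic form `x ↦ Φ x x x`. -/
def polarOne (Φ : V →ₗ[K] V →ₗ[K] V →ₗ[K] K) (p : V) : V →ₗ[K] K :=
  (Φ.flip p).flip p + (Φ p).flip p + Φ p p

/-- The full polarization of the cubic form `x ↦ Φ x x x`. -/
def polarTwo (Φ : V →ₗ[K] V →ₗ[K] V →ₗ[K] K) (p v : V) : V →ₗ[K] K :=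
  Φ p v + Φ v p + (Φ p).flip v + (Φ v).flip p + (Φ.flip p).flip v + (Φ.flip v).flip p

theorem polarOne_apply (Φ : V →ₗ[K] V →ₗ[K] V →ₗ[K] K) (p w : V) :
    polarOne Φ p w = Φ w p p + Φ p w p + Φ p p w := rfl

theorem polarTwo_apply (Φ : V →ₗ[K] V →ₗ[K] V →ₗ[K] K) (p v w : V) :
    polarTwo Φ p v w = Φ p v w + Φ v p w + Φ p w v + Φ v w p + Φ w p v + Φ w v p := rfl

theorem cubic_add (Φ : V →ₗ[K] V →ₗ[K] V →ₗ[K] K) (p v : V) (α β : K) :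
    Φ (α • p + β • v) (α • p + β • v) (α • p + β • v) =
      α ^ 3 * Φ p p p + α ^ 2 * β * polarOne Φ p v + α * β ^ 2 * polarOne Φ v p +
        β ^ 3 * Φ v v v := by
  simp only [polarOne_apply, map_add, map_smul, LinearMap.add_apply, LinearMap.smul_apply,
    smul_eq_mul]
  ring

theorem polarOne_add (Φ : V →ₗ[K] V →ₗ[K] V →ₗ[K] K) (p v w : V) (α β : K) :
    polarOne Φ (α • p + β • v) w =
      α ^ 2 * polarOne Φ p w + α * β * polarTwo Φ p v w + β ^ 2 * polarOne Φ v w := by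
  simp only [polarOne_apply, polarTwo_apply, map_add, map_smul, LinearMap.add_apply,
    LinearMap.smul_apply, smul_eq_mul]
  ring

theorem polarOne_self (Φ : V →ₗ[K] V →ₗ[K] V →ₗ[K] K) (p : V) :
    polarOne Φ p p = 3 * Φ p p p := by
  rw [polarOne_apply]; ring

theorem polarTwo_self (Φ : V →ₗ[K] V →ₗ[K] V →ₗ[K] K) (p w : V) :
    polarTwo Φ w p p = 2 * polarOne Φ p w := by
  rw [polarOne_apply, polarTwo_apply]; ring

theorem exists_binary_cubic_root [IsAlgClosed K] (a b c d : K) :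
    ∃ α β : K, (α ≠ 0 ∨ β ≠ 0) ∧
      α ^ 3 * a + α ^ 2 * β * b + α * β ^ 2 * c + β ^ 3 * d = 0 := by
  by_cases ha : a = 0
  · exact ⟨1, 0, Or.inl one_ne_zero, by simp [ha]⟩
  · obtain ⟨x, hx⟩ := IsAlgClosed.exists_root (Cubic.toPoly ⟨a, b, c, d⟩)
      (by rw [Cubic.degree_of_a_ne_zero' ha]; decide)
    refine ⟨x, 1, Or.inr one_ne_zero, ?_⟩
    simp only [Cubic.toPoly, Polynomial.IsRoot.def, Polynomial.eval_add, Polynomial.eval_mul,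
      Polynomial.eval_C, Polynomial.eval_pow, Polynomial.eval_X] at hx
    linear_combination hx

theorem exists_binary_quadratic_root [IsAlgClosed K] (a b c : K) :
    ∃ α β : K, (α ≠ 0 ∨ β ≠ 0) ∧ α ^ 2 * a + α * β * b + β ^ 2 * c = 0 := by
  by_cases ha : a = 0
  · exact ⟨1, 0, Or.inl one_ne_zero, by simp [ha]⟩
  · obtain ⟨x, hx⟩ := IsAlgClosed.exists_root (Cubic.toPoly ⟨0, a, b, c⟩)
      (by rw [Cubic.degree_of_b_ne_zero' ha]; decide)
    refine ⟨x, 1, Or.inr one_ne_zero, ?_⟩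
    simp only [Cubic.toPoly, Polynomial.IsRoot.def, Polynomial.eval_add, Polynomial.eval_mul,
      Polynomial.eval_C, Polynomial.eval_pow, Polynomial.eval_X] at hx
    linear_combination hx

theorem exists_eq_mul_of_forall_eq_zero (A B : V →ₗ[K] K) (h : ∀ w, A w = 0 → B w = 0) :
    ∃ b : K, ∀ w, B w = b * A w := by
  by_cases hA : ∀ w, A w = 0
  · exact ⟨0, fun w => by rw [h w (hA w), zero_mul]⟩
  · push Not at hA
    obtain ⟨w₀, hw₀⟩ := hA
    refine ⟨B w₀ / A w₀, fun w => ?_⟩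
    have := h (A w₀ • w - A w • w₀) (by simp [mul_comm])
    simp only [map_sub, map_smul, smul_eq_mul] at this
    field_simp
    linear_combination this

variable [FiniteDimensional K V]

theorem exists_ker_notMem_span (hV : Module.finrank K V = 4) (A : V →ₗ[K] K) (p q : V) :
    ∃ w, A w = 0 ∧ w ∉ Submodule.span K {p, q} := by
  by_contra! h
  have h1 : LinearMap.ker A ≤ Submodule.span K {p, q} := fun w hw => h w hw
  have h2 := Submodule.finrank_mono h1
  have h3 := LinearMap.finrank_range_add_finrank_ker A
  have h4 : Module.finrank K (LinearMap.range A) ≤ 1 := by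
    simpa using Submodule.finrank_le (LinearMap.range A)
  classical
  have h5 : Module.finrank K (Submodule.span K ({p, q} : Set V)) ≤ 2 := by
    refine (finrank_span_le_card ({p, q} : Set V)).trans ?_
    rw [Set.toFinset_insert, Set.toFinset_singleton]
    exact Finset.card_le_two
  omega

theorem exists_tangent_zero [IsAlgClosed K] (hV : Module.finrank K V = 4)
    (Φ : V →ₗ[K] V →ₗ[K] V →ₗ[K] K) {p : V} (hp : p ≠ 0) :
    ∃ v, Φ v v v = 0 ∧ polarOne Φ p v = 0 ∧ ∀ α β : K, α • p + β • v = 0 → α = 0 ∧ β = 0 := by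
  obtain ⟨w₁, h1, hw1⟩ := exists_ker_notMem_span hV (polarOne Φ p) p p
  obtain ⟨w₂, h2, hw2⟩ := exists_ker_notMem_span hV (polarOne Φ p) p w₁
  rw [Set.pair_eq_singleton, Submodule.mem_span_singleton] at hw1
  rw [Submodule.mem_span_pair] at hw2
  push Not at hw1 hw2
  obtain ⟨γ, δ, hγδ, hroot⟩ := exists_binary_cubic_root (Φ w₁ w₁ w₁) (polarOne Φ w₁ w₂)
    (polarOne Φ w₂ w₁) (Φ w₂ w₂ w₂)
  refine ⟨γ • w₁ + δ • w₂, by rw [cubic_add, hroot], by simp [h1, h2], fun α β h => ?_⟩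
  by_cases hβ : β = 0
  · subst hβ
    simpa [hp] using h
  exfalso
  have hβδ : δ = 0 := by
    by_contra hδ
    refine hw2 (-(α * (β * δ)⁻¹)) (-(γ * δ⁻¹)) ?_
    linear_combination (norm := skip) (-(β * δ)⁻¹) • h
    match_scalars <;> field_simp <;> ring
  subst hβδ
  have hγ : γ ≠ 0 := hγδ.resolve_right (not_not.2 rfl)
  refine hw1 (-(α * (β * γ)⁻¹)) ?_
  linear_combination (norm := skip) (-(β * γ)⁻¹) • h
  match_scalars <;> field_simp <;> ring

end Cubic

section Flex
variable {K V : Type*} [Field K] [AddCommGroup V] [Module K V]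

theorem polarTwo_comm (Φ : V →ₗ[K] V →ₗ[K] V →ₗ[K] K) (p v w : V) :
    polarTwo Φ p v w = polarTwo Φ p w v := by
  simp only [polarTwo_apply]; ring

theorem polarTwo_swap (Φ : V →ₗ[K] V →ₗ[K] V →ₗ[K] K) (p v w : V) :
    polarTwo Φ p v w = polarTwo Φ v p w := by
  simp only [polarTwo_apply]; ring

/-- A line `⟨p, v⟩` on a smooth cubic along which every tangent direction is asymptotic has
vanishing second polar. -/
theorem polarTwo_eq_zero_of_forall [IsAlgClosed K] (A B C : V →ₗ[K] K)
    (hne : ∀ α β : K, α ≠ 0 ∨ β ≠ 0 → ∃ w, α ^ 2 * A w + α * β * B w + β ^ 2 * C w ≠ 0)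
    (hA : ∀ w, A w = 0 → B w = 0) (hC : ∀ w, C w = 0 → B w = 0) : B = 0 := by
  obtain ⟨b, hb⟩ := exists_eq_mul_of_forall_eq_zero A B hA
  obtain ⟨c, hc⟩ := exists_eq_mul_of_forall_eq_zero C B hC
  by_cases hb0 : b = 0
  · ext w; simp [hb, hb0]
  by_cases hc0 : c = 0
  · ext w; simp [hc, hc0]
  exfalso
  obtain ⟨α, β, hαβ, hroot⟩ := exists_binary_quadratic_root b⁻¹ 1 c⁻¹
  obtain ⟨w, hw⟩ := hne α β hαβ
  apply hw
  have h1 : A w = b⁻¹ * B w := by rw [hb]; field_simp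
  have h2 : C w = c⁻¹ * B w := by rw [hc]; field_simp
  rw [h1, h2]
  linear_combination (B w) * hroot

theorem exists_dual_pair_of_two_eq_zero [IsAlgClosed K] (A C : V →ₗ[K] K)
    (hne : ∀ α β : K, α ≠ 0 ∨ β ≠ 0 → ∃ w, α ^ 2 * A w + β ^ 2 * C w ≠ 0) :
    ∃ w, A w = 1 ∧ C w = 0 := by
  by_contra! h
  have h' : ∀ w, C w = 0 → A w = 0 := by
    intro w hw
    by_contra hA
    exact h ((A w)⁻¹ • w) (by simp [hA]) (by simp [hw])
  obtain ⟨e, he⟩ := exists_eq_mul_of_forall_eq_zero C A h'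
  obtain ⟨x, hx⟩ := IsAlgClosed.exists_pow_nat_eq (-e) (n := 2) (by norm_num)
  obtain ⟨w, hw⟩ := hne 1 x (Or.inl one_ne_zero)
  apply hw
  rw [he, hx]; ring

theorem coeffs_eq_zero_of_forall_eval [Infinite K] {a b c d e f : K}
    (h : ∀ t : K, a + b * t + c * t ^ 2 + d * t ^ 3 + e * t ^ 4 + f * t ^ 5 = 0) :
    a = 0 ∧ b = 0 ∧ c = 0 ∧ d = 0 ∧ e = 0 ∧ f = 0 := by
  have hP : Polynomial.C a + Polynomial.C b * Polynomial.X + Polynomial.C c * Polynomial.X ^ 2 +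
      Polynomial.C d * Polynomial.X ^ 3 + Polynomial.C e * Polynomial.X ^ 4 +
      Polynomial.C f * Polynomial.X ^ 5 = 0 :=
    Polynomial.funext fun t => by simpa using h t
  have hc := fun n => congrArg (fun P => Polynomial.coeff P n) hP
  refine ⟨?_, ?_, ?_, ?_, ?_, ?_⟩
  · simpa [Polynomial.coeff_X, Polynomial.coeff_X_pow, Polynomial.coeff_C] using hc 0
  · simpa [Polynomial.coeff_X, Polynomial.coeff_X_pow, Polynomial.coeff_C] using hc 1
  · simpa [Polynomial.coeff_X, Polynomial.coeff_X_pow, Polynomial.coeff_C] using hc 2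
  · simpa [Polynomial.coeff_X, Polynomial.coeff_X_pow, Polynomial.coeff_C] using hc 3
  · simpa [Polynomial.coeff_X, Polynomial.coeff_X_pow, Polynomial.coeff_C] using hc 4
  · simpa [Polynomial.coeff_X, Polynomial.coeff_X_pow, Polynomial.coeff_C] using hc 5

variable [FiniteDimensional K V]

theorem exists_tangent_not_asymptotic [IsAlgClosed K] (hV : Module.finrank K V = 4)
    (Φ : V →ₗ[K] V →ₗ[K] V →ₗ[K] K)
    (hsm : ∀ p, p ≠ 0 → Φ p p p = 0 → ∃ w, polarOne Φ p w ≠ 0) :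
    ∃ p w, p ≠ 0 ∧ Φ p p p = 0 ∧ polarOne Φ p w = 0 ∧ polarOne Φ w p ≠ 0 := by
  by_contra! H
  obtain ⟨p, hp, hp0⟩ : ∃ p : V, p ≠ 0 ∧ Φ p p p = 0 := by
    have : Nontrivial V := Module.nontrivial_of_finrank_pos (R := K) (by omega)
    obtain ⟨q, hq⟩ := exists_ne (0 : V)
    obtain ⟨v, hv, -, hind⟩ := exists_tangent_zero hV Φ hq
    refine ⟨v, fun h => ?_, hv⟩
    simpa using (hind 0 1 (by simp [h])).2
  obtain ⟨v, hv0, hpv, hind⟩ := exists_tangent_zero hV Φ hp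
  have hvp : polarOne Φ v p = 0 := H p v hp hp0 hpv
  have hline : ∀ α β : K, Φ (α • p + β • v) (α • p + β • v) (α • p + β • v) = 0 := fun α β => by
    rw [cubic_add, hp0, hpv, hvp, hv0]; ring
  have hne : ∀ α β : K, α ≠ 0 ∨ β ≠ 0 → α • p + β • v ≠ 0 := fun α β h h0 => by
    obtain ⟨rfl, rfl⟩ := hind α β h0
    simp at h
  have key : ∀ (α β : K) (w), α ≠ 0 ∨ β ≠ 0 →
      α ^ 2 * polarOne Φ p w + α * β * polarTwo Φ p v w + β ^ 2 * polarOne Φ v w = 0 →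
      α * polarOne Φ w p + β * polarOne Φ w v = 0 := by
    intro α β w hαβ hw
    have := H _ w (hne α β hαβ) (hline α β) (by rw [polarOne_add, hw])
    simpa using this
  have hpp : polarOne Φ p p = 0 := by rw [polarOne_self, hp0, mul_zero]
  have hvv : polarOne Φ v v = 0 := by rw [polarOne_self, hv0, mul_zero]
  have hBp : polarTwo Φ p v p = 0 := by rw [polarTwo_swap, polarTwo_self, hpv, mul_zero]
  have hBv : polarTwo Φ p v v = 0 := by rw [polarTwo_self, hvp, mul_zero]
  have keyp : ∀ (α β : K) (w), α ≠ 0 ∨ β ≠ 0 →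
      α ^ 2 * polarOne Φ p w + α * β * polarTwo Φ p v w + β ^ 2 * polarOne Φ v w = 0 →
      2 * α * polarOne Φ p w + β * polarTwo Φ p v w = 0 := by
    intro α β w hαβ hw
    have hwpv : polarTwo Φ w p v = polarTwo Φ p v w := by rw [polarTwo_swap, polarTwo_comm]
    have h1 := key α β w hαβ hw
    have h2 := key α β ((1 : K) • w + (1 : K) • p) hαβ (by
      simp only [one_smul, map_add, hpp, hvp, hBp, add_zero, hw])
    rw [polarOne_add, polarOne_add, polarTwo_self, hpp, hpv, hwpv] at h2
    linear_combination h2 - h1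
  have keyv : ∀ (α β : K) (w), α ≠ 0 ∨ β ≠ 0 →
      α ^ 2 * polarOne Φ p w + α * β * polarTwo Φ p v w + β ^ 2 * polarOne Φ v w = 0 →
      α * polarTwo Φ p v w + 2 * β * polarOne Φ v w = 0 := by
    intro α β w hαβ hw
    have hwvp : polarTwo Φ w v p = polarTwo Φ p v w := by
      rw [polarTwo_comm, polarTwo_swap, polarTwo_comm]
    have h1 := key α β w hαβ hw
    have h2 := key α β ((1 : K) • w + (1 : K) • v) hαβ (by
      simp only [one_smul, map_add, hpv, hvv, hBv, add_zero, hw])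
    rw [polarOne_add, polarOne_add, polarTwo_self, hvv, hvp, hwvp] at h2
    linear_combination h2 - h1
  have hsmooth : ∀ α β : K, α ≠ 0 ∨ β ≠ 0 →
      ∃ w, α ^ 2 * polarOne Φ p w + α * β * polarTwo Φ p v w + β ^ 2 * polarOne Φ v w ≠ 0 := by
    intro α β hαβ
    obtain ⟨w, hw⟩ := hsm _ (hne α β hαβ) (hline α β)
    exact ⟨w, by rwa [← polarOne_add]⟩
  have hB : polarTwo Φ p v = 0 := by
    refine polarTwo_eq_zero_of_forall _ _ _ hsmooth (fun w hw => ?_) (fun w hw => ?_)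
    · simpa using keyv 1 0 w (Or.inl one_ne_zero) (by simp [hw])
    · simpa using keyp 0 1 w (Or.inr one_ne_zero) (by simp [hw])
  simp only [hB, LinearMap.zero_apply, mul_zero, add_zero, zero_add] at keyp keyv key hsmooth
  by_cases h2 : (2 : K) = 0
  · have hsmooth' : ∀ α β : K, α ≠ 0 ∨ β ≠ 0 →
        ∃ w, α ^ 2 * polarOne Φ v w + β ^ 2 * polarOne Φ p w ≠ 0 := fun α β h => by
      obtain ⟨w, hw⟩ := hsmooth β α h.symm
      exact ⟨w, by rwa [add_comm]⟩
    obtain ⟨w₁, hA1, hC1⟩ := exists_dual_pair_of_two_eq_zero _ _ hsmooth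
    obtain ⟨w₂, hC2, hA2⟩ := exists_dual_pair_of_two_eq_zero _ _ hsmooth'
    have hpoly : ∀ t : K, polarOne Φ w₁ v + polarOne Φ w₁ p * t + polarTwo Φ w₁ w₂ v * t ^ 2 +
        polarTwo Φ w₁ w₂ p * t ^ 3 + polarOne Φ w₂ v * t ^ 4 + polarOne Φ w₂ p * t ^ 5 = 0 := by
      intro t
      have := key t 1 ((1 : K) • w₁ + (t ^ 2) • w₂) (Or.inr one_ne_zero) (by
        simp only [map_add, map_smul, hA1, hC1, hA2, hC2, smul_eq_mul]
        linear_combination t ^ 2 * h2)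
      rw [polarOne_add, polarOne_add] at this
      linear_combination this
    obtain ⟨e1, e2, e3, e4, e5, e6⟩ := coeffs_eq_zero_of_forall_eval hpoly
    obtain ⟨x, hx⟩ := IsAlgClosed.exists_pow_nat_eq (-(3 * Φ w₁ w₁ w₁)) (n := 2) (by norm_num)
    obtain ⟨y, hy⟩ := IsAlgClosed.exists_pow_nat_eq (-polarOne Φ w₁ w₂) (n := 2) (by norm_num)
    set u : V := (1 : K) • w₁ + (1 : K) • (x • p + y • v) with hu
    have hBw : ∀ w, polarTwo Φ p v w = 0 := fun w => by rw [hB, LinearMap.zero_apply]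
    have hmid : ∀ w, polarTwo Φ w₁ (x • p + y • v) w =
        x * polarTwo Φ w₁ w p + y * polarTwo Φ w₁ w v := fun w => by
      rw [polarTwo_comm, map_add, map_smul, map_smul, smul_eq_mul, smul_eq_mul]
    have huw : ∀ w, polarOne Φ u w = polarOne Φ w₁ w + x * polarTwo Φ w₁ w p +
        y * polarTwo Φ w₁ w v + x ^ 2 * polarOne Φ p w + y ^ 2 * polarOne Φ v w := fun w => by
      rw [hu, polarOne_add, hmid, polarOne_add, hBw]; ring
    have hup : polarOne Φ u p = 0 := by
      rw [huw, polarTwo_self, polarTwo_swap, polarTwo_comm, hBw, hpp, hvp, e2]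
      linear_combination x * polarOne Φ p w₁ * h2
    have huv : polarOne Φ u v = 0 := by
      rw [huw, polarTwo_self, polarTwo_comm, polarTwo_swap, polarTwo_comm, hBw, hpv, hvv, e1]
      linear_combination y * polarOne Φ v w₁ * h2
    have hu1 : polarOne Φ u w₁ = 0 := by
      rw [huw, polarOne_self, hx, hA1, hC1, polarTwo_comm Φ w₁ w₁, polarTwo_comm Φ w₁ w₁,
        polarTwo_swap Φ w₁ p, polarTwo_swap Φ w₁ v, polarTwo_self, polarTwo_self, e1, e2]
      ring
    have hu2 : polarOne Φ u w₂ = 0 := by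
      rw [huw, e3, e4, hA2, hC2, hy]
      ring
    have hspan : ⊤ ≤ Submodule.span K (Set.range ![p, v, w₁, w₂]) := by
      have hli : LinearIndependent K ![p, v, w₁, w₂] := by
        rw [Fintype.linearIndependent_iff]
        intro g hg
        simp only [Fin.sum_univ_four, Matrix.cons_val] at hg
        have hA := congrArg (polarOne Φ p) hg
        have hC := congrArg (polarOne Φ v) hg
        simp only [map_add, map_smul, hpp, hpv, hvp, hvv, hA1, hA2, hC1, hC2, smul_eq_mul, map_zero,
          mul_zero, mul_one, zero_add, add_zero] at hA hC
        rw [hA, hC, zero_smul, zero_smul, add_zero, add_zero] at hg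
        obtain ⟨h0, h1⟩ := hind _ _ hg
        intro i
        fin_cases i
        exacts [h0, h1, hA, hC]
      exact (hli.span_eq_top_of_card_eq_finrank (by simp [hV])).ge
    have hzero : polarOne Φ u = 0 := by
      refine LinearMap.ext_on (top_le_iff.1 hspan) ?_
      rintro _ ⟨i, rfl⟩
      fin_cases i
      exacts [hup, huv, hu1, hu2]
    have hu0 : u ≠ 0 := fun h => by
      have := congrArg (polarOne Φ p) h
      simp [hu, hA1, hpp, hpv] at this
    have hself := polarOne_self Φ u
    rw [hzero, LinearMap.zero_apply] at hself
    obtain ⟨w, hw⟩ := hsm u hu0 (by linear_combination -hself - Φ u u u * h2)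
    exact hw (by rw [hzero, LinearMap.zero_apply])
  · have hker : ∀ w, (polarOne Φ p + polarOne Φ v) w = 0 → polarOne Φ p w = 0 := fun w hw => by
      have := keyp 1 1 w (Or.inl one_ne_zero) (by simpa using hw)
      simpa [h2] using this
    obtain ⟨e, he⟩ := exists_eq_mul_of_forall_eq_zero _ _ hker
    obtain ⟨α, hα⟩ := IsAlgClosed.exists_pow_nat_eq (1 - e) (n := 2) (by norm_num)
    obtain ⟨β, hβ⟩ := IsAlgClosed.exists_pow_nat_eq (-e) (n := 2) (by norm_num)
    have hαβ : α ≠ 0 ∨ β ≠ 0 := by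
      by_contra! h
      rw [h.1] at hα
      rw [h.2] at hβ
      exact one_ne_zero (α := K) (by linear_combination -hα + hβ)
    obtain ⟨w, hw⟩ := hsmooth α β hαβ
    apply hw
    have := he w
    rw [LinearMap.add_apply] at this
    rw [hα, hβ]
    linear_combination this

end Flex

section AdaptedCoordinates
variable {K : Type*} [Field K]

theorem exists_trilinear_add {σ V : Type*} [AddCommGroup V] [Module K V]
    {f g : V → K} {f' g' : σ → V → K} {e : σ → V}
    (hf : ∃ Φ : V →ₗ[K] V →ₗ[K] V →ₗ[K] K, (∀ x, f x = Φ x x x) ∧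
      ∀ i x, f' i x = polarOne Φ x (e i))
    (hg : ∃ Φ : V →ₗ[K] V →ₗ[K] V →ₗ[K] K, (∀ x, g x = Φ x x x) ∧
      ∀ i x, g' i x = polarOne Φ x (e i)) :
    ∃ Φ : V →ₗ[K] V →ₗ[K] V →ₗ[K] K, (∀ x, f x + g x = Φ x x x) ∧
      ∀ i x, f' i x + g' i x = polarOne Φ x (e i) := by
  obtain ⟨Φ, h1, h2⟩ := hf
  obtain ⟨Ψ, h3, h4⟩ := hg
  refine ⟨Φ + Ψ, fun x => by simp [h1, h3], fun i x => ?_⟩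
  rw [h2, h4, polarOne_apply, polarOne_apply, polarOne_apply]
  simp only [LinearMap.add_apply]
  ring

theorem MvPolynomial.IsHomogeneous.exists_trilinear {σ : Type*} [DecidableEq σ]
    {f : MvPolynomial σ K} (hf : f.IsHomogeneous 3) :
    ∃ Φ : (σ → K) →ₗ[K] (σ → K) →ₗ[K] (σ → K) →ₗ[K] K, (∀ x, eval x f = Φ x x x) ∧
      ∀ i x, eval x (pderiv i f) = polarOne Φ x (Pi.single i 1) := by
  have hmon : ∀ m ∈ f.support, ∃ Φ : (σ → K) →ₗ[K] (σ → K) →ₗ[K] (σ → K) →ₗ[K] K,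
      (∀ x, eval x (monomial m (coeff m f)) = Φ x x x) ∧
      ∀ i x, eval x (pderiv i (monomial m (coeff m f))) = polarOne Φ x (Pi.single i 1) := by
    intro m hm
    have hdeg : m.degree = 3 := by
      by_contra h
      exact (mem_support_iff.1 hm) (hf.coeff_eq_zero h)
    have hcard : m.toMultiset.card = 3 := by rw [Finsupp.card_toMultiset, ← hdeg]; rfl
    obtain ⟨p, q, r, hpqr⟩ := Multiset.card_eq_three.1 hcard
    have hm' : m = Finsupp.single p 1 + Finsupp.single q 1 + Finsupp.single r 1 := by
      apply (Multiset.toFinsupp (α := σ)).symm.injective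
      simp only [Multiset.toFinsupp_symm_apply, map_add, Finsupp.toMultiset_single, one_smul, hpqr]
      rfl
    have hmono : monomial m (coeff m f) = C (coeff m f) * (X p * X q * X r) := by
      rw [hm', X, X, X, monomial_mul, monomial_mul, C_mul_monomial]; simp
    refine ⟨coeff m f • (LinearMap.proj p).smulRight ((LinearMap.proj q).smulRight
      (LinearMap.proj r)), fun x => ?_, fun i x => ?_⟩
    · rw [hmono]
      simp [mul_assoc]
    · rw [hmono, polarOne_apply]
      simp only [pderiv_mul, pderiv_C, pderiv_X, map_mul, map_add, eval_C, eval_X,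
        LinearMap.smul_apply, LinearMap.smulRight_apply, LinearMap.proj_apply, smul_eq_mul, map_zero]
      have : ∀ j, eval x (Pi.single (M := fun _ => MvPolynomial σ K) i 1 j) =
          (Pi.single (M := fun _ => K) i 1 : σ → K) j := by
        intro j
        by_cases h : j = i
        · subst h; simp
        · simp [h]
      simp only [this]
      ring
  have hsum : ∀ s : Finset (σ →₀ ℕ), s ⊆ f.support →
      ∃ Φ : (σ → K) →ₗ[K] (σ → K) →ₗ[K] (σ → K) →ₗ[K] K,
      (∀ x, eval x (∑ m ∈ s, monomial m (coeff m f)) = Φ x x x) ∧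
      ∀ i x, eval x (pderiv i (∑ m ∈ s, monomial m (coeff m f))) =
        polarOne Φ x (Pi.single i 1) := by
    classical
    intro s
    induction s using Finset.induction_on with
    | empty => exact fun _ => ⟨0, by simp, by simp [polarOne_apply]⟩
    | insert m s hm ih =>
      intro hs
      rw [Finset.sum_insert hm]
      simp only [map_add]
      exact exists_trilinear_add (hmon m (hs (Finset.mem_insert_self _ _)))
        (ih ((Finset.subset_insert _ _).trans hs))
  have := hsum _ subset_rfl
  rwa [support_sum_monomial_coeff] at this

theorem polarOne_comp (Φ : (Fin 4 → K) →ₗ[K] (Fin 4 → K) →ₗ[K] (Fin 4 → K) →ₗ[K] K)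
    {f : MvPolynomial (Fin 4) K}
    (h : ∀ i x, eval x (pderiv i f) = polarOne Φ x (Pi.single i 1))
    (A : Matrix (Fin 4) (Fin 4) K) (i : Fin 4) (x : Fin 4 → K) :
    eval x (pderiv i (linSubst A f)) = polarOne Φ (A.mulVec x) (fun k => A k i) := by
  have hchain : ∀ g : MvPolynomial (Fin 4) K, eval x (pderiv i (linSubst A g)) =
      ∑ k, A k i * eval (A.mulVec x) (pderiv k g) := by
    intro g
    induction g using MvPolynomial.induction_on with
    | C c =>
      have : linSubst A (C c) = C c := by simp [linSubst]
      simp [this]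
    | add p q hp hq => simp only [map_add, hp, hq, mul_add, Finset.sum_add_distrib]
    | mul_X p j hp =>
      simp only [map_mul, pderiv_mul, map_add, hp, eval_linSubst, mul_add, Finset.sum_add_distrib,
        Finset.sum_mul, mul_assoc, linSubst_X, map_sum, pderiv_C, zero_mul, zero_add, eval_X]
      congr 1
      · simp [Matrix.mulVec, dotProduct]
      · simp [pderiv_X, Pi.single_apply, Finset.sum_ite_eq, mul_comm, apply_ite]
  rw [hchain]
  simp only [h]
  have hcol : (fun k => A k i) = ∑ k, A k i • (Pi.single k 1 : Fin 4 → K) := by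
    ext k; simp [Pi.single_apply, Finset.sum_apply]
  rw [hcol, map_sum]
  simp

theorem MvPolynomial.IsHomogeneous.eval_single {σ : Type*} [DecidableEq σ] {g : MvPolynomial σ K}
    {n : ℕ} (hg : g.IsHomogeneous n) (j : σ) :
    eval (Pi.single j 1) g = coeff (Finsupp.single j n) g := by
  rw [eval_eq]
  have hother : ∀ m ∈ g.support, m ≠ Finsupp.single j n →
      coeff m g * ∏ i ∈ m.support, (Pi.single j 1 : σ → K) i ^ m i = 0 := by
    intro m hm hmj
    obtain ⟨i, hi, hij⟩ : ∃ i ∈ m.support, i ≠ j := by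
      by_contra! h
      obtain ⟨c, hc⟩ := (Finsupp.support_subset_singleton'.1
        fun i hi => Finset.mem_singleton.2 (h i hi) : ∃ c, m = Finsupp.single j c)
      have hd : m.degree = n := by
        by_contra hne
        exact (mem_support_iff.1 hm) (hg.coeff_eq_zero hne)
      rw [hc, Finsupp.degree_single] at hd
      exact hmj (hc.trans (by rw [hd]))
    rw [Finset.prod_eq_zero hi, mul_zero]
    rw [Pi.single_eq_of_ne hij, zero_pow (Finsupp.mem_support_iff.1 hi)]
  rw [Finset.sum_eq_single (Finsupp.single j n) hother]
  · rw [Finset.prod_eq_one, mul_one]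
    intro i hi
    by_cases hij : i = j
    · subst hij; simp
    · simp [Ne.symm hij] at hi
  · intro h
    rw [notMem_support_iff.1 h, zero_mul]

theorem MvPolynomial.IsHomogeneous.coeff_single_add_single {σ : Type*} [DecidableEq σ]
    {f : MvPolynomial σ K} {n : ℕ} (hf : f.IsHomogeneous (n + 1)) {i j : σ} (hij : i ≠ j) :
    coeff (Finsupp.single j n + Finsupp.single i 1) f = eval (Pi.single j 1) (pderiv i f) := by
  have h := hf.pderiv (i := i)
  rw [Nat.add_sub_cancel] at h
  rw [h.eval_single, coeff_pderiv]
  simp [hij]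

theorem exists_isAdaptedCubic_linSubst [IsAlgClosed K] {f : MvPolynomial (Fin 4) K}
    (hf : f.IsHomogeneous 3)
    (hsm : ∀ v : Fin 4 → K, v ≠ 0 → eval v f = 0 → ∃ i, eval v (pderiv i f) ≠ 0) :
    ∃ A B : Matrix (Fin 4) (Fin 4) K, A * B = 1 ∧ IsAdaptedCubic (linSubst A f) := by
  obtain ⟨Φ, hΦ, hΦ'⟩ := hf.exists_trilinear
  have hV : Module.finrank K (Fin 4 → K) = 4 := by simp
  obtain ⟨p, w, hp, hp0, hpw, hwp⟩ := exists_tangent_not_asymptotic hV Φ fun p hp hp0 => by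
    obtain ⟨i, hi⟩ := hsm p hp (by rw [hΦ, hp0])
    exact ⟨_, by rwa [← hΦ']⟩
  obtain ⟨b₀', hb₀'⟩ : ∃ b, polarOne Φ p b ≠ 0 := by
    obtain ⟨i, hi⟩ := hsm p hp (by rw [hΦ, hp0])
    exact ⟨_, by rwa [← hΦ']⟩
  have hpp : polarOne Φ p p = 0 := by rw [polarOne_self, hp0, mul_zero]
  obtain ⟨b₂, hb₂, hb₂'⟩ := exists_ker_notMem_span hV (polarOne Φ p) p w
  obtain ⟨s, hs⟩ := IsAlgClosed.exists_pow_nat_eq (polarOne Φ w p)⁻¹ (n := 2) (by norm_num)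
  have hs0 : s ≠ 0 := fun h => by
    rw [h] at hs
    exact inv_ne_zero hwp (by rw [← hs]; norm_num)
  have hsm1 : ∀ c : K, polarOne Φ (c • w) p = c ^ 2 * polarOne Φ w p := fun c => by
    have := polarOne_add Φ w 0 p c 0
    simpa using this
  let b : Fin 4 → Fin 4 → K := ![(polarOne Φ p b₀')⁻¹ • b₀', s • w, b₂, p]
  have hb0 : polarOne Φ p (b 0) = 1 := by simp [b, hb₀']
  have hb1 : polarOne Φ p (b 1) = 0 := by simp [b, hpw]
  have hb2 : polarOne Φ p (b 2) = 0 := hb₂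
  have hb3 : polarOne Φ p (b 3) = 0 := hpp
  have hb13 : polarOne Φ (b 1) p = 1 := by
    change polarOne Φ (s • w) p = 1
    rw [hsm1, hs, inv_mul_cancel₀ hwp]
  have hli : LinearIndependent K b := by
    rw [Fintype.linearIndependent_iff]
    intro g hg
    rw [Fin.sum_univ_four] at hg
    have h0 : g 0 = 0 := by
      have := congrArg (polarOne Φ p) hg
      simpa [hb0, hb1, hb2, hb3] using this
    rw [Submodule.mem_span_pair] at hb₂'
    push Not at hb₂'
    have hg' : (g 1 * s) • w + g 2 • b₂ + g 3 • p = 0 := by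
      rw [h0, zero_smul, zero_add] at hg
      rw [mul_smul]
      exact hg
    have h2 : g 2 = 0 := by
      by_contra h2
      refine hb₂' (-((g 2)⁻¹ * g 3)) (-((g 2)⁻¹ * (g 1 * s))) ?_
      linear_combination (norm := skip) (-(g 2)⁻¹) • hg'
      match_scalars <;> field_simp <;> ring
    rw [h2, zero_smul, add_zero] at hg'
    have h1 : g 1 = 0 := by
      by_contra h1
      have h1s := mul_ne_zero h1 hs0
      have : w = (-((g 1 * s)⁻¹ * g 3)) • p := by
        linear_combination (norm := skip) ((g 1 * s)⁻¹) • hg'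
        match_scalars <;> field_simp <;> ring
      apply hwp
      rw [this]
      have := polarOne_add Φ p 0 p (-((g 1 * s)⁻¹ * g 3)) 0
      rw [hpp] at this
      simpa using this
    have h3 : g 3 = 0 := by
      rw [h1, zero_mul, zero_smul, zero_add] at hg'
      exact (smul_eq_zero.1 hg').resolve_right hp
    intro i
    fin_cases i
    exacts [h0, h1, h2, h3]
  let A : Matrix (Fin 4) (Fin 4) K := Matrix.of fun i j => b j i
  have hA : IsUnit A := Matrix.linearIndependent_cols_iff_isUnit.1 hli
  have hAe : ∀ j, A.mulVec (Pi.single j 1) = b j := fun j => by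
    rw [Matrix.mulVec_single_one]; rfl
  have hhom := linSubst_isHomogeneous A hf
  have hcoeff : ∀ i j : Fin 4, i ≠ j → coeff (Finsupp.single j 2 + Finsupp.single i 1)
      (linSubst A f) = polarOne Φ (b j) (b i) := fun i j hij => by
    rw [hhom.coeff_single_add_single hij, polarOne_comp Φ hΦ', hAe]
    rfl
  refine ⟨A, A⁻¹, Matrix.mul_nonsing_inv A ((Matrix.isUnit_iff_isUnit_det A).1 hA),
    ⟨hhom, ?_, ?_, ?_, ?_, ?_⟩⟩
  · rw [← hhom.eval_single, eval_linSubst, hAe, hΦ]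
    exact hp0
  · rw [hcoeff _ _ (by decide)]; exact hb1
  · rw [hcoeff _ _ (by decide)]; exact hb2
  · rw [hcoeff _ _ (by decide)]; exact hb0
  · rw [hcoeff _ _ (by decide)]; exact hb13

theorem exists_koszulRigid_of_smooth [IsAlgClosed K] {f : MvPolynomial (Fin 4) K}
    (hf : f.IsHomogeneous 3)
    (hsm : ∀ v : Fin 4 → K, v ≠ 0 → eval v f = 0 → ∃ i, eval v (pderiv i f) ≠ 0)
    {a : ℕ} (ha : 3 ≤ a) :
    ∃ v : Fin (3 * (a * (a - 1) / 2) + 2 * a) → Fin 4 → K,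
      KoszulRigid a f v ∧ ∀ j, eval (v j) f = 0 ∧ v j ≠ 0 := by
  obtain ⟨z, hz, hz'⟩ := exists_koszulRigid_special (K := K) ha
  let P : Matrix (Fin 4) (Fin 4) K := !![1, 1, 0, 0; 1, 0, 1, 0; 0, 0, 1, 0; 0, 0, 0, 1]
  let Q : Matrix (Fin 4) (Fin 4) K := !![0, 1, -1, 0; 1, -1, 1, 0; 0, 0, 1, 0; 0, 0, 0, 1]
  have hPQ : P * Q = 1 := by
    ext i j
    fin_cases i <;> fin_cases j <;> simp [P, Q, Matrix.mul_apply, Fin.sum_univ_four]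
  have hQP : Q * P = 1 := mul_eq_one_comm.1 hPQ
  have hspecial : X 3 * specialQuadric K = linSubst P (X 3 * (X 3 * X 0 + X 1 ^ 2)) := by
    simp only [map_mul, map_add, map_pow, linSubst_X, Fin.sum_univ_four, specialQuadric]
    simp [P, add_comm]
  have hback : linSubst Q (X 3 * specialQuadric K) = X 3 * (X 3 * X 0 + X 1 ^ 2) := by
    rw [hspecial, linSubst_linSubst hPQ]
  obtain ⟨A, B, hAB, hA⟩ := exists_isAdaptedCubic_linSubst hf hsm
  have hBA : B * A = 1 := mul_eq_one_comm.1 hAB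
  obtain ⟨v, hv, hv'⟩ := hA.exists_koszulRigid ha (z := fun j => P.mulVec (z j)) (by
      rw [← hback]
      refine KoszulRigid.of_linSubst hQP ?_
      simpa [Matrix.mulVec_mulVec, hQP] using hz) (fun j => by
      rw [← eval_linSubst, ← hspecial]
      exact (hz' j).1) (fun j => by
      refine (hz' j).2.imp (fun h => ?_) fun h => ?_
      · simpa [P, Matrix.mulVec, dotProduct, Fin.sum_univ_four] using h
      · simpa [P, Matrix.mulVec, dotProduct, Fin.sum_univ_four] using h)
  refine ⟨fun j => A.mulVec (v j), ?_, fun j => ⟨?_, fun h => (hv' j).2 ?_⟩⟩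
  · rw [← linSubst_linSubst hAB f]
    refine KoszulRigid.of_linSubst hBA ?_
    simpa [Matrix.mulVec_mulVec, hBA] using hv
  · rw [← eval_linSubst]
    exact (hv' j).1
  · have h : A.mulVec (v j) = 0 := h
    rw [← Matrix.one_mulVec (v j), ← hBA, ← Matrix.mulVec_mulVec, h, Matrix.mulVec_zero]

end AdaptedCoordinates

section Koszul
variable {M N L : Type*} [AddCommGroup M] [AddCommGroup N] [AddCommGroup L]

/-- The differential of the mapping cone of `x`. -/
def coneD (d x : M →+ M) : M × M →+ M × M :=
  AddMonoidHom.prod (d.comp (AddMonoidHom.fst M M) + x.comp (AddMonoidHom.snd M M))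
    (-(d.comp (AddMonoidHom.snd M M)))

theorem coneD_apply (d x : M →+ M) (c : M × M) : coneD d x c = (d c.1 + x c.2, -d c.2) := rfl

/-- The bigraded pieces of the mapping cone of an operator of internal degree one. -/
def coneP (P : ℤ → ℤ → AddSubgroup M) (p T : ℤ) : AddSubgroup (M × M) :=
  (P p T).prod (P (p - 1) (T - 1))

theorem mem_coneP {P : ℤ → ℤ → AddSubgroup M} {p T : ℤ} {c : M × M} :
    c ∈ coneP P p T ↔ c.1 ∈ P p T ∧ c.2 ∈ P (p - 1) (T - 1) := Iff.rfl

/-- The operator induced on a mapping cone. -/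
def coneMap (y : M →+ N) : M × M →+ N × N := y.prodMap y

theorem coneMap_apply (y : M →+ N) (c : M × M) : coneMap y c = (y c.1, y c.2) := rfl

/-- Exactness of a bigraded differential group at a given spot. -/
def ExactAt (d : M →+ M) (P : ℤ → ℤ → AddSubgroup M) (p T : ℤ) : Prop :=
  ∀ c ∈ P p T, d c = 0 → ∃ b ∈ P (p + 1) T, d b = c

/-- `d` is a differential of homological degree `-1` for the bigrading `P`. -/
structure IsDifferential (d : M →+ M) (P : ℤ → ℤ → AddSubgroup M) : Prop where
  sq : ∀ c, d (d c) = 0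
  mem : ∀ {p T c}, c ∈ P p T → d c ∈ P (p - 1) T

/-- The operator `y` shifts the internal degree by `e`. -/
def ShiftsBy (y : M →+ N) (P : ℤ → ℤ → AddSubgroup M) (Q : ℤ → ℤ → AddSubgroup N) (e : ℤ) : Prop :=
  ∀ ⦃p T c⦄, c ∈ P p T → y c ∈ Q p (T + e)

theorem ShiftsBy.cone {y : M →+ N} {P : ℤ → ℤ → AddSubgroup M} {Q : ℤ → ℤ → AddSubgroup N} {e : ℤ}
    (h : ShiftsBy y P Q e) : ShiftsBy (coneMap y) (coneP P) (coneP Q) e := fun p T c hc =>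
  ⟨h hc.1, by have := h hc.2; rwa [sub_add_eq_add_sub] at this⟩

theorem IsDifferential.cone {d x : M →+ M} {P : ℤ → ℤ → AddSubgroup M} (h : IsDifferential d P)
    (hdx : ∀ c, d (x c) = x (d c)) (hx : ShiftsBy x P P 1) :
    IsDifferential (coneD d x) (coneP P) where
  sq c := by simp [coneD_apply, h.sq, hdx]
  mem {p T c} hc := by
    have h₂ := hx hc.2
    rw [sub_add_cancel] at h₂
    exact mem_coneP.2 ⟨add_mem (h.mem hc.1) h₂, (P _ _).neg_mem (h.mem hc.2)⟩

theorem coneMap_comm {y z : M →+ M} (h : ∀ c, y (z c) = z (y c)) (c : M × M) :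
    coneMap y (coneMap z c) = coneMap z (coneMap y c) := by
  simp [coneMap_apply, h]

theorem coneMap_coneD {y : M →+ N} {d x : M →+ M} {d' x' : N →+ N} (hd : ∀ c, y (d c) = d' (y c))
    (hx : ∀ c, y (x c) = x' (y c)) (c : M × M) :
    coneMap y (coneD d x c) = coneD d' x' (coneMap y c) := by
  simp [coneMap_apply, coneD_apply, hd, hx]

theorem mem_coneP_iff_of_forall {P Q : ℤ → ℤ → AddSubgroup M} {y : M →+ N}
    (h : ∀ p T c, c ∈ P p T ↔ c ∈ Q p T ∧ y c = 0) (p T : ℤ) (c : M × M) :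
    c ∈ coneP P p T ↔ c ∈ coneP Q p T ∧ coneMap y c = 0 := by
  simp only [mem_coneP, h, coneMap_apply, Prod.mk_eq_zero]
  tauto

theorem surjOn_coneP {P : ℤ → ℤ → AddSubgroup M} {Q : ℤ → ℤ → AddSubgroup N} {y : M →+ N} {s : ℤ}
    (h : ∀ p T, T - p = s → ∀ c ∈ Q p T, ∃ b ∈ P p T, y b = c) (p T : ℤ) (hs : T - p = s)
    (c : N × N) (hc : c ∈ coneP Q p T) : ∃ b ∈ coneP P p T, coneMap y b = c := by
  obtain ⟨b₁, hb₁, h₁⟩ := h p T hs c.1 hc.1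
  obtain ⟨b₂, hb₂, h₂⟩ := h (p - 1) (T - 1) (by linarith) c.2 hc.2
  exact ⟨(b₁, b₂), ⟨hb₁, hb₂⟩, Prod.ext h₁ h₂⟩

theorem eq_zero_of_mem_coneP {P : ℤ → ℤ → AddSubgroup M} {m : ℤ}
    (h : ∀ p T, m < p → ∀ c ∈ P p T, c = 0) (p T : ℤ) (hp : m + 1 < p) (c : M × M)
    (hc : c ∈ coneP P p T) : c = 0 :=
  Prod.ext (h p T (by linarith) _ hc.1) (h (p - 1) (T - 1) (by linarith) _ hc.2)

/-- Exactness of the kernel of a surjective map of bigraded complexes. -/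
theorem ExactAt.ker {d : M →+ M} {d' : N →+ N} {P Q : ℤ → ℤ → AddSubgroup M}
    {Q' : ℤ → ℤ → AddSubgroup N} {y : M →+ N} (hd : IsDifferential d Q)
    (hyd : ∀ c, y (d c) = d' (y c)) (hy : ∀ p T c, c ∈ Q p T → y c ∈ Q' p T)
    (hP : ∀ p T c, c ∈ P p T ↔ c ∈ Q p T ∧ y c = 0) {p T : ℤ} (hQ : ExactAt d Q p T)
    (hQ' : ExactAt d' Q' (p + 1) T)
    (hsurj : ∀ c ∈ Q' (p + 1 + 1) T, ∃ b ∈ Q (p + 1 + 1) T, y b = c) : ExactAt d P p T := by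
  intro c hc hdc
  rw [hP] at hc
  obtain ⟨b, hb, hdb⟩ := hQ c hc.1 hdc
  obtain ⟨e, he, hde⟩ := hQ' (y b) (hy _ _ _ hb) (by rw [← hyd, hdb, hc.2])
  obtain ⟨e', he', hye⟩ := hsurj e he
  refine ⟨b - d e', (hP _ _ _).2 ⟨sub_mem hb ?_, ?_⟩, ?_⟩
  · have := hd.mem he'
    rwa [add_sub_cancel_right] at this
  · rw [map_sub, hyd, hye, hde, sub_self]
  · rw [map_sub, hd.sq, hdb, sub_zero]

/-- Exactness of the mapping cone of an operator with a left inverse `q`. -/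
theorem ExactAt.cone_of_leftInverse {d x q : M →+ M} {P P₀ : ℤ → ℤ → AddSubgroup M}
    (hqx : ∀ c, q (x c) = c) (hdx : ∀ c, d (x c) = x (d c)) (hdq : ∀ c, d (q c) = q (d c))
    (hx : ShiftsBy x P P 1) (hq : ShiftsBy q P P (-1))
    (hP : ∀ p T c, c ∈ P₀ p T ↔ c ∈ P p T ∧ x (q c) = 0) {p T : ℤ} (h : ExactAt d P₀ p T) :
    ExactAt (coneD d x) (coneP P) p T := by
  rintro ⟨c', c''⟩ ⟨hc', hc''⟩ hdc
  simp only [coneD_apply, Prod.mk_eq_zero, neg_eq_zero] at hdc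
  have hdc' : d c' = -x c'' := eq_neg_of_add_eq_zero_left hdc.1
  have hqc : q c' ∈ P p (T - 1) := hq hc'
  obtain ⟨b, hb, hdb⟩ := h (c' - x (q c')) ((hP _ _ _).2 ⟨sub_mem hc' (by
    have := hx hqc; rwa [sub_add_cancel] at this), by simp [hqx]⟩) (by
    rw [map_sub, hdx, hdq, hdc']; simp [hqx])
  refine ⟨(b, q c'), ⟨((hP _ _ _).1 hb).1, by rwa [add_sub_cancel_right]⟩, ?_⟩
  simp only [coneD_apply, hdb, hdq, hdc', map_neg, hqx, sub_add_cancel, neg_neg]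

/-- The homotopy on a mapping cone induced by an operator `a` and a homotopy `s`. -/
def coneS (s a : M →+ M) : M × M →+ M × M :=
  AddMonoidHom.prod (s.comp (AddMonoidHom.fst M M))
    (a.comp (AddMonoidHom.fst M M) - s.comp (AddMonoidHom.snd M M))

theorem coneS_apply (s a : M →+ M) (c : M × M) : coneS s a c = (s c.1, a c.1 - s c.2) := rfl

theorem coneMap_coneS {y s a : M →+ M} (hs : ∀ c, y (s c) = s (y c)) (ha : ∀ c, y (a c) = a (y c))
    (c : M × M) : coneMap y (coneS s a c) = coneS s a (coneMap y c) := by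
  simp [coneMap_apply, coneS_apply, hs, ha]

theorem coneS_mem {s a : M →+ M} {P : ℤ → ℤ → AddSubgroup M}
    (hs : ∀ p T c, c ∈ P p T → s c ∈ P (p + 1) T) (ha : ShiftsBy a P P (-1)) (p T : ℤ) (c : M × M)
    (hc : c ∈ coneP P p T) : coneS s a c ∈ coneP P (p + 1) T := by
  have h₁ : a c.1 ∈ P (p + 1 - 1) (T - 1) := by rw [add_sub_cancel_right]; exact ha hc.1
  have h₂ : s c.2 ∈ P (p + 1 - 1) (T - 1) := by
    have := hs _ _ _ hc.2
    rwa [sub_add_cancel, ← add_sub_cancel_right p 1] at this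
  exact mem_coneP.2 ⟨hs _ _ _ hc.1, sub_mem h₁ h₂⟩

theorem coneD_coneS_add {d x s a h : M →+ M} (hsx : ∀ c, s (x c) = x (s c))
    (hda : ∀ c, d (a c) = a (d c)) (hh : ∀ c, d (s c) + s (d c) = h c) (hxa : ∀ c, x (a c) = a (x c))
    (c : M × M) :
    coneD d x (coneS s a c) + coneS s a (coneD d x c) = coneMap (h + a.comp x) c := by
  simp only [coneD_apply, coneS_apply, coneMap_apply, map_add, map_sub, map_neg, ← hh, hsx, hda,
    AddMonoidHom.add_apply, AddMonoidHom.comp_apply, hxa, Prod.mk_add_mk, Prod.mk.injEq]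
  constructor <;> abel

end Koszul

section Koszul4
variable {M M' : Type*} [AddCommGroup M] [AddCommGroup M']

/-- A graded group placed in homological degree zero. -/
def baseP (N : ℤ → AddSubgroup M) (p T : ℤ) : AddSubgroup M := if p = 0 then N T else ⊥

/-- Four commuting operators of degree one on a graded group. -/
structure GradedOps (x : Fin 4 → M →+ M) (N : ℤ → AddSubgroup M) : Prop where
  comm : ∀ i j c, x i (x j c) = x j (x i c)
  mem : ∀ {i T c}, c ∈ N T → x i c ∈ N (T + 1)

/-- The Koszul differential of four commuting operators. -/
def kosD (x : Fin 4 → M →+ M) :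
    (((M × M) × (M × M)) × ((M × M) × (M × M))) × (((M × M) × (M × M)) × ((M × M) × (M × M))) →+
    (((M × M) × (M × M)) × ((M × M) × (M × M))) × (((M × M) × (M × M)) × ((M × M) × (M × M))) :=
  coneD (coneD (coneD (coneD 0 (x 0)) (coneMap (x 1))) (coneMap (coneMap (x 2))))
    (coneMap (coneMap (coneMap (x 3))))

/-- The bigraded pieces of the Koszul complex of four operators. -/
def kosP (N : ℤ → AddSubgroup M) := coneP (coneP (coneP (coneP (baseP N))))

/-- Exactness of the Koszul complex in homological degree `p` and total degree `T`. -/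
def KosExact (x : Fin 4 → M →+ M) (N : ℤ → AddSubgroup M) (p T : ℤ) : Prop :=
  ExactAt (kosD x) (kosP N) p T

theorem mem_baseP {N : ℤ → AddSubgroup M} {p T : ℤ} {c : M} :
    c ∈ baseP N p T ↔ (p = 0 ∧ c ∈ N T) ∨ c = 0 := by
  unfold baseP
  split_ifs with h
  · simp only [h, true_and, iff_self_or]
    rintro rfl; exact zero_mem _
  · simp [h]

theorem isDifferential_baseP (N : ℤ → AddSubgroup M) : IsDifferential 0 (baseP N) where
  sq _ := rfl
  mem _ := zero_mem _

theorem shiftsBy_baseP {y : M →+ M'} {N : ℤ → AddSubgroup M} {N' : ℤ → AddSubgroup M'} {e : ℤ}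
    (h : ∀ T c, c ∈ N T → y c ∈ N' (T + e)) : ShiftsBy y (baseP N) (baseP N') e := by
  intro p T c hc
  rw [mem_baseP] at hc ⊢
  rcases hc with ⟨hp, hc⟩ | rfl
  · exact .inl ⟨hp, h _ _ hc⟩
  · exact .inr (map_zero y)

section
variable {x : Fin 4 → M →+ M} {N : ℤ → AddSubgroup M}

theorem GradedOps.isDifferential (h : GradedOps x N) : IsDifferential (kosD x) (kosP N) := by
  have hb (i) : ShiftsBy (x i) (baseP N) (baseP N) 1 := shiftsBy_baseP fun _ _ => h.mem
  have h1 := (isDifferential_baseP N).cone (x := x 0) (fun c => (map_zero _).symm) (hb 0)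
  have h2 := h1.cone (x := coneMap (x 1))
    (fun c => (coneMap_coneD (fun _ => map_zero _) (h.comm 1 0) c).symm) (hb 1).cone
  have h3 := h2.cone (x := coneMap (coneMap (x 2)))
    (fun c => (coneMap_coneD (coneMap_coneD (fun _ => map_zero _) (h.comm 2 0))
      (coneMap_comm (h.comm 2 1)) c).symm) (hb 2).cone.cone
  exact h3.cone (x := coneMap (coneMap (coneMap (x 3))))
    (fun c => (coneMap_coneD (coneMap_coneD (coneMap_coneD (fun _ => map_zero _) (h.comm 3 0))
      (coneMap_comm (h.comm 3 1))) (coneMap_comm (coneMap_comm (h.comm 3 2))) c).symm)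
    (hb 3).cone.cone.cone

theorem KosExact.exists_sum {T : ℤ} (h : KosExact x N 0 T) {c : M} (hc : c ∈ N T) :
    ∃ b : Fin 4 → M, (∀ i, b i ∈ N (T - 1)) ∧ c = ∑ i, x i (b i) := by
  obtain ⟨b, hb, hdb⟩ := h ((((c, 0), 0), 0), 0)
    ⟨⟨⟨⟨mem_baseP.2 (.inl ⟨rfl, hc⟩), zero_mem _⟩, zero_mem _⟩, zero_mem _⟩, zero_mem _⟩
    (by simp [kosD, coneD_apply, coneMap_apply])
  obtain ⟨⟨⟨⟨-, h0⟩, h1, -⟩, ⟨h2, -⟩, -⟩, ⟨⟨h3, -⟩, -⟩, -⟩ := hb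
  refine ⟨![b.1.1.1.2, b.1.1.2.1, b.1.2.1.1, b.2.1.1.1], ?_, ?_⟩
  · have key : ∀ {b : M}, b ∈ baseP N (0 + 1 - 1) (T - 1) → b ∈ N (T - 1) := by
      intro b hb
      simpa [baseP] using hb
    intro i
    fin_cases i
    · exact key h0
    · exact key h1
    · exact key h2
    · exact key h3
  · have := congrArg (fun b => b.1.1.1.1) hdb
    simp only [kosD, coneD_apply, coneMap_apply, Prod.fst_add, AddMonoidHom.zero_apply,
      zero_add] at this
    simp [Fin.sum_univ_four, ← this]

end

theorem GradedOps.kosExact_ker {x : Fin 4 → M →+ M} {x' : Fin 4 → M' →+ M'}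
    {N G : ℤ → AddSubgroup M} {G' : ℤ → AddSubgroup M'} (φ : M →+ M') (hG : GradedOps x G)
    (hφ : ∀ i c, φ (x i c) = x' i (φ c)) (hGG : ∀ T c, c ∈ G T → φ c ∈ G' T)
    (hN : ∀ T c, c ∈ N T ↔ c ∈ G T ∧ φ c = 0) {p T : ℤ} (h : KosExact x G p T)
    (h' : KosExact x' G' (p + 1) T)
    (hs : 3 ≤ p ∨ ∀ c ∈ G' (T - p - 2), ∃ b ∈ G (T - p - 2), φ b = c) :
    KosExact x N p T := by
  have hφd := coneMap_coneD (coneMap_coneD (coneMap_coneD (coneMap_coneD (y := φ) (d := 0) (d' := 0)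
    (fun _ => map_zero _) (hφ 0)) (fun c => Prod.ext (hφ 1 c.1) (hφ 1 c.2) :
      ∀ c, coneMap φ (coneMap (x 1) c) = coneMap (x' 1) (coneMap φ c)))
    (fun c => Prod.ext (Prod.ext (hφ 2 c.1.1) (hφ 2 c.1.2)) (Prod.ext (hφ 2 c.2.1) (hφ 2 c.2.2)) :
      ∀ c, coneMap (coneMap φ) (coneMap (coneMap (x 2)) c) =
        coneMap (coneMap (x' 2)) (coneMap (coneMap φ) c)))
    (fun c => by simp [coneMap_apply, hφ] :
      ∀ c, coneMap (coneMap (coneMap φ)) (coneMap (coneMap (coneMap (x 3))) c) =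
        coneMap (coneMap (coneMap (x' 3))) (coneMap (coneMap (coneMap φ)) c))
  have hmem : ShiftsBy φ (baseP G) (baseP G') 0 :=
    shiftsBy_baseP fun T c hc => by rw [add_zero]; exact hGG T c hc
  have hP0 : ∀ p T c, c ∈ baseP N p T ↔ c ∈ baseP G p T ∧ φ c = 0 := by
    intro p T c
    simp only [mem_baseP, hN]
    constructor
    · rintro (h | rfl)
      · tauto
      · simp
    · tauto
  refine ExactAt.ker hG.isDifferential hφd
    (fun p T c hc => by have := hmem.cone.cone.cone.cone hc; rwa [add_zero] at this)
    (mem_coneP_iff_of_forall (mem_coneP_iff_of_forall (mem_coneP_iff_of_forall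
      (mem_coneP_iff_of_forall hP0)))) h h' ?_
  rcases hs with hp | hs
  · intro c hc
    have h0 : ∀ p T, 0 < p → ∀ c ∈ baseP G' p T, c = 0 := by
      intro p T hp c hc
      rcases mem_baseP.1 hc with h | h
      · omega
      · exact h
    rw [eq_zero_of_mem_coneP (eq_zero_of_mem_coneP (eq_zero_of_mem_coneP (eq_zero_of_mem_coneP h0)))
      _ _ (by linarith) c hc]
    exact ⟨0, zero_mem _, map_zero _⟩
  · refine surjOn_coneP (s := T - p - 2) (surjOn_coneP (surjOn_coneP (surjOn_coneP ?_))) _ _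
      (by ring)
    intro q S hS c hc
    rcases mem_baseP.1 hc with ⟨rfl, hc⟩ | rfl
    · obtain rfl : S = T - p - 2 := by linarith
      obtain ⟨b, hb, rfl⟩ := hs c hc
      exact ⟨b, mem_baseP.2 (.inl ⟨rfl, hb⟩), rfl⟩
    · exact ⟨0, zero_mem _, map_zero _⟩

/-- The Koszul complex of four operators with commuting left inverses. -/
theorem GradedOps.kosExact_of_leftInverse {x q : Fin 4 → M →+ M} {N : ℤ → AddSubgroup M}
    (h : GradedOps x N) (hqx : ∀ i c, q i (x i c) = c) (hq : ∀ i T c, c ∈ N T → q i c ∈ N (T - 1))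
    (hxq : ∀ i j c, i ≠ j → x i (q j c) = q j (x i c)) (hqq : ∀ i j c, q i (q j c) = q j (q i c))
    {p T : ℤ} (h0 : p = 0 → ∀ c ∈ N T, (∀ i, x i (q i c) = 0) → c = 0) : KosExact x N p T := by
  let e : Fin 4 → M →+ M := fun i => (x i).comp (q i)
  let N3 : ℤ → AddSubgroup M := fun T => N T ⊓ (e 3).ker
  let N2 : ℤ → AddSubgroup M := fun T => N3 T ⊓ (e 2).ker
  let N1 : ℤ → AddSubgroup M := fun T => N2 T ⊓ (e 1).ker
  let N0 : ℤ → AddSubgroup M := fun T => N1 T ⊓ (e 0).ker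
  have hP {A : ℤ → AddSubgroup M} (i : Fin 4) (p T c) :
      c ∈ baseP (fun T => A T ⊓ (e i).ker) p T ↔ c ∈ baseP A p T ∧ x i (q i c) = 0 := by
    simp only [mem_baseP, AddSubgroup.mem_inf, AddMonoidHom.mem_ker]
    constructor
    · rintro (h | rfl)
      · exact ⟨.inl ⟨h.1, h.2.1⟩, h.2.2⟩
      · simp
    · rintro ⟨h | h, h'⟩
      · exact .inl ⟨h.1, h.2, h'⟩
      · exact .inr h
  have hex {i j : Fin 4} (hij : j ≠ i) (c : M) : e i (x j c) = x j (e i c) := by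
    simp only [e, AddMonoidHom.comp_apply]
    rw [← hxq j i c hij, h.comm]
  have heq {i j : Fin 4} (hij : j ≠ i) (c : M) : e i (q j c) = q j (e i c) := by
    simp only [e, AddMonoidHom.comp_apply]
    rw [hqq, hxq i j _ hij.symm]
  have step {A : ℤ → AddSubgroup M} {j : Fin 4} (i : Fin 4) (hij : j ≠ i)
      (hA : ∀ T c, c ∈ A T → x j c ∈ A (T + 1) ∧ q j c ∈ A (T - 1)) (T c) 
      (hc : c ∈ A T ⊓ (e i).ker) : x j c ∈ A (T + 1) ⊓ (e i).ker ∧ q j c ∈ A (T - 1) ⊓ (e i).ker := by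
    have hk : e i c = 0 := hc.2
    refine ⟨⟨(hA T c hc.1).1, ?_⟩, ⟨(hA T c hc.1).2, ?_⟩⟩
    · exact (hex hij c).trans (by rw [hk, map_zero])
    · exact (heq hij c).trans (by rw [hk, map_zero])
  have m4 (j : Fin 4) (T c) (hc : c ∈ N T) : x j c ∈ N (T + 1) ∧ q j c ∈ N (T - 1) :=
    ⟨h.mem hc, hq j T c hc⟩
  have m3 (j : Fin 4) (hj : j ≠ 3) := step (A := N) 3 hj (m4 j)
  have m2 (j : Fin 4) (hj : j ≠ 3) (hj' : j ≠ 2) := step (A := N3) 2 hj' (m3 j hj)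
  have m1 (j : Fin 4) (hj : j ≠ 3) (hj' : j ≠ 2) (hj'' : j ≠ 1) :=
    step (A := N2) 1 hj'' (m2 j hj hj')
  have c0 (i j : Fin 4) (hij : i ≠ j) (c) : coneMap (x i) (coneMap (q j) c) =
    coneMap (q j) (coneMap (x i) c) := Prod.ext (hxq i j _ hij) (hxq i j _ hij)
  have e0 : ExactAt 0 (baseP N0) p T := by
    intro c hc _
    refine ⟨0, zero_mem _, ?_⟩
    rcases mem_baseP.1 hc with ⟨hp, ⟨⟨⟨hc, h3⟩, h2⟩, h1⟩, h4⟩ | h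
    · refine (h0 hp c hc fun i => ?_).symm
      fin_cases i
      · exact h4
      · exact h1
      · exact h2
      · exact h3
    · exact h.symm
  have e1 : ExactAt (coneD 0 (x 0)) (coneP (baseP N1)) p T :=
    ExactAt.cone_of_leftInverse (hqx 0) (fun _ => (map_zero _).symm) (fun _ => (map_zero _).symm)
      (shiftsBy_baseP fun T c hc => (m1 0 (by decide) (by decide) (by decide) T c hc).1)
      (shiftsBy_baseP fun T c hc => (m1 0 (by decide) (by decide) (by decide) T c hc).2) (hP 0) e0
  have e2 : ExactAt (coneD (coneD 0 (x 0)) (coneMap (x 1))) (coneP (coneP (baseP N2))) p T :=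
    ExactAt.cone_of_leftInverse (q := coneMap (q 1))
      (fun c => by simp [coneMap_apply, hqx])
      (fun c => (coneMap_coneD (fun _ => map_zero _) (h.comm 1 0) c).symm)
      (fun c => (coneMap_coneD (fun _ => map_zero _)
        (fun c => (hxq 0 1 c (by decide)).symm) c).symm)
      (shiftsBy_baseP fun T c hc => (m2 1 (by decide) (by decide) T c hc).1).cone
      (shiftsBy_baseP fun T c hc => (m2 1 (by decide) (by decide) T c hc).2).cone
      (mem_coneP_iff_of_forall (y := e 1) (hP 1)) e1
  have e3 : ExactAt (coneD (coneD (coneD 0 (x 0)) (coneMap (x 1))) (coneMap (coneMap (x 2))))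
      (coneP (coneP (coneP (baseP N3)))) p T :=
    ExactAt.cone_of_leftInverse (q := coneMap (coneMap (q 2)))
      (fun c => by simp [coneMap_apply, hqx])
      (fun c => (coneMap_coneD (coneMap_coneD (fun _ => map_zero _) (h.comm 2 0))
        (coneMap_comm (h.comm 2 1)) c).symm)
      (fun c => (coneMap_coneD (coneMap_coneD (fun _ => map_zero _)
        (fun c => (hxq 0 2 c (by decide)).symm))
        (fun c => (c0 1 2 (by decide) c).symm) c).symm)
      (shiftsBy_baseP fun T c hc => (m3 2 (by decide) T c hc).1).cone.cone
      (shiftsBy_baseP fun T c hc => (m3 2 (by decide) T c hc).2).cone.cone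
      (mem_coneP_iff_of_forall (y := coneMap (e 2)) (mem_coneP_iff_of_forall (y := e 2) (hP 2))) e2
  exact ExactAt.cone_of_leftInverse (q := coneMap (coneMap (coneMap (q 3))))
      (fun c => by simp [coneMap_apply, hqx])
      (fun c => (coneMap_coneD (coneMap_coneD (coneMap_coneD (fun _ => map_zero _) (h.comm 3 0))
        (coneMap_comm (h.comm 3 1))) (coneMap_comm (coneMap_comm (h.comm 3 2))) c).symm)
      (fun c => (coneMap_coneD (coneMap_coneD (coneMap_coneD (fun _ => map_zero _)
        (fun c => (hxq 0 3 c (by decide)).symm))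
        (fun c => (c0 1 3 (by decide) c).symm)) (coneMap_comm (fun c => (c0 2 3 (by decide) c).symm)) c).symm)
      (shiftsBy_baseP fun T c hc => (m4 3 T c hc).1).cone.cone.cone
      (shiftsBy_baseP fun T c hc => (m4 3 T c hc).2).cone.cone.cone
      (mem_coneP_iff_of_forall (y := coneMap (coneMap (e 3)))
        (mem_coneP_iff_of_forall (y := coneMap (e 3))
          (mem_coneP_iff_of_forall (y := e 3) (hP 3)))) e3

/-- The Koszul complex of four operators generating the unit ideal. -/
theorem GradedOps.kosExact_of_sum_eq {x a : Fin 4 → M →+ M} {N : ℤ → AddSubgroup M}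
    (ha : ∀ i T c, c ∈ N T → a i c ∈ N (T - 1))
    (hxa : ∀ i j c, x i (a j c) = a j (x i c)) (hs : ∀ c, ∑ i, a i (x i c) = c) (p T : ℤ) :
    KosExact x N p T := by
  have hb (i) : ShiftsBy (a i) (baseP N) (baseP N) (-1) := shiftsBy_baseP (ha i)
  have hax (i j c) : a i (x j c) = x j (a i c) := (hxa j i c).symm
  have m1 := coneS_mem (s := 0) (fun p T c _ => zero_mem (baseP N (p + 1) T)) (hb 0)
  have m2 := coneS_mem m1 (hb 1).cone
  have m3 := coneS_mem m2 (hb 2).cone.cone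
  have m4 := coneS_mem m3 (hb 3).cone.cone.cone
  have k1 (i c) := coneMap_coneS (y := x i) (s := 0) (fun _ => map_zero _) (hxa i 0) c
  have k2 (i c) := coneMap_coneS (k1 i) (coneMap_comm (hxa i 1)) c
  have k3 (i c) := coneMap_coneS (k2 i) (coneMap_comm (coneMap_comm (hxa i 2))) c
  have d1 (i c) := coneMap_coneD (y := a i) (d := 0) (d' := 0) (fun _ => map_zero _) (hax i 0) c
  have d2 (i c) := coneMap_coneD (d1 i) (coneMap_comm (hax i 1)) c
  have d3 (i c) := coneMap_coneD (d2 i) (coneMap_comm (coneMap_comm (hax i 2))) c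
  have h1 := coneD_coneS_add (d := 0) (s := 0) (x := x 0) (a := a 0) (h := 0)
    (fun _ => (map_zero _).symm) (fun _ => (map_zero _).symm) (fun _ => add_zero _) (hxa 0 0)
  have h2 := coneD_coneS_add (fun c => (k1 1 c).symm) (fun c => (d1 1 c).symm) h1
    (coneMap_comm (hxa 1 1))
  have h3 := coneD_coneS_add (fun c => (k2 2 c).symm) (fun c => (d2 2 c).symm) h2
    (coneMap_comm (coneMap_comm (hxa 2 2)))
  have h4 := coneD_coneS_add (fun c => (k3 3 c).symm) (fun c => (d3 3 c).symm) h3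
    (coneMap_comm (coneMap_comm (coneMap_comm (hxa 3 3))))
  intro c hc hdc
  refine ⟨_, m4 _ _ c hc, ?_⟩
  have := h4 c
  change kosD x _ + coneS _ _ (kosD x c) = _ at this
  rw [hdc, map_zero, add_zero] at this
  refine this.trans ?_
  simp only [Fin.sum_univ_four] at hs
  simp [coneMap_apply, hs]

end Koszul4

section HomPiece
variable {K : Type*} [Field K]

variable (K) in
/-- The forms of degree `T`, where `T` is an integer. -/
def homPiece (T : ℤ) : Submodule K (MvPolynomial (Fin 4) K) where
  carrier := {p | ∀ m, coeff m p ≠ 0 → (m.degree : ℤ) = T}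
  zero_mem' := by simp
  add_mem' {p q} hp hq m hm := by
    by_cases h : coeff m p = 0
    · exact hq m fun h' => hm (by rw [coeff_add, h, h', add_zero])
    · exact hp m h
  smul_mem' c p hp m hm := hp m fun h => hm (by rw [coeff_smul, h, smul_zero])

theorem mem_homPiece {T : ℤ} {p : MvPolynomial (Fin 4) K} :
    p ∈ homPiece K T ↔ ∀ m, coeff m p ≠ 0 → (m.degree : ℤ) = T := Iff.rfl

theorem mem_homPiece_natCast {n : ℕ} {p : MvPolynomial (Fin 4) K} :
    p ∈ homPiece K n ↔ p.IsHomogeneous n := by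
  simp only [mem_homPiece, Nat.cast_inj, IsHomogeneous, IsWeightedHomogeneous,
    Finsupp.degree_eq_weight_one]
  rfl

theorem homPiece_natCast (n : ℕ) : homPiece K n = homogeneousSubmodule (Fin 4) K n :=
  Submodule.ext fun _ => mem_homPiece_natCast

theorem homPiece_of_neg {T : ℤ} (hT : T < 0) : homPiece K T = ⊥ := by
  refine (Submodule.eq_bot_iff _).2 fun p hp => MvPolynomial.ext _ _ fun m => ?_
  by_contra h
  have := hp m h
  lia

theorem mul_mem_homPiece {S T : ℤ} {p q : MvPolynomial (Fin 4) K} (hp : p ∈ homPiece K S)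
    (hq : q ∈ homPiece K T) : p * q ∈ homPiece K (S + T) := by
  rcases lt_or_ge S 0 with hS | hS
  · rw [homPiece_of_neg hS, Submodule.mem_bot] at hp
    rw [hp, zero_mul]; exact zero_mem _
  rcases lt_or_ge T 0 with hT | hT
  · rw [homPiece_of_neg hT, Submodule.mem_bot] at hq
    rw [hq, mul_zero]; exact zero_mem _
  lift S to ℕ using hS
  lift T to ℕ using hT
  rw [← Nat.cast_add]
  exact mem_homPiece_natCast.2 ((mem_homPiece_natCast.1 hp).mul (mem_homPiece_natCast.1 hq))

theorem X_mem_homPiece (i : Fin 4) : (X i : MvPolynomial (Fin 4) K) ∈ homPiece K 1 :=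
  mem_homPiece_natCast.2 (isHomogeneous_X K i)

theorem X_mul_mem_homPiece {T : ℤ} {p : MvPolynomial (Fin 4) K} (hp : p ∈ homPiece K T)
    (i : Fin 4) : X i * p ∈ homPiece K (T + 1) := by
  rw [add_comm]; exact mul_mem_homPiece (X_mem_homPiece i) hp

instance finite_homPiece (T : ℤ) : Module.Finite K (homPiece K T) := by
  rcases lt_or_ge T 0 with hT | hT
  · rw [homPiece_of_neg hT]; infer_instance
  · lift T to ℕ using hT
    rw [homPiece_natCast]; infer_instance

theorem finrank_homPiece_natCast (n : ℕ) :
    Module.finrank K (homPiece K (n : ℤ)) = (n + 3).choose 3 := by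
  rw [homPiece_natCast, finrank_homogeneousSubmodule]

/-- Division by a variable, dropping the monomials not divisible by it. -/
noncomputable def divX (i : Fin 4) : MvPolynomial (Fin 4) K →+ MvPolynomial (Fin 4) K :=
  AddMonoidHom.mk' (fun p => p.divMonomial (Finsupp.single i 1)) fun p q => add_divMonomial p q _

theorem coeff_divX (i : Fin 4) (p : MvPolynomial (Fin 4) K) (m : Fin 4 →₀ ℕ) :
    coeff m (divX i p) = coeff (Finsupp.single i 1 + m) p := coeff_divMonomial _ _ _

theorem divX_X_mul (i : Fin 4) (p : MvPolynomial (Fin 4) K) : divX i (X i * p) = p :=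
  X_mul_divMonomial i p

theorem divX_mem_homPiece {T : ℤ} {p : MvPolynomial (Fin 4) K} (hp : p ∈ homPiece K T)
    (i : Fin 4) : divX i p ∈ homPiece K (T - 1) := by
  intro m hm
  rw [coeff_divX] at hm
  have := hp _ hm
  rw [map_add, Finsupp.degree_single] at this
  push_cast at this
  linarith

theorem divX_comm (i j : Fin 4) (p : MvPolynomial (Fin 4) K) :
    divX i (divX j p) = divX j (divX i p) := by
  ext m
  simp only [coeff_divX]
  rw [add_left_comm]

theorem X_mul_divX {i j : Fin 4} (hij : i ≠ j) (p : MvPolynomial (Fin 4) K) :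
    X i * divX j p = divX j (X i * p) := by
  ext m
  rw [coeff_divX, coeff_X_mul', coeff_X_mul', coeff_divX]
  have : i ∈ (Finsupp.single j 1 + m).support ↔ i ∈ m.support := by
    simp [hij.symm]
  simp only [this]
  split_ifs with h
  · congr 1
    refine Eq.symm (add_tsub_assoc_of_le ?_ _)
    simp only [Finsupp.single_le_iff]
    exact Nat.one_le_iff_ne_zero.2 (Finsupp.mem_support_iff.1 h)
  · rfl

theorem eq_zero_of_X_mul_divX {T : ℤ} (hT : T ≠ 0) {p : MvPolynomial (Fin 4) K}
    (hp : p ∈ homPiece K T) (h : ∀ i, X i * divX i p = 0) : p = 0 := by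
  ext m
  rw [coeff_zero]
  by_contra hm
  have hd := hp m hm
  have h0 : m ≠ 0 := by
    rintro rfl
    exact hT (by rw [← hd]; simp)
  obtain ⟨i, hi⟩ := Finsupp.ne_iff.1 h0
  have := congrArg (coeff m) (h i)
  rw [coeff_X_mul', if_pos (Finsupp.mem_support_iff.2 hi), coeff_divX, coeff_zero,
    add_tsub_cancel_of_le] at this
  · exact hm this
  · simp only [Finsupp.single_le_iff]
    exact Nat.one_le_iff_ne_zero.2 hi

/-- Multiplication by a variable on a module over the polynomial ring. -/
noncomputable def mulX (M : Type*) [AddCommGroup M] [Module (MvPolynomial (Fin 4) K) M] (i : Fin 4) : M →+ M :=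
  DistribSMul.toAddMonoidHom M (X i : MvPolynomial (Fin 4) K)

theorem mulX_apply {M : Type*} [AddCommGroup M] [Module (MvPolynomial (Fin 4) K) M] (i : Fin 4)
    (c : M) : mulX (K := K) M i c = (X i : MvPolynomial (Fin 4) K) • c := rfl

theorem mulX_comm {M : Type*} [AddCommGroup M] [Module (MvPolynomial (Fin 4) K) M] (i j : Fin 4)
    (c : M) : mulX (K := K) M i (mulX (K := K) M j c) = mulX (K := K) M j (mulX (K := K) M i c) := by
  simp only [mulX_apply, smul_smul, mul_comm]

/-- The degree `T` piece of a graded free module with generators of degrees `d`. -/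
noncomputable def freePiece {m : ℕ} (d : Fin m → ℤ) (T : ℤ) : Submodule K (Fin m → MvPolynomial (Fin 4) K) :=
  Submodule.pi Set.univ fun j => homPiece K (T - d j)

theorem mem_freePiece {m : ℕ} {d : Fin m → ℤ} {T : ℤ} {w : Fin m → MvPolynomial (Fin 4) K} :
    w ∈ freePiece d T ↔ ∀ j, w j ∈ homPiece K (T - d j) := by
  simp [freePiece]

theorem gradedOps_homPiece :
    GradedOps (mulX (K := K) (MvPolynomial (Fin 4) K)) fun T => (homPiece K T).toAddSubgroup where
  comm := mulX_comm
  mem hc := X_mul_mem_homPiece hc _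

theorem gradedOps_freePiece {m : ℕ} (d : Fin m → ℤ) :
    GradedOps (mulX (K := K) (Fin m → MvPolynomial (Fin 4) K))
      fun T => (freePiece d T).toAddSubgroup where
  comm := mulX_comm
  mem {i T c} hc := mem_freePiece.2 fun j => by
    rw [add_sub_right_comm]; exact X_mul_mem_homPiece (mem_freePiece.1 hc j) i

theorem kosExact_homPiece {p T : ℤ} (h : p = 0 → T ≠ 0) :
    KosExact (mulX (K := K) (MvPolynomial (Fin 4) K)) (fun T => (homPiece K T).toAddSubgroup) p T :=
  gradedOps_homPiece.kosExact_of_leftInverse (q := divX) divX_X_mul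
    (fun i _ _ hc => divX_mem_homPiece hc i) (fun _ _ _ hij => X_mul_divX hij _)
    divX_comm fun hp _ hc => eq_zero_of_X_mul_divX (h hp) hc

theorem kosExact_freePiece {m : ℕ} {d : Fin m → ℤ} {p T : ℤ} (h : p = 0 → ∀ j, T ≠ d j) :
    KosExact (mulX (K := K) (Fin m → MvPolynomial (Fin 4) K))
      (fun T => (freePiece d T).toAddSubgroup) p T := by
  refine (gradedOps_freePiece d).kosExact_of_leftInverse (q := fun i => (divX i).compLeft (Fin m))
    (fun i c => ?_) (fun i T c hc => ?_) (fun i i' c hij => ?_) (fun i i' c => ?_)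
    (fun hp c hc h0 => ?_)
  · funext j; exact divX_X_mul i (c j)
  · refine mem_freePiece.2 fun j => ?_
    rw [sub_right_comm]; exact divX_mem_homPiece (mem_freePiece.1 hc j) i
  · funext j; exact X_mul_divX hij (c j)
  · funext j; exact divX_comm i i' (c j)
  · funext j
    exact eq_zero_of_X_mul_divX (sub_ne_zero.2 (h hp j)) (mem_freePiece.1 hc j)
      fun i => congrFun (h0 i) j

/-- Propagation of surjectivity from degree `D` to all higher degrees. -/
theorem GradedOps.surj_of_kosExact {M M' : Type*} [AddCommGroup M] [AddCommGroup M']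
    {x : Fin 4 → M →+ M} {x' : Fin 4 → M' →+ M'} {G : ℤ → AddSubgroup M} {N : ℤ → AddSubgroup M'}
    (hG : GradedOps x G) {φ : M →+ M'} (hφ : ∀ i c, φ (x i c) = x' i (φ c)) {D : ℤ}
    (hN : ∀ T, D < T → KosExact x' N 0 T) (hD : ∀ c ∈ N D, ∃ b ∈ G D, φ b = c) {T : ℤ}
    (hT : D ≤ T) : ∀ c ∈ N T, ∃ b ∈ G T, φ b = c := by
  induction T, hT using Int.leInduction with
  | base => exact hD
  | succ T hT ih =>
    intro c hc
    obtain ⟨b, hb, rfl⟩ := (hN (T + 1) (by lia)).exists_sum hc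
    choose e he hφe using fun i => ih (b i) (by simpa using hb i)
    exact ⟨∑ i, x i (e i), sum_mem fun i _ => hG.mem (he i), by simp [hφ, hφe]⟩

theorem kosExact_top {A : Type*} [CommRing A] (y b : Fin 4 → A) (h : ∑ i, b i * y i = 1)
    (p T : ℤ) : KosExact (fun i => AddMonoidHom.mulLeft (y i)) (fun _ => ⊤) p T :=
  GradedOps.kosExact_of_sum_eq (a := fun i => AddMonoidHom.mulLeft (b i)) (fun _ _ _ _ => AddSubgroup.mem_top _)
    (fun i j c => by simp [mul_left_comm]) (fun c => by
      simp only [AddMonoidHom.coe_mulLeft, ← mul_assoc, ← Finset.sum_mul, h, one_mul]) p T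

/-- Rank–nullity for a linear map restricted to a submodule. -/
theorem finrank_eq_finrank_map_add_finrank_inf_ker {V W : Type*} [AddCommGroup V] [Module K V]
    [AddCommGroup W] [Module K W] (φ : V →ₗ[K] W) (G : Submodule K V) [Module.Finite K G] :
    Module.finrank K G =
      Module.finrank K (G.map φ) + Module.finrank K (G ⊓ LinearMap.ker φ : Submodule K V) := by
  rw [← (φ.domRestrict G).finrank_range_add_finrank_ker]
  congr 1
  · rw [LinearMap.range_domRestrict]
  · have : (LinearMap.ker (φ.domRestrict G)).map G.subtype = G ⊓ LinearMap.ker φ := by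
      ext v
      simp [and_comm, LinearMap.domRestrict_apply]
    rw [← this, Submodule.finrank_map_subtype_eq]

/-- The degree `T` piece of a free module is the product of the pieces of its summands. -/
noncomputable def freePieceEquiv {m : ℕ} (d : Fin m → ℤ) (T : ℤ) :
    freePiece (K := K) d T ≃ₗ[K] ∀ j, homPiece K (T - d j) where
  toFun w j := ⟨w.1 j, mem_freePiece.1 w.2 j⟩
  invFun w := ⟨fun j => w j, mem_freePiece.2 fun j => (w j).2⟩
  map_add' _ _ := rfl
  map_smul' _ _ := rfl

instance finite_freePiece {m : ℕ} (d : Fin m → ℤ) (T : ℤ) :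
    Module.Finite K (freePiece (K := K) d T) :=
  Module.Finite.equiv (freePieceEquiv d T).symm

theorem finrank_freePiece {m : ℕ} (d : Fin m → ℤ) (T : ℤ) :
    Module.finrank K (freePiece (K := K) d T) = ∑ j, Module.finrank K (homPiece K (T - d j)) := by
  rw [(freePieceEquiv d T).finrank_eq, Module.finrank_pi_fintype]

end HomPiece

section Low
variable {K : Type*} [Field K]

theorem six_mul_finrank_homPiece {T : ℤ} (hT : -3 ≤ T) :
    (6 * Module.finrank K (homPiece K T) : ℤ) = (T + 1) * (T + 2) * (T + 3) := by
  rcases lt_or_ge T 0 with h | h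
  · rw [homPiece_of_neg h, finrank_bot]
    obtain rfl | rfl | rfl : T = -1 ∨ T = -2 ∨ T = -3 := by lia
    all_goals norm_num
  · lift T to ℕ using h
    rw [finrank_homPiece_natCast, mul_comm]
    have := Nat.descFactorial_eq_factorial_mul_choose (T + 3) 3
    simp only [Nat.descFactorial_succ, Nat.descFactorial_zero, Nat.factorial] at this
    have h' : (T + 1) * (T + 2) * (T + 3) = (T + 3).choose 3 * 6 := by
      rw [show T + 3 - 2 = T + 1 by lia, show T + 3 - 1 = T + 2 by lia, Nat.sub_zero] at this
      linarith
    exact_mod_cast h'.symm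

/-- Evaluation of polynomials at finitely many vectors. -/
noncomputable def evalAt {n : ℕ} (v : Fin n → Fin 4 → K) :
    MvPolynomial (Fin 4) K →ₗ[K] (Fin n → K) :=
  LinearMap.pi fun j => (aeval (v j) : MvPolynomial (Fin 4) K →ₐ[K] K).toLinearMap

theorem evalAt_apply {n : ℕ} (v : Fin n → Fin 4 → K) (p : MvPolynomial (Fin 4) K) (j : Fin n) :
    evalAt v p j = eval (v j) p := by
  simp [evalAt, aeval_eq_eval]

/-- The forms of degree `T` vanishing at the given vectors. -/
noncomputable def idealPiece {n : ℕ} (v : Fin n → Fin 4 → K) (T : ℤ) :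
    Submodule K (MvPolynomial (Fin 4) K) := homPiece K T ⊓ LinearMap.ker (evalAt v)

theorem mem_idealPiece {n : ℕ} {v : Fin n → Fin 4 → K} {T : ℤ} {p : MvPolynomial (Fin 4) K} :
    p ∈ idealPiece v T ↔ p ∈ homPiece K T ∧ ∀ j, eval (v j) p = 0 := by
  simp [idealPiece, funext_iff, evalAt_apply]

instance {n : ℕ} (v : Fin n → Fin 4 → K) (T : ℤ) : Module.Finite K (idealPiece v T) :=
  Submodule.finiteDimensional_of_le inf_le_left

theorem mul_mem_idealPiece {n : ℕ} {v : Fin n → Fin 4 → K} {S T : ℤ} {p q : MvPolynomial (Fin 4) K}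
    (hp : p ∈ homPiece K S) (hq : q ∈ idealPiece v T) : p * q ∈ idealPiece v (S + T) := by
  rw [mem_idealPiece] at hq ⊢
  exact ⟨mul_mem_homPiece hp hq.1, fun j => by rw [map_mul, hq.2 j, mul_zero]⟩

/-- The map from a free module defined by a family of elements. -/
noncomputable def rowMap {m : ℕ} {M : Type*} [AddCommGroup M] [Module (MvPolynomial (Fin 4) K) M]
    (e : Fin m → M) : (Fin m → MvPolynomial (Fin 4) K) →ₗ[MvPolynomial (Fin 4) K] M :=
  Fintype.linearCombination _ e

theorem rowMap_apply {m : ℕ} {M : Type*} [AddCommGroup M] [Module (MvPolynomial (Fin 4) K) M]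
    (e : Fin m → M) (w : Fin m → MvPolynomial (Fin 4) K) : rowMap e w = ∑ j, w j • e j := rfl

theorem rowMap_mem {m : ℕ} {M : Type*} [AddCommGroup M] [Module (MvPolynomial (Fin 4) K) M]
    {N : ℤ → AddSubgroup M} (hN : ∀ {S T p c}, p ∈ homPiece K S → c ∈ N T → p • c ∈ N (S + T))
    {d : Fin m → ℤ} {e : Fin m → M} (he : ∀ j, e j ∈ N (d j)) {T : ℤ}
    {w : Fin m → MvPolynomial (Fin 4) K} (hw : w ∈ freePiece d T) : rowMap e w ∈ N T := by
  rw [rowMap_apply]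
  refine sum_mem fun j _ => ?_
  have := hN (mem_freePiece.1 hw j) (he j)
  rwa [sub_add_cancel] at this

/-- The syzygies of degree `T` of a family of elements. -/
noncomputable def syzPiece {m : ℕ} {M : Type*} [AddCommGroup M] [Module (MvPolynomial (Fin 4) K) M]
    [Module K M] [IsScalarTower K (MvPolynomial (Fin 4) K) M] (d : Fin m → ℤ) (e : Fin m → M)
    (T : ℤ) : Submodule K (Fin m → MvPolynomial (Fin 4) K) :=
  freePiece d T ⊓ LinearMap.ker ((rowMap e).restrictScalars K)

theorem mem_syzPiece {m : ℕ} {M : Type*} [AddCommGroup M] [Module (MvPolynomial (Fin 4) K) M]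
    [Module K M] [IsScalarTower K (MvPolynomial (Fin 4) K) M] {d : Fin m → ℤ} {e : Fin m → M}
    {T : ℤ} {w : Fin m → MvPolynomial (Fin 4) K} :
    w ∈ syzPiece d e T ↔ w ∈ freePiece d T ∧ rowMap e w = 0 := Iff.rfl

instance {m : ℕ} {M : Type*} [AddCommGroup M] [Module (MvPolynomial (Fin 4) K) M]
    [Module K M] [IsScalarTower K (MvPolynomial (Fin 4) K) M] (d : Fin m → ℤ) (e : Fin m → M)
    (T : ℤ) : Module.Finite K (syzPiece (K := K) d e T) :=
  Submodule.finiteDimensional_of_le inf_le_left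

theorem finrank_freePiece_eq {m : ℕ} {M : Type*} [AddCommGroup M]
    [Module (MvPolynomial (Fin 4) K) M] [Module K M] [IsScalarTower K (MvPolynomial (Fin 4) K) M]
    (d : Fin m → ℤ) (e : Fin m → M) (T : ℤ) :
    Module.finrank K (freePiece (K := K) d T) =
      Module.finrank K ((freePiece d T).map ((rowMap e).restrictScalars K)) +
        Module.finrank K (syzPiece (K := K) d e T) :=
  finrank_eq_finrank_map_add_finrank_inf_ker _ _

/-- A rigid configuration of vectors on an irreducible cubic cone, of the expected size. -/
structure RigidConfig {n : ℕ} (a : ℕ) (f : MvPolynomial (Fin 4) K) (v : Fin n → Fin 4 → K) :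
    Prop where
  three_le : 3 ≤ a
  homog : f.IsHomogeneous 3
  prime : Prime f
  rigid : KoszulRigid a f v
  vanish : ∀ j, eval (v j) f = 0
  ne_zero : ∀ j, v j ≠ 0
  card : (2 * n : ℤ) = 3 * (a * (a - 1)) + 4 * a

namespace RigidConfig
variable {n a : ℕ} {f : MvPolynomial (Fin 4) K} {v : Fin n → Fin 4 → K}

theorem f_mem (h : RigidConfig a f v) : f ∈ idealPiece v 3 :=
  mem_idealPiece.2 ⟨mem_homPiece_natCast.2 h.homog, h.vanish⟩

theorem not_dvd_X (h : RigidConfig a f v) (i : Fin 4) : ¬ f ∣ X i := fun hd =>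
  X_ne_zero i (eq_zero_of_dvd_of_degree_lt h.homog (isHomogeneous_X K i) hd (by norm_num))

theorem exists_eq_mul (h : RigidConfig a f v) {T : ℤ} {p : MvPolynomial (Fin 4) K}
    (hp : p ∈ homPiece K T) (hd : f ∣ p) : ∃ q ∈ homPiece K (T - 3), p = f * q := by
  rcases lt_or_ge T 0 with hT | hT
  · rw [homPiece_of_neg hT, Submodule.mem_bot] at hp
    exact ⟨0, zero_mem _, by rw [hp, mul_zero]⟩
  lift T to ℕ using hT
  rw [mem_homPiece_natCast] at hp
  rcases lt_or_ge T 3 with hT | hT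
  · exact ⟨0, zero_mem _, by rw [eq_zero_of_dvd_of_degree_lt h.homog hp hd hT, mul_zero]⟩
  · obtain ⟨T, rfl⟩ := Nat.exists_eq_add_of_le hT
    obtain ⟨q, hq, rfl⟩ := exists_homogeneous_of_dvd h.homog hp hd
    exact ⟨q, by push_cast; rw [add_sub_cancel_left]; exact mem_homPiece_natCast.2 hq, rfl⟩

/-- Rigid configurations admit forms of degree `a` separating the vectors, via a dimension count
for relations with prescribed values. -/
theorem exists_relation (h : RigidConfig a f v) (y : Fin n → Fin 4 → K)
    (hy : ∀ j, ∑ c, v j c * y j c = 0) :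
    ∃ F : Fin 4 → MvPolynomial (Fin 4) K, (∀ c, F c ∈ homPiece K a) ∧
      ∀ j c, eval (v j) (F c) = y j c := by
  let d : Fin 5 → ℤ := ![1, 1, 1, 1, 3]
  let e : Fin 5 → MvPolynomial (Fin 4) K := ![X 0, X 1, X 2, X 3, -f]
  have ha := h.three_le
  have h1 := finrank_freePiece_eq (K := K) d e (a + 1)
  have h2 : Module.finrank K ((freePiece d (a + 1)).map ((rowMap e).restrictScalars K)) ≤
      Module.finrank K (homPiece K ((a : ℤ) + 1)) := by
    refine Submodule.finrank_mono (Submodule.map_le_iff_le_comap.2 fun w hw => ?_)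
    refine rowMap_mem (N := fun T => (homPiece K T).toAddSubgroup) mul_mem_homPiece
      (fun j => ?_) hw
    have hf : -f ∈ homPiece K 3 := neg_mem (mem_idealPiece.1 h.f_mem).1
    fin_cases j
    exacts [X_mem_homPiece 0, X_mem_homPiece 1, X_mem_homPiece 2, X_mem_homPiece 3, hf]
  let ε : (Fin 5 → MvPolynomial (Fin 4) K) →ₗ[K] (Fin n → Fin 4 → K) :=
    LinearMap.pi fun j => LinearMap.pi fun c => (LinearMap.proj j) ∘ₗ (evalAt v) ∘ₗ
      (LinearMap.proj c.castSucc)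
  have hε (w j c) : ε w j c = eval (v j) (w c.castSucc) := evalAt_apply _ _ _
  have h3 := finrank_eq_finrank_map_add_finrank_inf_ker ε (syzPiece d e (a + 1))
  have hsyz {w} (hw : w ∈ syzPiece d e (a + 1)) :
      (∀ c : Fin 4, w c.castSucc ∈ homPiece K a) ∧
        ∑ c : Fin 4, X c * w c.castSucc = f * w (Fin.last 4) := by
    obtain ⟨hw, hw'⟩ := mem_syzPiece.1 hw
    refine ⟨fun c => ?_, ?_⟩
    · have := mem_freePiece.1 hw c.castSucc
      have hd : d c.castSucc = 1 := by fin_cases c <;> rfl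
      rwa [hd, add_sub_cancel_right] at this
    · rw [rowMap_apply, Fin.sum_univ_castSucc] at hw'
      simp only [Fin.sum_univ_four, smul_eq_mul] at hw' ⊢
      simp only [e, Fin.castSucc_zero, Fin.castSucc_one] at hw'
      have : w 0 * X 0 + w 1 * X 1 + w (Fin.castSucc 2) * X 2 + w (Fin.castSucc 3) * X 3 +
        w (Fin.last 4) * (-f) = 0 := hw'
      simp only [Fin.castSucc_zero, Fin.castSucc_one]
      linear_combination this
  let ρ : (Fin 4 → MvPolynomial (Fin 4) K) →ₗ[MvPolynomial (Fin 4) K]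
      (Fin 5 → MvPolynomial (Fin 4) K) :=
    rowMap fun c : Fin 4 => (Fin.snoc (Pi.single c f) (X c) : Fin 5 → MvPolynomial (Fin 4) K)
  have h4 : Module.finrank K (syzPiece d e (a + 1) ⊓ LinearMap.ker ε : Submodule K _) ≤
      Module.finrank K (freePiece (K := K) (fun _ : Fin 4 => 3) a) := by
    refine le_trans (Submodule.finrank_mono (t := (freePiece (K := K) (fun _ : Fin 4 => 3) a).map
      (ρ.restrictScalars K)) fun w hw => ?_) (Submodule.finrank_map_le _ _)
    obtain ⟨hw, hw'⟩ := hw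
    obtain ⟨hw, hs⟩ := hsyz hw
    have hdvd := h.rigid (fun c => w c.castSucc) (fun c => mem_homPiece_natCast.1 (hw c))
      ⟨_, hs⟩ fun j c => by
        rw [← hε]; exact congrFun (congrFun (LinearMap.mem_ker.1 hw') j) c
    choose q hq hwq using fun c => h.exists_eq_mul (hw c) (hdvd c)
    refine ⟨q, mem_freePiece.2 hq, ?_⟩
    have hlast : ∑ c, X c * q c = w (Fin.last 4) := by
      refine mul_left_cancel₀ h.prime.ne_zero (hs.symm.trans ?_).symm
      rw [Finset.mul_sum]
      exact Finset.sum_congr rfl fun c _ => by rw [hwq c]; ring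
    funext j
    change ρ q j = w j
    rw [rowMap_apply, Finset.sum_apply]
    refine Fin.lastCases ?_ (fun c => ?_) j
    · rw [← hlast]
      exact Finset.sum_congr rfl fun c _ => by
        rw [Pi.smul_apply, Fin.snoc_last, smul_eq_mul, mul_comm]
    · rw [hwq c]
      simp [Pi.single_apply, mul_comm]
  let Y : (Fin n → Fin 4 → K) →ₗ[K] (Fin n → K) :=
    LinearMap.pi fun j => ∑ c, v j c • (LinearMap.proj (R := K) (φ := fun _ : Fin 4 => K) c ∘ₗ
      LinearMap.proj (φ := fun _ : Fin n => Fin 4 → K) j)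
  have hY (y j) : Y y j = ∑ c, v j c * y j c := by simp [Y, LinearMap.sum_apply]
  have h5 : Module.finrank K (LinearMap.ker Y) + n = 4 * n := by
    have hsurj : LinearMap.range Y = ⊤ := by
      refine LinearMap.range_eq_top.2 fun z => ?_
      choose c hc using fun j => Function.ne_iff.1 (h.ne_zero j)
      refine ⟨fun j => Pi.single (c j) (z j / v j (c j)), funext fun j => ?_⟩
      rw [hY]
      simp only [Pi.single_apply, mul_ite, mul_zero, Finset.sum_ite_eq', Finset.mem_univ, if_true]
      exact mul_div_cancel₀ _ (hc j)
    have := Y.finrank_range_add_finrank_ker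
    rw [hsurj, finrank_top] at this
    simp only [Module.finrank_pi_fintype, Module.finrank_self, Finset.sum_const, Finset.card_univ,
      Fintype.card_fin, smul_eq_mul, mul_one] at this
    lia
  have h6 : (syzPiece d e (a + 1)).map ε ≤ LinearMap.ker Y := by
    rintro _ ⟨w, hw, rfl⟩
    rw [LinearMap.mem_ker]
    funext j
    have := congrArg (eval (v j)) (hsyz hw).2
    rw [map_sum, map_mul, h.vanish j, zero_mul] at this
    rw [hY]
    simpa [hε] using this
  have h7 : (syzPiece d e (a + 1)).map ε = LinearMap.ker Y := by
    refine Submodule.eq_of_le_of_finrank_le h6 ?_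
    have hG : Module.finrank K (freePiece (K := K) d (a + 1)) =
        4 * Module.finrank K (homPiece K a) + Module.finrank K (homPiece K ((a : ℤ) - 2)) := by
      have hs : ((a : ℤ) + 1 - 3) = a - 2 := by ring
      rw [finrank_freePiece, Fin.sum_univ_castSucc, Fin.sum_univ_four]
      change Module.finrank K (homPiece K ((a : ℤ) + 1 - 1)) +
        Module.finrank K (homPiece K ((a : ℤ) + 1 - 1)) +
        Module.finrank K (homPiece K ((a : ℤ) + 1 - 1)) +
        Module.finrank K (homPiece K ((a : ℤ) + 1 - 1)) +
        Module.finrank K (homPiece K ((a : ℤ) + 1 - 3)) = _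
      rw [add_sub_cancel_right, hs]
      ring
    rw [finrank_freePiece] at h4
    simp only [Finset.sum_const, Finset.card_univ, Fintype.card_fin, smul_eq_mul] at h4
    have e0 := six_mul_finrank_homPiece (K := K) (T := a + 1) (by lia)
    have e1 := six_mul_finrank_homPiece (K := K) (T := a) (by lia)
    have e2 := six_mul_finrank_homPiece (K := K) (T := a - 2) (by lia)
    have e3 := six_mul_finrank_homPiece (K := K) (T := a - 3) (by lia)
    have hn := h.card
    zify at *
    linarith
  have hyk : y ∈ LinearMap.ker Y := LinearMap.mem_ker.2 (funext fun j => (hY y j).trans (hy j))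
  rw [← h7] at hyk
  obtain ⟨w, hw, rfl⟩ := hyk
  exact ⟨fun c => w c.castSucc, (hsyz hw).1, fun j c => (hε w j c).symm⟩

end RigidConfig
end Low

section Low2
variable {K : Type*} [Field K]

theorem exists_orthogonal_ne_zero (u : Fin 4 → K) : ∃ y : Fin 4 → K, y ≠ 0 ∧ ∑ c, u c * y c = 0 := by
  by_cases h : u 0 = 0
  · refine ⟨Pi.single 0 1, by simp, by simp [Pi.single_apply, h]⟩
  · refine ⟨![u 1, -u 0, 0, 0], fun h' => h ?_, ?_⟩
    · simpa using congrFun h' 1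
    · simp [Fin.sum_univ_four]; ring

namespace RigidConfig
variable {n a : ℕ} {f : MvPolynomial (Fin 4) K} {v : Fin n → Fin 4 → K}

theorem exists_separating (h : RigidConfig a f v) (j : Fin n) :
    ∃ p ∈ homPiece K a, ∀ i, eval (v i) p = if i = j then 1 else 0 := by
  obtain ⟨y, hy0, hy⟩ := exists_orthogonal_ne_zero (v j)
  obtain ⟨F, hF, hFy⟩ := h.exists_relation (Pi.single j y) fun i => by
    by_cases hij : i = j
    · subst hij; simpa using hy
    · simp [hij]
  obtain ⟨c, hc⟩ := Function.ne_iff.1 hy0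
  rw [Pi.zero_apply] at hc
  refine ⟨(y c)⁻¹ • F c, Submodule.smul_mem _ _ (hF c), fun i => ?_⟩
  rw [smul_eval, hFy]
  split_ifs with hij
  · subst hij; simp [hc]
  · simp [hij]

theorem exists_evalAt_eq (h : RigidConfig a f v) {T : ℤ} (hT : a ≤ T) (y : Fin n → K) :
    ∃ p ∈ homPiece K T, evalAt v p = y := by
  obtain ⟨k, rfl⟩ := Int.le.dest hT
  choose p hp hpe using h.exists_separating
  choose c hc using fun j => Function.ne_iff.1 (h.ne_zero j)
  refine ⟨∑ j, (y j / v j (c j) ^ k) • (p j * X (c j) ^ k), sum_mem fun j _ =>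
    Submodule.smul_mem _ _ (mul_mem_homPiece (hp j) (mem_homPiece_natCast.2 ?_)), funext fun i => ?_⟩
  · simpa using (isHomogeneous_X K (c j)).pow k
  · rw [evalAt_apply]
    simp only [map_sum, smul_eval, map_mul, hpe, map_pow, eval_X]
    rw [Finset.sum_eq_single i]
    · rw [if_pos rfl, one_mul]
      exact div_mul_cancel₀ _ (pow_ne_zero _ (hc i))
    · intro j _ hj
      rw [if_neg hj.symm]; ring
    · simp

theorem finrank_idealPiece (h : RigidConfig a f v) {T : ℤ} (hT : a ≤ T) :
    Module.finrank K (homPiece K T) = n + Module.finrank K (idealPiece v T) := by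
  have hm : (homPiece K T).map (evalAt v) = ⊤ := by
    refine (Submodule.eq_top_iff').2 fun y => ?_
    obtain ⟨p, hp, rfl⟩ := h.exists_evalAt_eq hT y
    exact ⟨p, hp, rfl⟩
  rw [finrank_eq_finrank_map_add_finrank_inf_ker (evalAt v), hm, finrank_top, Module.finrank_fin_fun]
  rfl

theorem dvd_of_mem_idealPiece (h : RigidConfig a f v) {T : ℤ} (hT : T < a)
    {p : MvPolynomial (Fin 4) K} (hp : p ∈ idealPiece v T) : f ∣ p := by
  obtain ⟨k, hk⟩ := Int.le.dest (Int.lt_iff_add_one_le.1 hT)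
  have hX : (X 0 ^ k : MvPolynomial (Fin 4) K) ∈ homPiece K k :=
    mem_homPiece_natCast.2 (by simpa using (isHomogeneous_X K (0 : Fin 4)).pow k)
  have hq := mul_mem_idealPiece hX hp
  have hmem (i : Fin 4) : X i * (X 0 ^ k * p) ∈ idealPiece v a := by
    have := mul_mem_idealPiece (X_mem_homPiece i) hq
    rwa [show (1 : ℤ) + (k + T) = a by lia] at this
  have key := h.rigid ![X 1 * (X 0 ^ k * p), -(X 0 * (X 0 ^ k * p)), 0, 0]
    (fun c => mem_homPiece_natCast.1 (by
      fin_cases c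
      · exact (mem_idealPiece.1 (hmem 1)).1
      · exact neg_mem (mem_idealPiece.1 (hmem 0)).1
      · exact zero_mem _
      · exact zero_mem _))
    ⟨0, by simp [Fin.sum_univ_four]; ring⟩ (fun j c => by
      fin_cases c
      · exact (mem_idealPiece.1 (hmem 1)).2 j
      · simpa using (mem_idealPiece.1 (hmem 0)).2 j
      · simp
      · simp) 0
  rcases h.prime.dvd_or_dvd key with h1 | h1
  · exact (h.not_dvd_X 1 h1).elim
  rcases h.prime.dvd_or_dvd h1 with h2 | h2
  · exact (h.not_dvd_X 0 (h.prime.dvd_of_dvd_pow h2)).elim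
  · exact h2

/-- The degrees of the minimal generators. -/
def genDeg (a : ℕ) : Fin (a + 1 + 1) → ℤ := Fin.append (fun _ : Fin (a + 1) => (a : ℤ)) fun _ => 3

theorem genDeg_castSucc (i : Fin (a + 1)) : genDeg a i.castSucc = a :=
  Fin.append_left (fun _ => (a : ℤ)) (fun _ : Fin 1 => 3) i

theorem genDeg_last : genDeg a (Fin.last _) = 3 :=
  Fin.append_right (fun _ : Fin (a + 1) => (a : ℤ)) (fun _ : Fin 1 => 3) 0

theorem finrank_freePiece_genDeg (T : ℤ) :
    Module.finrank K (freePiece (K := K) (genDeg a) T) =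
      (a + 1) * Module.finrank K (homPiece K (T - a)) + Module.finrank K (homPiece K (T - 3)) := by
  rw [finrank_freePiece, Fin.sum_univ_castSucc, genDeg_last,
    Finset.sum_congr rfl fun i _ => by rw [genDeg_castSucc], Finset.sum_const, Finset.card_univ,
    Fintype.card_fin, smul_eq_mul]

/-- A family of `a + 1` forms of degree `a` complementing the multiples of `f`. -/
structure IsComplement (f : MvPolynomial (Fin 4) K) (v : Fin n → Fin 4 → K)
    (g : Fin (a + 1) → MvPolynomial (Fin 4) K) : Prop where
  mem : ∀ i, g i ∈ idealPiece v a
  eq_zero : ∀ c : Fin (a + 1) → K, f ∣ ∑ i, c i • g i → c = 0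
  exists_eq : ∀ p ∈ idealPiece v (a : ℤ), ∃ c : Fin (a + 1) → K, ∃ q ∈ homPiece K ((a : ℤ) - 3),
    p = ∑ i, c i • g i + q * f

theorem exists_isComplement (h : RigidConfig a f v) :
    ∃ g : Fin (a + 1) → MvPolynomial (Fin 4) K, IsComplement f v g := by
  have ha := h.three_le
  let J : Submodule K (MvPolynomial (Fin 4) K) :=
    (homPiece K ((a : ℤ) - 3)).map (LinearMap.mulRight K f)
  have hJI : J ≤ idealPiece v a := by
    rintro _ ⟨q, hq, rfl⟩
    have := mul_mem_idealPiece hq h.f_mem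
    rwa [sub_add_cancel] at this
  have hJ : Module.finrank K J = Module.finrank K (homPiece K ((a : ℤ) - 3)) :=
    (LinearEquiv.finrank_eq (Submodule.equivMapOfInjective _
      (fun _ _ hpq => mul_right_cancel₀ h.prime.ne_zero hpq) _)).symm
  obtain ⟨Q, hQ⟩ := Submodule.exists_isCompl J
  have hsup : J ⊔ Q ⊓ idealPiece v a = idealPiece v a := by
    rw [← sup_inf_assoc_of_le Q hJI, hQ.sup_eq_top, top_inf_eq]
  have hinf : J ⊓ (Q ⊓ idealPiece v a) = ⊥ := by
    rw [← inf_assoc, hQ.inf_eq_bot, bot_inf_eq]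
  have : Module.Finite K J := Submodule.finiteDimensional_of_le hJI
  have : Module.Finite K (Q ⊓ idealPiece v a : Submodule K _) :=
    Submodule.finiteDimensional_of_le inf_le_right
  have hdim : Module.finrank K (Q ⊓ idealPiece v a : Submodule K _) = a + 1 := by
    have h1 := Submodule.finrank_sup_add_finrank_inf_eq J (Q ⊓ idealPiece v a)
    rw [hsup, hinf, finrank_bot, hJ] at h1
    have h2 := h.finrank_idealPiece le_rfl
    have e1 := six_mul_finrank_homPiece (K := K) (T := a) (by lia)
    have e2 := six_mul_finrank_homPiece (K := K) (T := a - 3) (by lia)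
    have hn := h.card
    zify at *
    linarith
  let b := Module.finBasisOfFinrankEq K _ hdim
  refine ⟨fun i => b i, fun i => (b i).2.2, fun c hc => ?_, fun p hp => ?_⟩
  · have hmem : ∑ i, c i • (b i : MvPolynomial (Fin 4) K) ∈ Q ⊓ idealPiece v a :=
      sum_mem fun i _ => Submodule.smul_mem _ _ (b i).2
    obtain ⟨q, hq, hpq⟩ := h.exists_eq_mul (mem_idealPiece.1 hmem.2).1 hc
    have h0 : ∑ i, c i • (b i : MvPolynomial (Fin 4) K) ∈ J ⊓ (Q ⊓ idealPiece v a) :=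
      ⟨⟨q, hq, by rw [hpq, LinearMap.mulRight_apply, mul_comm]⟩, hmem⟩
    rw [hinf, Submodule.mem_bot] at h0
    have h1 : ∑ i, c i • b i = 0 := Subtype.ext (by simpa using h0)
    exact funext (Fintype.linearIndependent_iff.1 b.linearIndependent c h1)
  · rw [← hsup] at hp
    obtain ⟨_, ⟨q, hq, rfl⟩, r, hr, rfl⟩ := Submodule.mem_sup.1 hp
    refine ⟨b.repr ⟨r, hr⟩, q, hq, ?_⟩
    have := congrArg Subtype.val (b.sum_repr ⟨r, hr⟩)
    simp only [Submodule.coe_sum, Submodule.coe_smul] at this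
    rw [this, LinearMap.mulRight_apply, add_comm]

theorem _root_.exists_sum_X_of_mem_homPiece {p : MvPolynomial (Fin 4) K} (hp : p ∈ homPiece K 1) :
    ∃ l : Fin 4 → K, p = ∑ c, l c • X c := by
  obtain ⟨b, hb, rfl⟩ := (kosExact_homPiece (p := 0) (T := 1) fun _ => one_ne_zero).exists_sum hp
  have hb' (i) : ∃ c, b i = C c := exists_eq_C_of_isHomogeneous_zero
    (mem_homPiece_natCast.1 (by simpa using hb i))
  choose l hl using hb'
  exact ⟨l, Finset.sum_congr rfl fun i _ => by rw [hl, mulX_apply, smul_eq_mul, smul_eq_C_mul, mul_comm]⟩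

/-- The generators of the ideal of a rigid configuration. -/
def gens (f : MvPolynomial (Fin 4) K) (g : Fin (a + 1) → MvPolynomial (Fin 4) K) :
    Fin (a + 1 + 1) → MvPolynomial (Fin 4) K := Fin.append g fun _ => f

theorem gens_castSucc (g : Fin (a + 1) → MvPolynomial (Fin 4) K) (i : Fin (a + 1)) :
    gens f g i.castSucc = g i := Fin.append_left g (fun _ : Fin 1 => f) i

theorem gens_last (g : Fin (a + 1) → MvPolynomial (Fin 4) K) : gens f g (Fin.last _) = f :=
  Fin.append_right g (fun _ : Fin 1 => f) 0

theorem rowMap_gens (g : Fin (a + 1) → MvPolynomial (Fin 4) K)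
    (w : Fin (a + 1 + 1) → MvPolynomial (Fin 4) K) :
    rowMap (gens f g) w = ∑ i : Fin (a + 1), w i.castSucc * g i + w (Fin.last _) * f := by
  rw [rowMap_apply, Fin.sum_univ_castSucc]
  simp only [gens_castSucc, gens_last, smul_eq_mul]

theorem mem_freePiece_genDeg {T : ℤ} {w : Fin (a + 1 + 1) → MvPolynomial (Fin 4) K} :
    w ∈ freePiece (genDeg a) T ↔
      (∀ i : Fin (a + 1), w i.castSucc ∈ homPiece K (T - a)) ∧ w (Fin.last _) ∈ homPiece K (T - 3) := by
  simp only [mem_freePiece, Fin.forall_fin_succ', genDeg_castSucc, genDeg_last]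

variable {g : Fin (a + 1) → MvPolynomial (Fin 4) K}

theorem gens_mem (h : RigidConfig a f v) (hg : IsComplement f v g) (j : Fin (a + 1 + 1)) :
    gens f g j ∈ idealPiece v (genDeg a j) := by
  refine Fin.lastCases ?_ (fun i => ?_) j
  · rw [gens_last, genDeg_last]; exact h.f_mem
  · rw [gens_castSucc, genDeg_castSucc]; exact hg.mem i

theorem syzPiece_gens_succ (h : RigidConfig a f v) (hg : IsComplement f v g) :
    syzPiece (K := K) (genDeg a) (gens f g) (a + 1) = ⊥ := by
  refine (Submodule.eq_bot_iff _).2 fun w hw => ?_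
  obtain ⟨hw, hw0⟩ := mem_syzPiece.1 hw
  obtain ⟨hw1, -⟩ := mem_freePiece_genDeg.1 hw
  rw [rowMap_gens] at hw0
  rw [add_sub_cancel_left] at hw1
  choose l hl using fun i => exists_sum_X_of_mem_homPiece (hw1 i)
  have hF (c : Fin 4) : ∑ i, l i c • g i ∈ idealPiece v (a : ℤ) :=
    sum_mem fun i _ => Submodule.smul_mem _ _ (hg.mem i)
  have hsum : ∑ c, X c * ∑ i, l i c • g i = ∑ i, w i.castSucc * g i := by
    simp only [hl, Finset.mul_sum, Finset.sum_mul]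
    rw [Finset.sum_comm]
    refine Finset.sum_congr rfl fun i _ => Finset.sum_congr rfl fun c _ => ?_
    rw [mul_smul_comm, smul_mul_assoc]
  have hd := h.rigid (fun c => ∑ i, l i c • g i)
    (fun c => mem_homPiece_natCast.1 (mem_idealPiece.1 (hF c)).1)
    ⟨-w (Fin.last _), by rw [hsum]; linear_combination hw0⟩ fun j c => (mem_idealPiece.1 (hF c)).2 j
  have hl0 (i c) : l i c = 0 := congrFun (hg.eq_zero (fun i => l i c) (hd c)) i
  have hwi (i) : w (Fin.castSucc i) = 0 := by rw [hl]; simp [hl0]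
  simp only [hwi, zero_mul, Finset.sum_const_zero, zero_add] at hw0
  refine funext fun j => Fin.lastCases ?_ hwi j
  exact (mul_eq_zero.1 hw0).resolve_right h.prime.ne_zero

theorem syzPiece_gens_eq_bot (h : RigidConfig a f v) (hg : IsComplement f v g) {T : ℤ}
    (hT : T ≤ a + 1) : syzPiece (K := K) (genDeg a) (gens f g) T = ⊥ := by
  obtain ⟨k, hk⟩ := Int.le.dest hT
  refine (Submodule.eq_bot_iff _).2 fun w hw => ?_
  obtain ⟨hw, hw0⟩ := mem_syzPiece.1 hw
  have hX : (X 0 ^ k : MvPolynomial (Fin 4) K) ∈ homPiece K k :=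
    mem_homPiece_natCast.2 (by simpa using (isHomogeneous_X K (0 : Fin 4)).pow k)
  have hmem : (X 0 ^ k : MvPolynomial (Fin 4) K) • w ∈
      syzPiece (K := K) (genDeg a) (gens f g) (a + 1) := by
    refine mem_syzPiece.2 ⟨mem_freePiece.2 fun j => ?_, by rw [map_smul, hw0, smul_zero]⟩
    have := mul_mem_homPiece hX (mem_freePiece.1 hw j)
    rwa [show (k : ℤ) + (T - genDeg a j) = a + 1 - genDeg a j by lia] at this
  rw [h.syzPiece_gens_succ hg, Submodule.mem_bot] at hmem
  exact (smul_eq_zero.1 hmem).resolve_left (pow_ne_zero _ (X_ne_zero 0))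

theorem map_freePiece_le (h : RigidConfig a f v) (hg : IsComplement f v g) (T : ℤ) :
    (freePiece (genDeg a) T).map ((rowMap (gens f g)).restrictScalars K) ≤ idealPiece v T := by
  rintro _ ⟨w, hw, rfl⟩
  exact rowMap_mem (N := fun T => (idealPiece v T).toAddSubgroup) mul_mem_idealPiece
    (h.gens_mem hg) hw

/-- The chosen elements generate the ideal in degrees up to `a + 1`. -/
theorem map_freePiece_of_le (h : RigidConfig a f v) (hg : IsComplement f v g) {T : ℤ}
    (hT : T ≤ a + 1) :
    (freePiece (genDeg a) T).map ((rowMap (gens f g)).restrictScalars K) = idealPiece v T := by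
  have ha := h.three_le
  refine le_antisymm (h.map_freePiece_le hg T) ?_
  rcases lt_trichotomy T a with h1 | rfl | h1
  · intro p hp
    obtain ⟨q, hq, rfl⟩ := h.exists_eq_mul (mem_idealPiece.1 hp).1 (h.dvd_of_mem_idealPiece h1 hp)
    refine ⟨Fin.snoc (fun _ => 0) q, mem_freePiece_genDeg.2 ⟨fun i => ?_, ?_⟩, ?_⟩
    · rw [Fin.snoc_castSucc]; exact zero_mem _
    · rwa [Fin.snoc_last]
    · refine (rowMap_gens g _).trans ?_
      simp [mul_comm]
  · intro p hp
    obtain ⟨c, q, hq, rfl⟩ := hg.exists_eq p hp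
    refine ⟨Fin.snoc (fun i => C (c i)) q, mem_freePiece_genDeg.2 ⟨fun i => ?_, ?_⟩, ?_⟩
    · rw [Fin.snoc_castSucc, sub_self]
      exact mem_homPiece_natCast.2 (isHomogeneous_C _ _)
    · rwa [Fin.snoc_last]
    · refine (rowMap_gens g _).trans ?_
      simp [smul_eq_C_mul]
  · obtain rfl : T = a + 1 := by lia
    refine (Submodule.eq_of_le_of_finrank_le (h.map_freePiece_le hg _) ?_).ge
    have h1 := finrank_freePiece_eq (K := K) (genDeg a) (gens f g) (a + 1)
    rw [h.syzPiece_gens_succ hg, finrank_bot, add_zero, finrank_freePiece_genDeg,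
      add_sub_cancel_left] at h1
    rw [← h1]
    have h2 := h.finrank_idealPiece (T := a + 1) (by lia)
    have e1 := six_mul_finrank_homPiece (K := K) (T := a + 1) (by lia)
    have e2 := six_mul_finrank_homPiece (K := K) (T := a + 1 - 3) (by lia)
    have e3 := six_mul_finrank_homPiece (K := K) (T := 1) (by lia)
    have e4 : Module.finrank K (homPiece K 1) = 4 := by lia
    have hn := h.card
    rw [e4]
    zify at *
    linarith

end RigidConfig
end Low2

section Res
variable {K : Type*} [Field K]

section Module
variable {M : Type*} [AddCommGroup M] [Module (MvPolynomial (Fin 4) K) M]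

theorem exists_rowMap_eq {m : ℕ} {d : Fin m → ℤ} {e : Fin m → M} {N : ℤ → AddSubgroup M} {D : ℤ}
    (hN : ∀ T, D < T → KosExact (mulX (K := K) M) N 0 T)
    (hD : ∀ c ∈ N D, ∃ w ∈ freePiece (K := K) d D, rowMap e w = c) {T : ℤ} (hT : D ≤ T) :
    ∀ c ∈ N T, ∃ w ∈ freePiece (K := K) d T, rowMap e w = c :=
  (gradedOps_freePiece d).surj_of_kosExact (x' := mulX (K := K) M) (φ := (rowMap e).toAddMonoidHom)
    (fun i w => (rowMap e).map_smul (X i) w) hN hD hT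

variable [Module K M] [IsScalarTower K (MvPolynomial (Fin 4) K) M]

theorem kosExact_syzPiece {m : ℕ} {d : Fin m → ℤ} {e : Fin m → M} {N : ℤ → AddSubgroup M}
    (hN : ∀ {S T p c}, p ∈ homPiece K S → c ∈ N T → p • c ∈ N (S + T)) (he : ∀ j, e j ∈ N (d j))
    {p T : ℤ} (hT : p = 0 → ∀ j, T ≠ d j) (h : KosExact (mulX (K := K) M) N (p + 1) T)
    (hs : ∀ T, ∀ c ∈ N T, ∃ w ∈ freePiece (K := K) d T, rowMap e w = c) :
    KosExact (mulX (K := K) (Fin m → MvPolynomial (Fin 4) K))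
      (fun T => (syzPiece (K := K) d e T).toAddSubgroup) p T :=
  (gradedOps_freePiece d).kosExact_ker (x' := mulX (K := K) M) (rowMap e).toAddMonoidHom
    (fun i w => (rowMap e).map_smul (X i) w) (fun _ _ hw => rowMap_mem hN he hw)
    (fun _ _ => mem_syzPiece) (kosExact_freePiece hT) h (.inr (hs _))

theorem smul_mem_syzPiece {m : ℕ} {d : Fin m → ℤ} {e : Fin m → M} {S T : ℤ}
    {p : MvPolynomial (Fin 4) K} {w : Fin m → MvPolynomial (Fin 4) K} (hp : p ∈ homPiece K S)
    (hw : w ∈ syzPiece (K := K) d e T) : p • w ∈ syzPiece (K := K) d e (S + T) := by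
  obtain ⟨hw, hw0⟩ := mem_syzPiece.1 hw
  refine mem_syzPiece.2 ⟨mem_freePiece.2 fun j => ?_, by rw [map_smul, hw0, smul_zero]⟩
  rw [add_sub_assoc]
  exact mul_mem_homPiece hp (mem_freePiece.1 hw j)

theorem exists_basis_family {m : ℕ} {P : Submodule K M} [Module.Finite K P]
    (hP : Module.finrank K P = m) (D : ℤ) :
    ∃ e : Fin m → M, (∀ j, e j ∈ P) ∧
      (∀ c ∈ P, ∃ w ∈ freePiece (K := K) (fun _ => D) D, rowMap e w = c) ∧
      syzPiece (K := K) (fun _ => D) e D = ⊥ := by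
  let b := Module.finBasisOfFinrankEq K P hP
  have hb (c : Fin m → K) : rowMap (fun j => (b j : M)) (fun j => C (c j)) =
      ((∑ j, c j • b j : P) : M) := by
    rw [rowMap_apply, Submodule.coe_sum]
    refine Finset.sum_congr rfl fun j _ => ?_
    rw [← algebraMap_eq, algebraMap_smul, Submodule.coe_smul]
  refine ⟨fun j => b j, fun j => (b j).2, fun c hc => ?_, (Submodule.eq_bot_iff _).2 fun w hw => ?_⟩
  · refine ⟨fun j => C (b.repr ⟨c, hc⟩ j), mem_freePiece.2 fun j => ?_, ?_⟩
    · rw [sub_self]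
      exact mem_homPiece_natCast.2 (isHomogeneous_C _ _)
    · rw [hb, b.sum_repr]
  · obtain ⟨hw, hw0⟩ := mem_syzPiece.1 hw
    have hc (j) : ∃ c, w j = C c := exists_eq_C_of_isHomogeneous_zero
      (mem_homPiece_natCast.1 (by simpa using mem_freePiece.1 hw j))
    choose c hc using hc
    obtain rfl : w = fun j => C (c j) := funext hc
    rw [hb] at hw0
    have := Fintype.linearIndependent_iff.1 b.linearIndependent c (Subtype.ext hw0)
    funext j
    simp [this j]

theorem syzPiece_eq_bot_of_lt {m : ℕ} {D : ℤ} {e : Fin m → M} {T : ℤ} (hT : T < D) :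
    syzPiece (K := K) (fun _ => D) e T = ⊥ := by
  refine (Submodule.eq_bot_iff _).2 fun w hw => funext fun j => ?_
  have := mem_freePiece.1 (mem_syzPiece.1 hw).1 j
  rwa [homPiece_of_neg (by lia), Submodule.mem_bot] at this

end Module

namespace RigidConfig
variable {n a : ℕ} {f : MvPolynomial (Fin 4) K} {v : Fin n → Fin 4 → K}
  {g : Fin (a + 1) → MvPolynomial (Fin 4) K}

theorem kosExact_idealPiece (h : RigidConfig a f v) {p T : ℤ} (h0 : p = 0 → T ≠ 0)
    (hT : 3 ≤ p ∨ (a : ℤ) ≤ T - p - 2) :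
    KosExact (mulX (K := K) (MvPolynomial (Fin 4) K))
      (fun T => (idealPiece v T).toAddSubgroup) p T := by
  choose c hc using fun j => Function.ne_iff.1 (h.ne_zero j)
  refine gradedOps_homPiece.kosExact_ker (evalAt v).toAddMonoidHom
    (x' := fun i => AddMonoidHom.mulLeft fun j => v j i) (G' := fun _ => ⊤) (fun i p => ?_)
    (fun _ _ _ => AddSubgroup.mem_top _) (fun _ _ => Iff.rfl) (kosExact_homPiece h0)
    (kosExact_top _ (fun i j => if i = c j then (v j (c j))⁻¹ else 0) (funext fun j => ?_) _ _)
    (hT.imp_right fun hT y _ => h.exists_evalAt_eq hT y)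
  · funext j
    simp [evalAt_apply, mulX_apply]
  · have := hc j
    simp_all

theorem exists_rowMap_gens_eq (h : RigidConfig a f v) (hg : IsComplement f v g) (T : ℤ) :
    ∀ p ∈ idealPiece v T, ∃ w ∈ freePiece (K := K) (genDeg a) T, rowMap (gens f g) w = p := by
  have key {T : ℤ} (hT : T ≤ a + 1) (p) (hp : p ∈ idealPiece v T) :
      ∃ w ∈ freePiece (K := K) (genDeg a) T, rowMap (gens f g) w = p := by
    rwa [← h.map_freePiece_of_le hg hT] at hp
  rcases le_total T (a + 1) with hT | hT
  · exact key hT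
  · exact exists_rowMap_eq (N := fun T => (idealPiece v T).toAddSubgroup)
      (fun T hT => h.kosExact_idealPiece (by lia) (.inr (by lia))) (key le_rfl) hT

theorem map_freePiece_eq (h : RigidConfig a f v) (hg : IsComplement f v g) (T : ℤ) :
    (freePiece (genDeg a) T).map ((rowMap (gens f g)).restrictScalars K) = idealPiece v T :=
  le_antisymm (h.map_freePiece_le hg T) fun p hp => h.exists_rowMap_gens_eq hg T p hp

theorem finrank_syzPiece_gens (h : RigidConfig a f v) (hg : IsComplement f v g) {T : ℤ}
    (hT : a ≤ T) :
    (a + 1) * Module.finrank K (homPiece K (T - a)) + Module.finrank K (homPiece K (T - 3)) + n =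
      Module.finrank K (homPiece K T) +
        Module.finrank K (syzPiece (K := K) (genDeg a) (gens f g) T) := by
  have h1 := finrank_freePiece_eq (K := K) (genDeg a) (gens f g) T
  rw [h.map_freePiece_eq hg, finrank_freePiece_genDeg] at h1
  have h2 := h.finrank_idealPiece hT
  lia

theorem kosExact_syzPiece_gens (h : RigidConfig a f v) (hg : IsComplement f v g) {p T : ℤ}
    (hp : 0 ≤ p) (hT : 2 ≤ p ∨ a + 3 + p ≤ T) :
    KosExact (mulX (K := K) (Fin (a + 1 + 1) → MvPolynomial (Fin 4) K))
      (fun T => (syzPiece (K := K) (genDeg a) (gens f g) T).toAddSubgroup) p T := by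
  have ha := h.three_le
  refine kosExact_syzPiece (N := fun T => (idealPiece v T).toAddSubgroup) mul_mem_idealPiece
    (h.gens_mem hg) (fun h0 j => ?_)
    (h.kosExact_idealPiece (by lia) (by lia)) (h.exists_rowMap_gens_eq hg)
  refine Fin.lastCases ?_ (fun i => ?_) j
  · rw [genDeg_last]; lia
  · rw [genDeg_castSucc]; lia

/-- The graded minimal free resolution of a rigid configuration. -/
theorem exists_resolution (h : RigidConfig a f v) (hg : IsComplement f v g) :
    ∃ (e : Fin (3 * a) → Fin (a + 1 + 1) → MvPolynomial (Fin 4) K)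
      (r : Fin (2 * a - 1) → Fin (3 * a) → MvPolynomial (Fin 4) K),
      (∀ i, e i ∈ syzPiece (K := K) (genDeg a) (gens f g) (a + 2)) ∧
      (∀ l, r l ∈ syzPiece (K := K) (fun _ => (a : ℤ) + 2) e (a + 3)) ∧
      (∀ T, ∀ w ∈ syzPiece (K := K) (genDeg a) (gens f g) T,
        ∃ u ∈ freePiece (K := K) (fun _ => (a : ℤ) + 2) T, rowMap e u = w) ∧
      (∀ T, ∀ u ∈ syzPiece (K := K) (fun _ => (a : ℤ) + 2) e T,
        ∃ t ∈ freePiece (K := K) (fun _ => (a : ℤ) + 3) T, rowMap r t = u) ∧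
      ∀ T, syzPiece (K := K) (fun _ => (a : ℤ) + 3) r T = ⊥ := by
  have ha := h.three_le
  have hn := h.card
  have hd2 : Module.finrank K (syzPiece (K := K) (genDeg a) (gens f g) (a + 2)) = 3 * a := by
    have h1 := h.finrank_syzPiece_gens hg (T := a + 2) (by lia)
    rw [add_sub_cancel_left] at h1
    have e1 := six_mul_finrank_homPiece (K := K) (T := a + 2) (by lia)
    have e2 := six_mul_finrank_homPiece (K := K) (T := a + 2 - 3) (by lia)
    have e3 := six_mul_finrank_homPiece (K := K) (T := 2) (by lia)
    have e4 : Module.finrank K (homPiece K 2) = 10 := by lia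
    rw [e4] at h1
    zify at *
    linarith
  obtain ⟨e, he, hsurj, hbot⟩ := exists_basis_family hd2 (a + 2)
  have hsurj2 (T) : ∀ w ∈ syzPiece (K := K) (genDeg a) (gens f g) T,
      ∃ u ∈ freePiece (K := K) (fun _ => (a : ℤ) + 2) T, rowMap e u = w := by
    rcases lt_or_ge T (a + 2) with hT | hT
    · intro w hw
      rw [h.syzPiece_gens_eq_bot hg (by lia), Submodule.mem_bot] at hw
      exact ⟨0, zero_mem _, by rw [hw, map_zero]⟩
    · exact exists_rowMap_eq (N := fun T => (syzPiece (K := K) (genDeg a) (gens f g) T).toAddSubgroup)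
        (fun T hT => h.kosExact_syzPiece_gens hg le_rfl (.inr (by lia))) hsurj hT
  have hmap2 (T) : (freePiece (fun _ => (a : ℤ) + 2) T).map ((rowMap e).restrictScalars K) =
      syzPiece (K := K) (genDeg a) (gens f g) T := by
    refine le_antisymm ?_ (hsurj2 T)
    rintro _ ⟨w, hw, rfl⟩
    exact rowMap_mem (N := fun T => (syzPiece (K := K) (genDeg a) (gens f g) T).toAddSubgroup)
      smul_mem_syzPiece he hw
  have hkos2 {p T : ℤ} (hp : 0 ≤ p) (hT : 1 ≤ p ∨ a + 4 ≤ T) :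
      KosExact (mulX (K := K) (Fin (3 * a) → MvPolynomial (Fin 4) K))
        (fun T => (syzPiece (K := K) (fun _ => (a : ℤ) + 2) e T).toAddSubgroup) p T :=
    kosExact_syzPiece (N := fun T => (syzPiece (K := K) (genDeg a) (gens f g) T).toAddSubgroup)
      smul_mem_syzPiece he (fun _ _ => by lia)
      (h.kosExact_syzPiece_gens hg (by lia) (by lia)) hsurj2
  have hd3 : Module.finrank K (syzPiece (K := K) (fun _ => (a : ℤ) + 2) e (a + 3)) = 2 * a - 1 := by
    have h1 := h.finrank_syzPiece_gens hg (T := a + 3) (by lia)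
    have h2 := finrank_freePiece_eq (K := K) (fun _ => (a : ℤ) + 2) e (a + 3)
    rw [hmap2, finrank_freePiece, Finset.sum_const, Finset.card_univ, Fintype.card_fin,
      add_sub_add_left_eq_sub, smul_eq_mul, show (3 : ℤ) - 2 = 1 by norm_num] at h2
    rw [add_sub_cancel_left, add_sub_cancel_right] at h1
    have e1 := six_mul_finrank_homPiece (K := K) (T := a + 3) (by lia)
    have e2 := six_mul_finrank_homPiece (K := K) (T := a) (by lia)
    have e3 := six_mul_finrank_homPiece (K := K) (T := 3) (by lia)
    have e4 : Module.finrank K (homPiece K 3) = 20 := by lia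
    have e5 := six_mul_finrank_homPiece (K := K) (T := 1) (by lia)
    have e6 : Module.finrank K (homPiece K 1) = 4 := by lia
    rw [e4] at h1
    rw [e6] at h2
    refine Nat.eq_sub_of_add_eq ?_
    zify at *
    linarith
  obtain ⟨r, hr, hsurj', hbot'⟩ := exists_basis_family hd3 (a + 3)
  have hsurj3 (T) : ∀ u ∈ syzPiece (K := K) (fun _ => (a : ℤ) + 2) e T,
      ∃ t ∈ freePiece (K := K) (fun _ => (a : ℤ) + 3) T, rowMap r t = u := by
    rcases lt_or_ge T (a + 3) with hT | hT
    · intro w hw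
      have h0 : syzPiece (K := K) (fun _ => (a : ℤ) + 2) e T = ⊥ := by
        rcases lt_or_ge T (a + 2) with h1 | h1
        · exact syzPiece_eq_bot_of_lt h1
        · rwa [show T = a + 2 by lia]
      rw [h0, Submodule.mem_bot] at hw
      exact ⟨0, zero_mem _, by rw [hw, map_zero]⟩
    · exact exists_rowMap_eq
        (N := fun T => (syzPiece (K := K) (fun _ => (a : ℤ) + 2) e T).toAddSubgroup)
        (fun T hT => hkos2 le_rfl (.inr (by lia))) hsurj' hT
  have hkos3 {T : ℤ} (hT : T ≠ a + 3) :
      KosExact (mulX (K := K) (Fin (2 * a - 1) → MvPolynomial (Fin 4) K))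
        (fun T => (syzPiece (K := K) (fun _ => (a : ℤ) + 3) r T).toAddSubgroup) 0 T :=
    kosExact_syzPiece
      (N := fun T => (syzPiece (K := K) (fun _ => (a : ℤ) + 2) e T).toAddSubgroup)
      smul_mem_syzPiece hr (fun _ _ => hT) (hkos2 (by lia) (by lia)) hsurj3
  refine ⟨e, r, he, hr, hsurj2, hsurj3, fun T => ?_⟩
  rcases lt_or_ge T (a + 3) with hT | hT
  · exact syzPiece_eq_bot_of_lt hT
  · induction T, hT using Int.leInduction with
    | base => exact hbot'
    | succ T hT ih =>
      refine (Submodule.eq_bot_iff _).2 fun w hw => ?_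
      obtain ⟨b, hb, rfl⟩ := (hkos3 (T := T + 1) (by lia)).exists_sum hw
      refine Finset.sum_eq_zero fun i _ => ?_
      have : b i ∈ syzPiece (K := K) (fun _ => (a : ℤ) + 3) r T := by simpa using hb i
      rw [ih, Submodule.mem_bot] at this
      rw [this, map_zero]

end RigidConfig
end Res

section Ungraded
variable {K : Type*} [Field K]

/-- The homogeneous component of integral degree `T`. -/
noncomputable def intComponent (T : ℤ) : MvPolynomial (Fin 4) K →ₗ[K] MvPolynomial (Fin 4) K :=
  if T < 0 then 0 else homogeneousComponent T.toNat

theorem intComponent_natCast (n : ℕ) (p : MvPolynomial (Fin 4) K) :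
    intComponent (n : ℤ) p = homogeneousComponent n p := by
  rw [intComponent, if_neg (by lia), Int.toNat_natCast]

theorem intComponent_of_neg {T : ℤ} (hT : T < 0) (p : MvPolynomial (Fin 4) K) :
    intComponent T p = 0 := by
  simp [intComponent, hT]

theorem intComponent_mem (T : ℤ) (p : MvPolynomial (Fin 4) K) :
    intComponent T p ∈ homPiece K T := by
  rcases lt_or_ge T 0 with hT | hT
  · rw [intComponent_of_neg hT]; exact zero_mem _
  · lift T to ℕ using hT
    rw [intComponent_natCast]
    exact mem_homPiece_natCast.2 (homogeneousComponent_isHomogeneous _ _)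

theorem coeff_intComponent (T : ℤ) (p : MvPolynomial (Fin 4) K) (m : Fin 4 →₀ ℕ) :
    coeff m (intComponent T p) = if (m.degree : ℤ) = T then coeff m p else 0 := by
  rcases lt_or_ge T 0 with hT | hT
  · rw [intComponent_of_neg hT, coeff_zero, if_neg (by lia)]
  · lift T to ℕ using hT
    rw [intComponent_natCast, coeff_homogeneousComponent]
    simp

theorem intComponent_mul {S T : ℤ} (p : MvPolynomial (Fin 4) K) {q : MvPolynomial (Fin 4) K}
    (hq : q ∈ homPiece K T) : intComponent S (p * q) = intComponent (S - T) p * q := by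
  rcases lt_or_ge T 0 with hT | hT
  · rw [homPiece_of_neg hT, Submodule.mem_bot] at hq
    simp [hq]
  lift T to ℕ using hT
  rw [mem_homPiece_natCast] at hq
  rcases lt_or_ge S 0 with hS | hS
  · rw [intComponent_of_neg hS, intComponent_of_neg (by lia), zero_mul]
  lift S to ℕ using hS
  rw [intComponent_natCast, mul_comm]
  rcases lt_or_ge S T with h | h
  · rw [homogeneousComponent_mul_left_of_lt hq _ h, intComponent_of_neg (by lia), zero_mul]
  · obtain ⟨S, rfl⟩ := Nat.exists_eq_add_of_le h
    rw [homogeneousComponent_mul_left hq, Nat.cast_add, add_sub_cancel_left, intComponent_natCast,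
      mul_comm]

theorem sum_intComponent (p : MvPolynomial (Fin 4) K) {d : ℤ} (hd : 0 ≤ d) {N : ℕ}
    (hN : p.totalDegree + d < N) : ∑ T ∈ Finset.range N, intComponent ((T : ℤ) - d) p = p := by
  lift d to ℕ using hd
  ext m
  simp only [coeff_sum, coeff_intComponent]
  by_cases hm : coeff m p = 0
  · simp [hm]
  · have hle : m.degree ≤ p.totalDegree := le_totalDegree (mem_support_iff.2 hm)
    rw [Finset.sum_eq_single (m.degree + d)]
    · simp
    · intro T _ hT
      rw [if_neg (by lia)]
    · intro hT
      exact absurd (Finset.mem_range.2 (by lia)) hT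

/-- The component of degree `T` of an element of a graded free module. -/
noncomputable def freeComponent {m : ℕ} (d : Fin m → ℤ) (T : ℤ) (w : Fin m → MvPolynomial (Fin 4) K) :
    Fin m → MvPolynomial (Fin 4) K := fun j => intComponent (T - d j) (w j)

theorem freeComponent_mem {m : ℕ} (d : Fin m → ℤ) (T : ℤ) (w : Fin m → MvPolynomial (Fin 4) K) :
    freeComponent d T w ∈ freePiece d T := mem_freePiece.2 fun _ => intComponent_mem _ _

theorem exists_sum_freeComponent {m : ℕ} {d : Fin m → ℤ} (hd : ∀ j, 0 ≤ d j)
    (w : Fin m → MvPolynomial (Fin 4) K) :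
    ∃ N : ℕ, ∑ T ∈ Finset.range N, freeComponent d T w = w := by
  refine ⟨∑ j, ((w j).totalDegree + (d j).toNat) + 1, funext fun j => ?_⟩
  rw [Finset.sum_apply]
  refine sum_intComponent _ (hd j) ?_
  have := Finset.single_le_sum (f := fun j => (w j).totalDegree + (d j).toNat)
    (fun _ _ => Nat.zero_le _) (Finset.mem_univ j)
  have := hd j
  lia

theorem intComponent_rowMap {m : ℕ} {d : Fin m → ℤ} {e : Fin m → MvPolynomial (Fin 4) K}
    (he : ∀ j, e j ∈ homPiece K (d j)) (T : ℤ) (w : Fin m → MvPolynomial (Fin 4) K) :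
    intComponent T (rowMap e w) = rowMap e (freeComponent d T w) := by
  simp only [rowMap_apply, map_sum, smul_eq_mul, freeComponent]
  exact Finset.sum_congr rfl fun j _ => intComponent_mul _ (he j)

theorem freeComponent_rowMap {m l : ℕ} {d : Fin m → ℤ} {d' : Fin l → ℤ}
    {e : Fin m → Fin l → MvPolynomial (Fin 4) K} (he : ∀ j, e j ∈ freePiece d' (d j)) (T : ℤ)
    (w : Fin m → MvPolynomial (Fin 4) K) :
    freeComponent d' T (rowMap e w) = rowMap e (freeComponent d T w) := by
  funext i
  simp only [rowMap_apply, map_sum, smul_eq_mul, freeComponent, Finset.sum_apply, Pi.smul_apply]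
  refine Finset.sum_congr rfl fun j _ => ?_
  rw [intComponent_mul _ (mem_freePiece.1 (he j) i), sub_sub_sub_cancel_right]

theorem exists_rowMap_eq_of_freeComponent {m l : ℕ} {d : Fin l → ℤ} (hd : ∀ j, 0 ≤ d j)
    {e : Fin m → Fin l → MvPolynomial (Fin 4) K} {w : Fin l → MvPolynomial (Fin 4) K}
    (h : ∀ T, ∃ u : Fin m → MvPolynomial (Fin 4) K, rowMap e u = freeComponent d T w) : ∃ u : Fin m → MvPolynomial (Fin 4) K, rowMap e u = w := by
  obtain ⟨N, hN⟩ := exists_sum_freeComponent hd w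
  choose u hu using h
  exact ⟨∑ T ∈ Finset.range N, u T, by simp only [map_sum, hu, hN]⟩

theorem exists_rowMap_eq_of_intComponent {m : ℕ} {e : Fin m → MvPolynomial (Fin 4) K}
    {p : MvPolynomial (Fin 4) K} (h : ∀ T, ∃ u : Fin m → MvPolynomial (Fin 4) K, rowMap e u = intComponent T p) :
    ∃ u : Fin m → MvPolynomial (Fin 4) K, rowMap e u = p := by
  have hN := sum_intComponent p (d := 0) le_rfl (N := p.totalDegree + 1) (by lia)
  choose u hu using h
  refine ⟨∑ T ∈ Finset.range (p.totalDegree + 1), u T, ?_⟩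
  conv_rhs => rw [← hN]
  simp only [map_sum, hu, sub_zero]

theorem eval_smul_of_isHomogeneous {n : ℕ} {p : MvPolynomial (Fin 4) K} (hp : p.IsHomogeneous n)
    (c : K) (u : Fin 4 → K) : eval (c • u) p = c ^ n * eval u p := by
  rw [eval_eq, eval_eq, Finset.mul_sum]
  refine Finset.sum_congr rfl fun m hm => ?_
  have : m.degree = n := by
    rw [Finsupp.degree_eq_weight_one]; exact hp (mem_support_iff.1 hm)
  simp only [Pi.smul_apply, smul_eq_mul, mul_pow, Finset.prod_mul_distrib, Finset.prod_pow_eq_pow_sum]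
  rw [← this, Finsupp.degree_apply]
  ring

theorem eval_smul_eq_sum (p : MvPolynomial (Fin 4) K) (c : K) (u : Fin 4 → K) :
    eval (c • u) p =
      ∑ n ∈ Finset.range (p.totalDegree + 1), eval u (homogeneousComponent n p) * c ^ n := by
  conv_lhs => rw [← sum_homogeneousComponent p]
  rw [map_sum]
  refine Finset.sum_congr rfl fun n _ => ?_
  rw [eval_smul_of_isHomogeneous (homogeneousComponent_isHomogeneous n p), mul_comm]

/-- A polynomial vanishing on a punctured line through the origin has all its homogeneous
components vanishing there. -/
theorem eval_intComponent_eq_zero [Infinite K] {p : MvPolynomial (Fin 4) K} {u : Fin 4 → K}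
    (h : ∀ c : K, c ≠ 0 → eval (c • u) p = 0) (T : ℤ) : eval u (intComponent T p) = 0 := by
  rcases lt_or_ge T 0 with hT | hT
  · rw [intComponent_of_neg hT, map_zero]
  lift T to ℕ using hT
  rw [intComponent_natCast]
  rcases lt_or_ge p.totalDegree T with hT | hT
  · rw [homogeneousComponent_eq_zero _ _ hT, map_zero]
  let Q : Polynomial K := ∑ n ∈ Finset.range (p.totalDegree + 1),
    Polynomial.C (eval u (homogeneousComponent n p)) * Polynomial.X ^ n
  have hQ : Q * Polynomial.X = 0 := by
    refine Polynomial.funext fun c => ?_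
    rcases eq_or_ne c 0 with rfl | hc
    · simp
    · have := h c hc
      rw [eval_smul_eq_sum] at this
      simp [Q, Polynomial.eval_finsetSum, this]
  have := congrArg (Polynomial.coeff · T) ((mul_eq_zero.1 hQ).resolve_right Polynomial.X_ne_zero)
  simpa [Q, Polynomial.finsetSum_coeff, Polynomial.coeff_C_mul, Polynomial.coeff_X_pow,
    Nat.lt_succ_iff.2 hT] using this

end Ungraded

section Points
variable {k : Type} [Field k]

theorem vanishesAt_mk_iff {p : MvPolynomial (Fin 4) k} {u : Fin 4 → k} (hu : u ≠ 0) :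
    VanishesAt k p (Projectivization.mk k u hu) ↔ ∀ c : k, c ≠ 0 → eval (c • u) p = 0 := by
  refine ⟨fun h c hc => h _ (smul_ne_zero hc hu)
    ((Projectivization.mk_eq_mk_iff' k _ _ _ _).2 ⟨c, rfl⟩), fun h w hw hmk => ?_⟩
  obtain ⟨c, rfl⟩ := (Projectivization.mk_eq_mk_iff' k _ _ _ _).1 hmk
  exact h c (left_ne_zero_of_smul hw)

theorem vanishesAt_mk_of_isHomogeneous {p : MvPolynomial (Fin 4) k} {d : ℕ} (hp : p.IsHomogeneous d)
    {u : Fin 4 → k} (hu : u ≠ 0) (h : eval u p = 0) : VanishesAt k p (Projectivization.mk k u hu) :=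
  (vanishesAt_mk_iff hu).2 fun c _ => by rw [eval_smul_of_isHomogeneous hp, h, mul_zero]

theorem mem_pointsIdeal_range {n : ℕ} {Z : Fin n → P3 k} {p : MvPolynomial (Fin 4) k} :
    p ∈ pointsIdeal k (Set.range Z) ↔ ∀ j, VanishesAt k p (Z j) := Set.forall_mem_range

theorem mem_pointsIdeal_of_mem_idealPiece {n d : ℕ} {Z : Fin n → P3 k} {v : Fin n → Fin 4 → k}
    (hv : ∀ j, ∃ h : v j ≠ 0, Projectivization.mk k (v j) h = Z j) {p : MvPolynomial (Fin 4) k}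
    (hp : p ∈ idealPiece v d) : p ∈ pointsIdeal k (Set.range Z) := by
  obtain ⟨hp, hp0⟩ := mem_idealPiece.1 hp
  refine mem_pointsIdeal_range.2 fun j => ?_
  obtain ⟨h, hj⟩ := hv j
  rw [← hj]
  exact vanishesAt_mk_of_isHomogeneous (mem_homPiece_natCast.1 hp) h (hp0 j)

theorem intComponent_mem_idealPiece [Infinite k] {n : ℕ} {Z : Fin n → P3 k} {v : Fin n → Fin 4 → k}
    (hv : ∀ j, ∃ h : v j ≠ 0, Projectivization.mk k (v j) h = Z j) {p : MvPolynomial (Fin 4) k}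
    (hp : p ∈ pointsIdeal k (Set.range Z)) (T : ℤ) : intComponent T p ∈ idealPiece v T := by
  refine mem_idealPiece.2 ⟨intComponent_mem _ _, fun j => ?_⟩
  obtain ⟨h, hj⟩ := hv j
  have := mem_pointsIdeal_range.1 hp j
  rw [← hj] at this
  exact eval_intComponent_eq_zero ((vanishesAt_mk_iff h).1 this) T

theorem entryOk_of_mem_homPiece {d e : ℕ} (hde : e < d) {q : MvPolynomial (Fin 4) k}
    (hq : q ∈ homPiece k ((d : ℤ) - e)) : EntryOk k d e q := by
  obtain ⟨c, rfl⟩ := Nat.exists_eq_add_of_lt hde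
  refine ⟨.inr ⟨c + 1, by lia, ?_⟩, ?_⟩
  · rw [show ((e + c + 1 : ℕ) : ℤ) - e = (c + 1 : ℕ) by push_cast; ring] at hq
    exact mem_homPiece_natCast.1 hq
  · by_contra h0
    have := hq 0 h0
    simp at this
    lia

/-- A rigid configuration has the expected minimal free resolution. -/
theorem RigidConfig.hasMinFreeRes3 [Infinite k] {n a : ℕ} {f : MvPolynomial (Fin 4) k}
    {v : Fin n → Fin 4 → k} (h : RigidConfig a f v) {Z : Fin n → P3 k}
    (hv : ∀ j, ∃ h : v j ≠ 0, Projectivization.mk k (v j) h = Z j) :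
    HasMinFreeRes3 k ⊥ (pointsIdeal k (Set.range Z))
      (Fin.append (fun _ : Fin (a + 1) => a) (fun _ : Fin 1 => 3))
      (fun _ : Fin (3 * a) => a + 2) (fun _ : Fin (2 * a - 1) => a + 3) := by
  have ha := h.three_le
  obtain ⟨g, hg⟩ := h.exists_isComplement
  obtain ⟨e, r, he, hr, hge, her, hr0⟩ := h.exists_resolution hg
  set d1 : Fin (a + 1 + 1) → ℕ := Fin.append (fun _ : Fin (a + 1) => a) (fun _ : Fin 1 => 3) with hd1
  have hd : ∀ j, genDeg a j = d1 j := by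
    refine Fin.lastCases ?_ fun i => ?_
    · rw [genDeg_last, show d1 (Fin.last _) = 3 from
        Fin.append_right (fun _ : Fin (a + 1) => a) (fun _ : Fin 1 => 3) 0]
      rfl
    · rw [genDeg_castSucc, show d1 i.castSucc = a from
        Fin.append_left (fun _ : Fin (a + 1) => a) (fun _ : Fin 1 => 3) i]
  have hd1lt : ∀ j, d1 j < a + 2 := by
    refine Fin.lastCases ?_ fun i => ?_
    · have := hd (Fin.last _)
      rw [genDeg_last] at this; lia
    · have := hd i.castSucc
      rw [genDeg_castSucc] at this; lia
  have hgd (j) : gens f g j ∈ idealPiece v (d1 j) := by rw [← hd]; exact h.gens_mem hg j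
  have hgen0 (j) : 0 ≤ genDeg a j := by rw [hd]; lia
  have hrow {m} (w : Fin m → MvPolynomial (Fin 4) k) (x : Fin m → MvPolynomial (Fin 4) k) :
      ∑ j, w j * x j = rowMap x w := rfl
  have hcol {m l} (u : Fin m → MvPolynomial (Fin 4) k) (y : Fin m → Fin l → MvPolynomial (Fin 4) k)
      (j) : ∑ i, u i * y i j = rowMap y u j := by
    simp [rowMap_apply]
  have hge0 (i) : rowMap (gens f g) (e i) = 0 := (mem_syzPiece.1 (he i)).2
  have her0 (l) : rowMap e (r l) = 0 := (mem_syzPiece.1 (hr l)).2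
  refine ⟨gens f g, e, r, fun j => ⟨mem_pointsIdeal_of_mem_idealPiece hv (hgd j),
    mem_homPiece_natCast.1 (mem_idealPiece.1 (hgd j)).1⟩, fun x hx => ?_, fun i j => ?_,
    fun l i => ?_, fun w => ?_, fun u => ?_, fun t ht => ?_⟩
  · obtain ⟨w, hw⟩ := exists_rowMap_eq_of_intComponent (e := gens f g) (p := x) fun T => by
      obtain ⟨w, -, hw⟩ := h.exists_rowMap_gens_eq hg T _ (intComponent_mem_idealPiece hv hx T)
      exact ⟨w, hw⟩
    exact ⟨w, by rw [hrow, hw, sub_self]; exact zero_mem _⟩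
  · refine entryOk_of_mem_homPiece (hd1lt j) ?_
    have := mem_freePiece.1 (mem_syzPiece.1 (he i)).1 j
    rw [hd] at this
    exact_mod_cast this
  · refine entryOk_of_mem_homPiece (by lia) ?_
    exact_mod_cast mem_freePiece.1 (mem_syzPiece.1 (hr l)).1 i
  · rw [hrow, Ideal.mem_bot]
    simp only [hcol, ← _root_.funext_iff]
    refine ⟨fun hw => ?_, ?_⟩
    · obtain ⟨u, hu⟩ := exists_rowMap_eq_of_freeComponent (e := e) hgen0 (w := w) fun T => by
        obtain ⟨u, -, hu⟩ := hge T (freeComponent (genDeg a) T w)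
          (mem_syzPiece.2 ⟨freeComponent_mem _ _ _, by
            rw [← intComponent_rowMap fun j => (mem_idealPiece.1 (h.gens_mem hg j)).1, hw, map_zero]⟩)
        exact ⟨u, hu⟩
      exact ⟨u, hu.symm⟩
    · rintro ⟨u, rfl⟩
      rw [rowMap_apply e, map_sum]
      simp only [map_smul, hge0, smul_zero, Finset.sum_const_zero]
  · simp only [hcol, ← _root_.funext_iff]
    refine ⟨fun hu => ?_, ?_⟩
    · obtain ⟨t, ht⟩ := exists_rowMap_eq_of_freeComponent (e := r) (d := fun _ => (a : ℤ) + 2)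
        (fun _ => by lia) (w := u) fun T => by
        obtain ⟨t, -, ht⟩ := her T (freeComponent (fun _ => (a : ℤ) + 2) T u)
          (mem_syzPiece.2 ⟨freeComponent_mem _ _ _, by
            rw [← freeComponent_rowMap (d' := genDeg a) fun j => (mem_syzPiece.1 (he j)).1]
            rw [show rowMap e u = 0 from hu]
            funext j
            simp [freeComponent]⟩)
        exact ⟨t, ht⟩
      exact ⟨t, ht.symm⟩
    · rintro ⟨t, rfl⟩
      rw [rowMap_apply r, map_sum]
      simp only [map_smul, her0, smul_zero, Finset.sum_const_zero]
      rfl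
  · simp only [hcol] at ht
    obtain ⟨N, hN⟩ := exists_sum_freeComponent (d := fun _ => (a : ℤ) + 3) (fun _ => by lia) t
    rw [← hN]
    refine Finset.sum_eq_zero fun T _ => ?_
    have : freeComponent (fun _ => (a : ℤ) + 3) T t ∈
        syzPiece (K := k) (fun _ => (a : ℤ) + 3) r T := mem_syzPiece.2 ⟨freeComponent_mem _ _ _, by
      rw [← freeComponent_rowMap (d' := fun _ => (a : ℤ) + 2) fun j => (mem_syzPiece.1 (hr j)).1]
      rw [show rowMap r t = 0 from funext ht]
      funext j
      simp [freeComponent]⟩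
    rwa [hr0, Submodule.mem_bot] at this

theorem RigidConfig.injective_mk {n a : ℕ} {f : MvPolynomial (Fin 4) k} {v : Fin n → Fin 4 → k}
    (h : RigidConfig a f v) :
    Function.Injective fun j => Projectivization.mk k (v j) (h.ne_zero j) := by
  intro i j hij
  by_contra hne
  obtain ⟨c, hc⟩ := (Projectivization.mk_eq_mk_iff' k _ _ _ _).1 hij
  obtain ⟨p, hp, hpe⟩ := h.exists_separating i
  have h1 := hpe i
  rw [← hc, eval_smul_of_isHomogeneous (mem_homPiece_natCast.1 hp), hpe j,
    if_neg (fun h => hne h.symm), mul_zero, if_pos rfl] at h1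
  exact zero_ne_one h1

end Points

/-- For `a ≥ 3`, a general set `Z` of `n(a) = (3/2)a(a-1) + 2a` points on a
smooth cubic surface `X ⊂ ℙ³` has graded minimal free resolution
`0 → R(-a-3)^(2a-1) → R(-a-2)^(3a) → R(-a)^(a+1) ⊕ R(-3) → I_Z → 0`. -/
theorem mrc_cubic_resolution_n (k : Type) [Field k] [IsAlgClosed k]
    (S : SmoothCubicSurface k) (a : ℕ) (ha : 3 ≤ a) :
    GeneralPointsSatisfy k S (3 * (a * (a - 1) / 2) + 2 * a) (fun Z =>
      HasMinFreeRes3 k ⊥ (pointsIdeal k (Set.range Z))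
        (Fin.append (fun _ : Fin (a + 1) => a) (fun _ : Fin (1) => 3))
        (fun _ : Fin (3 * a) => a + 2)
        (fun _ : Fin (2 * a - 1) => a + 3)) := by
  have hcard : (2 * (3 * (a * (a - 1) / 2) + 2 * a : ℕ) : ℤ) = 3 * (a * (a - 1)) + 4 * a := by
    have h2 : 2 * (a * (a - 1) / 2) = a * (a - 1) :=
      Nat.mul_div_cancel' (Nat.even_mul_pred_self a).two_dvd
    obtain ⟨b, rfl⟩ := Nat.exists_eq_add_of_le ha
    rw [show 3 + b - 1 = 2 + b by lia] at *
    zify at h2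
    push_cast
    linarith
  have hconfig {v : Fin (3 * (a * (a - 1) / 2) + 2 * a) → Fin 4 → k} (hr : KoszulRigid a S.f v)
      (hv : ∀ j, eval (v j) S.f = 0) (h0 : ∀ j, v j ≠ 0) : RigidConfig a S.f v :=
    ⟨ha, S.homog, S.irred.prime, hr, hv, h0, hcard⟩
  obtain ⟨v₀, hv₀, hv₀'⟩ := exists_koszulRigid_of_smooth S.homog S.smooth ha
  have h₀ := hconfig hv₀ (fun j => (hv₀' j).1) fun j => (hv₀' j).2
  obtain ⟨E, M, hdet, hE⟩ := hv₀.exists_det ha S.irred.ne_zero S.homog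
  let P := MvPolynomial (Fin (3 * (a * (a - 1) / 2) + 2 * a) × Fin 4) k
  let D : P := (E.map (algebraMap k P) * relMatrix a (map (algebraMap k P) S.f)
    (fun j i => X (j, i)) + M.map (algebraMap k P)).det
  have hD (v : Fin (3 * (a * (a - 1) / 2) + 2 * a) → Fin 4 → k) :
      eval (fun q => v q.1 q.2) D = (E * relMatrix a S.f v + M).det := by
    have := map_relMatrix_det (K := k) (aeval (fun q => v q.1 q.2) : P →ₐ[k] k) E M
      (map (algebraMap k P) S.f) (fun j i => X (j, i))
    have hid : ((algebraMap k k : k →+* k) : k → k) = id := rfl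
    have hid' : ((aeval (fun q => v q.1 q.2) : P →ₐ[k] k) : P →+* k).comp (algebraMap k P) =
      RingHom.id k := AlgHom.comp_algebraMap _
    rw [map_map, hid', map_id] at this
    simp only [aeval_X, aeval_eq_eval, hid, Matrix.map_id] at this
    exact this
  refine ⟨D, ⟨fun j => Projectivization.mk k (v₀ j) (h₀.ne_zero j), ⟨h₀.injective_mk, fun j =>
    vanishesAt_mk_of_isHomogeneous S.homog _ (h₀.vanish j)⟩, v₀, fun j => ⟨h₀.ne_zero j, rfl⟩, ?_⟩,
    fun Z hZ hZD => ?_⟩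
  · rwa [hD]
  · obtain ⟨v, hv, hvD⟩ := hZD
    rw [hD] at hvD
    have hv0 (j) : eval (v j) S.f = 0 := (hv j).elim fun h hj => hZ.2 j _ h hj
    exact (hconfig (hE _ v S.irred.ne_zero S.homog hv0 hvD) hv0 fun j => (hv j).1).hasMinFreeRes3 hv
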